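/- A finitely generated group Γ has polynomial growth if and only if Γ contains a nilpotent subgroup of finite index. -/

import Mathlib

/-- A group has polynomial growth if for some (finite) generating set `S`, the number of
elements expressible as words of length `≤ k` in `S ∪ S⁻¹` is bounded by a polynomial in
`k`. -/
def HasPolynomialGrowth (G : Type*) [Group G] : Prop :=
  ∃ S : Finset G, Subgroup.closure (S : Set G) = ⊤ ∧
    ∃ C d : ℕ, ∀ k : ℕ, 1 ≤ k →
      Nat.card {g : G | ∃ l : List G, l.length ≤ k ∧
        (∀ a ∈ l, a ∈ S ∨ a⁻¹ ∈ S) ∧ l.prod = g} ≤ C * k ^ d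

namespace Gromov

section Growth

open scoped Pointwise Classical

universe u

/-- Uniform polynomial growth of degree `d` for all finite subsets. -/
def PG (d : ℕ) (G : Type u) [Group G] : Prop :=
  ∀ T : Finset G, ∃ C : ℕ, ∀ k : ℕ, (T ^ k).card ≤ C * (k + 1) ^ d

/-- Weak polynomial growth. -/
def WPG (G : Type u) [Group G] : Prop :=
  ∀ T : Finset G, ∃ C d : ℕ, ∀ k : ℕ, (T ^ k).card ≤ C * (k + 1) ^ d

lemma PG.wpg {d : ℕ} {G : Type u} [Group G] (h : PG d G) : WPG G := fun T => by
  obtain ⟨C, hC⟩ := h T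
  exact ⟨C, d, hC⟩

lemma WPG.dec {G : Type u} [Group G] [i : DecidableEq G] (h : WPG G) (T : Finset G) :
    ∃ C d : ℕ, ∀ k : ℕ, (T ^ k).card ≤ C * (k + 1) ^ d := by
  have hi : i = fun a b => Classical.propDecidable (a = b) := Subsingleton.elim _ _
  subst hi
  exact h T

lemma PG.dec {d : ℕ} {G : Type u} [Group G] [i : DecidableEq G] (h : PG d G) (T : Finset G) :
    ∃ C : ℕ, ∀ k : ℕ, (T ^ k).card ≤ C * (k + 1) ^ d := by
  have hi : i = fun a b => Classical.propDecidable (a = b) := Subsingleton.elim _ _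
  subst hi
  exact h T

lemma PG.of_dec {d : ℕ} {G : Type u} [Group G] [i : DecidableEq G]
    (h : ∀ T : Finset G, ∃ C : ℕ, ∀ k : ℕ, (T ^ k).card ≤ C * (k + 1) ^ d) : PG d G := by
  have hi : i = fun a b => Classical.propDecidable (a = b) := Subsingleton.elim _ _
  subst hi
  exact h

lemma PG.of_injective {d : ℕ} {G H : Type u} [Group G] [Group H] (f : H →* G)
    (hf : Function.Injective f) (h : PG d G) : PG d H := fun T => by
  obtain ⟨C, hC⟩ := h (T.image f)
  refine ⟨C, fun k => ?_⟩
  have := hC k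
  rwa [← Finset.image_pow, Finset.card_image_of_injective _ hf] at this

lemma PG.subgroup {d : ℕ} {G : Type u} [Group G] (h : PG d G) (H : Subgroup G) : PG d H :=
  h.of_injective H.subtype H.subtype_injective

lemma PG.of_surjective {d : ℕ} {G H : Type u} [Group G] [Group H] (f : G →* H)
    (hf : Function.Surjective f) (h : PG d G) : PG d H := fun T => by
  obtain ⟨g, hg⟩ := hf.hasRightInverse
  obtain ⟨C, hC⟩ := h (T.image g)
  refine ⟨C, fun k => le_trans ?_ (hC k)⟩
  have h1 : T = (T.image g).image f := by
    rw [Finset.image_image]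
    conv_lhs => rw [← Finset.image_id (s := T)]
    congr 1
    ext x
    simp [hg x]
  conv_lhs => rw [h1, ← Finset.image_pow]
  exact Finset.card_image_le

lemma WPG.of_injective {G H : Type u} [Group G] [Group H] (f : H →* G)
    (hf : Function.Injective f) (h : WPG G) : WPG H := fun T => by
  obtain ⟨C, d, hC⟩ := h (T.image f)
  refine ⟨C, d, fun k => ?_⟩
  have := hC k
  rwa [← Finset.image_pow, Finset.card_image_of_injective _ hf] at this

lemma exists_pow_of_mem_closure {G : Type u} [Group G] {U : Finset G} (h1 : (1 : G) ∈ U)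
    (hinv : ∀ x ∈ U, x⁻¹ ∈ U) {g : G} (hg : g ∈ Subgroup.closure (U : Set G)) :
    ∃ n : ℕ, g ∈ U ^ n := by
  have hs : ∀ n : ℕ, ∀ x ∈ U ^ n, x⁻¹ ∈ U ^ n := by
    intro n x hx
    have hU : U⁻¹ = U := by
      ext x
      rw [Finset.mem_inv']
      constructor
      · intro h
        simpa using hinv _ h
      · exact hinv x
    have : x⁻¹ ∈ (U ^ n)⁻¹ := by simpa [Finset.mem_inv'] using hx
    rwa [← inv_pow, hU] at this
  induction hg using Subgroup.closure_induction with
  | mem x hx => exact ⟨1, by simpa using hx⟩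
  | one => exact ⟨0, by simp⟩
  | mul x y _ _ hx hy =>
    obtain ⟨n, hn⟩ := hx
    obtain ⟨m, hm⟩ := hy
    exact ⟨n + m, by rw [pow_add]; exact Finset.mul_mem_mul hn hm⟩
  | inv x _ hx =>
    obtain ⟨n, hn⟩ := hx
    exact ⟨n, hs n x hn⟩

lemma exists_subset_pow_of_closure {G : Type u} [Group G] {U : Finset G} (h1 : (1 : G) ∈ U)
    (hinv : ∀ x ∈ U, x⁻¹ ∈ U) (T : Finset G)
    (hT : (T : Set G) ⊆ Subgroup.closure (U : Set G)) :
    ∃ n : ℕ, T ⊆ U ^ n := by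
  induction T using Finset.induction_on with
  | empty => exact ⟨0, by simp⟩
  | insert a s _ ih =>
    obtain ⟨n, hn⟩ := ih (fun x hx => hT (by simp at hx ⊢; tauto))
    obtain ⟨m, hm⟩ := exists_pow_of_mem_closure h1 hinv (hT (show a ∈ _ by simp))
    refine ⟨max n m, ?_⟩
    intro x hx
    rcases Finset.mem_insert.1 hx with rfl | hx
    · exact Finset.pow_subset_pow_right h1 (le_max_right _ _) hm
    · exact Finset.pow_subset_pow_right h1 (le_max_left _ _) (hn hx)

/-- The symmetrised generating set. -/
noncomputable def symmSet {G : Type u} [Group G] (S : Finset G) : Finset G :=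
  insert 1 (S ∪ S⁻¹)

lemma one_mem_symmSet {G : Type u} [Group G] (S : Finset G) : (1 : G) ∈ symmSet S := by
  simp [symmSet]

lemma subset_symmSet {G : Type u} [Group G] (S : Finset G) : S ⊆ symmSet S := by
  intro x hx
  simp [symmSet, hx]

lemma inv_mem_symmSet {G : Type u} [Group G] (S : Finset G) :
    ∀ x ∈ symmSet S, x⁻¹ ∈ symmSet S := by
  intro x hx
  simp only [symmSet, Finset.mem_insert, Finset.mem_union, Finset.mem_inv', inv_eq_one,
    inv_inv] at hx ⊢
  tauto

lemma closure_symmSet {G : Type u} [Group G] (S : Finset G) :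
    Subgroup.closure (symmSet S : Set G) = Subgroup.closure (S : Set G) := by
  apply le_antisymm
  · rw [Subgroup.closure_le]
    intro x hx
    simp only [symmSet, Finset.coe_insert, Set.mem_insert_iff, Finset.mem_coe, Finset.mem_union,
      Finset.mem_inv'] at hx
    rcases hx with rfl | hx | hx
    · exact one_mem _
    · exact Subgroup.subset_closure hx
    · have := Subgroup.inv_mem _ (Subgroup.subset_closure (k := (S : Set G)) hx)
      simpa using this
  · exact Subgroup.closure_mono (by exact_mod_cast subset_symmSet S)

lemma ball_eq {G : Type u} [Group G] (S : Finset G) (k : ℕ) :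
    {g : G | ∃ l : List G, l.length ≤ k ∧ (∀ a ∈ l, a ∈ S ∨ a⁻¹ ∈ S) ∧ l.prod = g} =
      ((symmSet S ^ k : Finset G) : Set G) := by
  ext g
  simp only [Set.mem_setOf_eq, Finset.mem_coe]
  constructor
  · rintro ⟨l, hl, hS, rfl⟩
    refine Finset.pow_subset_pow_right (one_mem_symmSet S) hl ?_
    clear hl
    induction l with
    | nil => simp
    | cons a l ih =>
      simp only [List.prod_cons, List.length_cons, pow_succ']
      refine Finset.mul_mem_mul ?_ (ih fun b hb => hS b (List.mem_cons_of_mem _ hb))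
      have := hS a (by simp)
      simp only [symmSet, Finset.mem_insert, Finset.mem_union, Finset.mem_inv']
      tauto
  · intro hg
    induction k generalizing g with
    | zero =>
      refine ⟨[], by simp, by simp, ?_⟩
      simpa [eq_comm] using hg
    | succ k ih =>
      rw [pow_succ', Finset.mem_mul] at hg
      obtain ⟨a, ha, b, hb, rfl⟩ := hg
      obtain ⟨l, hl, hS, rfl⟩ := ih b hb
      simp only [symmSet, Finset.mem_insert, Finset.mem_union, Finset.mem_inv'] at ha
      rcases ha with rfl | ha
      · exact ⟨l, by lia, hS, by simp⟩
      · refine ⟨a :: l, by simpa using hl, ?_, by simp⟩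
        intro b hb
        rcases List.mem_cons.1 hb with rfl | hb
        · exact ha
        · exact hS b hb

lemma exists_pg_of_hasPolynomialGrowth {G : Type u} [Group G] (h : HasPolynomialGrowth G) :
    ∃ d, PG d G := by
  obtain ⟨S, hS, C, d, hC⟩ := h
  refine ⟨d, fun T => ?_⟩
  obtain ⟨L, hL⟩ := exists_subset_pow_of_closure (one_mem_symmSet S) (inv_mem_symmSet S) T
    (by rw [closure_symmSet, hS]; simp)
  refine ⟨C * (L + 1) ^ d, fun k => ?_⟩
  have h1 : T ^ k ⊆ symmSet S ^ ((L + 1) * (k + 1)) := by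
    calc T ^ k ⊆ (symmSet S ^ L) ^ k := Finset.pow_subset_pow_left hL
      _ = symmSet S ^ (L * k) := by rw [pow_mul]
      _ ⊆ _ := Finset.pow_subset_pow_right (one_mem_symmSet S) (by gcongr <;> lia)
  have h2 := hC ((L + 1) * (k + 1)) (by nlinarith)
  rw [ball_eq] at h2
  simp only [Nat.card_eq_fintype_card, Finset.coe_sort_coe, Fintype.card_coe] at h2
  calc (T ^ k).card ≤ _ := Finset.card_le_card h1
    _ ≤ _ := h2
    _ = _ := by rw [mul_pow]; ring

lemma hasPolynomialGrowth_of_wpg {G : Type u} [Group G] (hfg : Group.FG G) (h : WPG G) :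
    HasPolynomialGrowth G := by
  obtain ⟨S, hS⟩ := Group.fg_def.1 hfg
  obtain ⟨C, d, hC⟩ := h (symmSet S)
  refine ⟨S, hS, C * 2 ^ d, d, fun k hk => ?_⟩
  rw [ball_eq]
  simp only [Nat.card_eq_fintype_card, Finset.coe_sort_coe, Fintype.card_coe]
  calc _ ≤ _ := hC k
    _ ≤ C * (2 * k) ^ d := by gcongr; lia
    _ = _ := by rw [mul_pow]; ring

end Growth

end Gromov

namespace Gromov

section Easy

open scoped Pointwise Classical commutatorElement

universe u

/-- Weak polynomial growth for finite subsets of a subgroup. -/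
def WPGS {G : Type u} [Group G] (H : Subgroup G) : Prop :=
  ∀ T : Finset G, (T : Set G) ⊆ H → ∃ C d : ℕ, ∀ k : ℕ, (T ^ k).card ≤ C * (k + 1) ^ d

lemma conj_mem_pow {G : Type u} [Group G] (t : G) (U : Finset G) (h1 : (1 : G) ∈ U)
    (hU : ∀ x ∈ U, ⁅t, x⁆ ∈ U) (m : ℕ) :
    ∀ x ∈ U, (fun y => ⁅t, y⁆)^[m] x = 1 → ∀ b : ℕ, t ^ b * x * (t ^ b)⁻¹ ∈ U ^ ((b + 1) ^ m) := by
  induction m with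
  | zero =>
    intro x _ hx1 b
    simp only [Function.iterate_zero, id] at hx1
    subst hx1
    simpa using h1
  | succ m ih =>
    intro x hx hx1 b
    induction b with
    | zero => simpa using hx
    | succ b ihb =>
      have e : t ^ (b + 1) * x * (t ^ (b + 1))⁻¹ =
          (t ^ b * ⁅t, x⁆ * (t ^ b)⁻¹) * (t ^ b * x * (t ^ b)⁻¹) := by
        rw [commutatorElement_def, pow_succ]
        group
      rw [e]
      have h2 := ih ⁅t, x⁆ (hU x hx) (by simpa using hx1) b
      have h3 := Finset.mul_mem_mul h2 ihb
      rw [← pow_add] at h3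
      refine Finset.pow_subset_pow_right h1 ?_ h3
      have h4 : (b + 1) ^ m ≤ (b + 1 + 1) ^ m := Nat.pow_le_pow_left (by lia) m
      calc (b + 1) ^ m + (b + 1) ^ (m + 1) = (b + 1) ^ m * (b + 1 + 1) := by ring
        _ ≤ (b + 1 + 1) ^ m * (b + 1 + 1) := by gcongr
        _ = _ := by ring

lemma iterate_comm_mem_lcs {G : Type u} [Group G] (t x : G) (m : ℕ) :
    (fun y => ⁅t, y⁆)^[m] x ∈ (⊤ : Subgroup G).lowerCentralSeries m := by
  induction m with
  | zero => simp
  | succ m ih =>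
    rw [Function.iterate_succ_apply', Subgroup.lowerCentralSeries_succ, Subgroup.commutator_comm]
    exact Subgroup.commutator_mem_commutator (Subgroup.mem_top t) ih

lemma exists_conj_set {G : Type u} [Group G] [hG : Group.IsNilpotent G] (H : Subgroup G) (t : G)
    (ht : ∀ h ∈ H, t * h * t⁻¹ ∈ H) (T : Finset G) (hT : (T : Set G) ⊆ H) :
    ∃ (U : Finset G) (m : ℕ), (U : Set G) ⊆ H ∧ (1 : G) ∈ U ∧
      ∀ x ∈ T, ∀ b : ℕ, t ^ b * x * (t ^ b)⁻¹ ∈ U ^ ((b + 1) ^ m) := by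
  obtain ⟨m, hm⟩ := Subgroup.nilpotent_iff_lowerCentralSeries.1 hG
  have hzero : ∀ x : G, (fun y => ⁅t, y⁆)^[m] x = 1 := by
    intro x
    have := iterate_comm_mem_lcs t x m
    rwa [hm, Subgroup.mem_bot] at this
  have hone : ∀ i : ℕ, (fun y => ⁅t, y⁆)^[i] (1 : G) = 1 := by
    intro i
    induction i with
    | zero => rfl
    | succ i ih => rw [Function.iterate_succ_apply', ih]; simp
  set U : Finset G := insert 1 ((Finset.range (m + 1)).biUnion
    (fun i => T.image ((fun y => ⁅t, y⁆)^[i]))) with hUdef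
  have hmem : ∀ y, y ∈ U ↔ y = 1 ∨ ∃ i < m + 1, ∃ x ∈ T, (fun y => ⁅t, y⁆)^[i] x = y := by
    intro y
    simp only [hUdef, Finset.mem_insert, Finset.mem_biUnion, Finset.mem_range, Finset.mem_image]
  have hU1 : (1 : G) ∈ U := by simp [hUdef]
  have hUc : ∀ x ∈ U, ⁅t, x⁆ ∈ U := by
    intro y hy
    rw [hmem] at hy
    rcases hy with rfl | ⟨i, hi, x, hx, rfl⟩
    · simpa using hU1
    · rw [← Function.iterate_succ_apply' (fun y => ⁅t, y⁆)]
      by_cases h : i = m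
      · subst h
        rw [Function.iterate_succ_apply', hzero]
        simpa using hU1
      · rw [hmem]
        exact Or.inr ⟨i + 1, by lia, x, hx, rfl⟩
  refine ⟨U, m, ?_, hU1, ?_⟩
  · intro y hy
    rw [Finset.mem_coe, hmem] at hy
    rcases hy with rfl | ⟨i, hi, x, hx, rfl⟩
    · exact one_mem _
    · clear hi
      induction i with
      | zero => exact hT hx
      | succ i ih =>
        rw [Function.iterate_succ_apply']
        exact H.mul_mem (ht _ ih) (H.inv_mem ih)
  · intro x hx b
    refine conj_mem_pow t U hU1 hUc m x ?_ (hzero x) b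
    rw [hmem]
    exact Or.inr ⟨0, by lia, x, hx, rfl⟩

lemma mem_sup_zpowers {G : Type u} [Group G] (H : Subgroup G) (t : G)
    (ht : ∀ h ∈ H, t * h * t⁻¹ ∈ H) (ht' : ∀ h ∈ H, t⁻¹ * h * t ∈ H) {x : G}
    (hx : x ∈ H ⊔ Subgroup.zpowers t) : ∃ h ∈ H, ∃ n : ℤ, x = h * t ^ n := by
  have hconj : ∀ n : ℤ, ∀ h ∈ H, t ^ n * h * (t ^ n)⁻¹ ∈ H := by
    intro n
    induction n using Int.induction_on with
    | zero => intro h hh; simpa using hh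
    | succ n ih =>
      intro h hh
      have := ih _ (ht h hh)
      convert this using 1
      rw [zpow_add_one]; group
    | pred n ih =>
      intro h hh
      have := ih _ (ht' h hh)
      convert this using 1
      rw [zpow_sub_one]; group
  rw [Subgroup.sup_eq_closure] at hx
  induction hx using Subgroup.closure_induction with
  | mem x hx =>
    rcases hx with hx | hx
    · exact ⟨x, hx, 0, by simp⟩
    · obtain ⟨n, rfl⟩ := Subgroup.mem_zpowers_iff.1 hx
      exact ⟨1, one_mem _, n, by simp⟩
  | one => exact ⟨1, one_mem _, 0, by simp⟩
  | mul x y _ _ hx hy =>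
    obtain ⟨h, hh, n, rfl⟩ := hx
    obtain ⟨h', hh', n', rfl⟩ := hy
    refine ⟨h * (t ^ n * h' * (t ^ n)⁻¹), H.mul_mem hh (hconj n h' hh'), n + n', ?_⟩
    rw [zpow_add]; group
  | inv x _ hx =>
    obtain ⟨h, hh, n, rfl⟩ := hx
    refine ⟨t ^ (-n) * h⁻¹ * (t ^ (-n))⁻¹, hconj (-n) _ (H.inv_mem hh), -n, ?_⟩
    group

lemma WPGS.sup_zpowers {G : Type u} [Group G] [Group.IsNilpotent G] {H : Subgroup G}
    (hH : WPGS H) (t : G) (ht : ∀ h ∈ H, t * h * t⁻¹ ∈ H) (ht' : ∀ h ∈ H, t⁻¹ * h * t ∈ H) :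
    WPGS (H ⊔ Subgroup.zpowers t) := by
  intro T hT
  choose! hh hhH hn hhe using fun x (hx : x ∈ T) => mem_sup_zpowers H t ht ht' (hT hx)
  set F : Finset G := symmSet (T.image hh) with hF
  have hFH : (F : Set G) ⊆ H := by
    intro x hx
    have h1 : (F : Set G) ⊆ Subgroup.closure (F : Set G) := Subgroup.subset_closure
    rw [hF, closure_symmSet] at h1
    refine (Subgroup.closure_le H).2 ?_ (h1 hx)
    intro y hy
    simp only [Finset.coe_image, Set.mem_image, Finset.mem_coe] at hy
    obtain ⟨z, hz, rfl⟩ := hy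
    exact hhH z hz
  obtain ⟨U₁, m₁, hU₁, h1₁, hc₁⟩ := exists_conj_set H t ht F hFH
  obtain ⟨U₂, m₂, hU₂, h1₂, hc₂⟩ := exists_conj_set H t⁻¹ (by simpa using ht') F hFH
  set U := U₁ ∪ U₂ with hU
  set m := max m₁ m₂ with hm
  have hU1 : (1 : G) ∈ U := Finset.mem_union_left _ h1₁
  have hUH : (U : Set G) ⊆ H := by
    rw [hU, Finset.coe_union]
    exact Set.union_subset hU₁ hU₂
  have hconj : ∀ x ∈ F, ∀ n : ℤ, t ^ n * x * (t ^ n)⁻¹ ∈ U ^ ((n.natAbs + 1) ^ m) := by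
    intro x hx n
    obtain ⟨b, rfl | rfl⟩ := n.eq_nat_or_neg
    · have := hc₁ x hx b
      simp only [Int.natAbs_natCast, zpow_natCast]
      exact Finset.pow_subset_pow Finset.subset_union_left hU1
        (Nat.pow_le_pow_right (by lia) (le_max_left _ _)) this
    · have := hc₂ x hx b
      simp only [Int.natAbs_neg, Int.natAbs_natCast, zpow_neg, zpow_natCast]
      rw [inv_pow] at this
      exact Finset.pow_subset_pow Finset.subset_union_right hU1
        (Nat.pow_le_pow_right (by lia) (le_max_right _ _)) this
  set W : Finset G := F ∪ {t, t⁻¹} with hW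
  have hF1 : (1 : G) ∈ F := one_mem_symmSet _
  have hW1 : (1 : G) ∈ W := Finset.mem_union_left _ hF1
  have hWinv : ∀ x ∈ W, x⁻¹ ∈ W := by
    intro x hx
    simp only [hW, Finset.mem_union, Finset.mem_insert, Finset.mem_singleton] at hx ⊢
    rcases hx with hx | rfl | rfl
    · exact Or.inl (inv_mem_symmSet _ x hx)
    · simp
    · simp
  have hword : ∀ k : ℕ, ∀ x ∈ W ^ k, ∃ n : ℤ, n.natAbs ≤ k ∧
      ∃ h ∈ U ^ (k * (k + 1) ^ m), x = h * t ^ n := by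
    intro k
    induction k with
    | zero =>
      intro x hx
      refine ⟨0, by simp, 1, by simp, ?_⟩
      simpa using hx
    | succ k ih =>
      intro x hx
      rw [pow_succ, Finset.mem_mul] at hx
      obtain ⟨y, hy, w, hw, rfl⟩ := hx
      obtain ⟨n, hn, h, hh, rfl⟩ := ih y hy
      have hmono : k * (k + 1) ^ m + (n.natAbs + 1) ^ m ≤ (k + 1) * (k + 1 + 1) ^ m := by
        have h1 : (k + 1) ^ m ≤ (k + 1 + 1) ^ m := Nat.pow_le_pow_left (by lia) m
        have h2 : (n.natAbs + 1) ^ m ≤ (k + 1 + 1) ^ m := Nat.pow_le_pow_left (by lia) m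
        nlinarith
      simp only [hW, Finset.mem_union, Finset.mem_insert, Finset.mem_singleton] at hw
      rcases hw with hw | rfl | rfl
      · refine ⟨n, by lia, h * (t ^ n * w * (t ^ n)⁻¹), ?_, by group⟩
        have := Finset.mul_mem_mul hh (hconj w hw n)
        rw [← pow_add] at this
        exact Finset.pow_subset_pow_right hU1 hmono this
      · exact ⟨n + 1, by lia, h, Finset.pow_subset_pow_right hU1 (by lia) hh,
          by rw [zpow_add_one]; group⟩
      · exact ⟨n - 1, by lia, h, Finset.pow_subset_pow_right hU1 (by lia) hh,
          by rw [zpow_sub_one]; group⟩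
  obtain ⟨C, d, hC⟩ := hH U hUH
  have hcard : ∀ k : ℕ, (W ^ k).card ≤ (2 * C) * (k + 1) ^ ((m + 1) * d + 1) := by
    intro k
    have hsub : W ^ k ⊆ (U ^ (k * (k + 1) ^ m)) * ((Finset.Icc (-(k : ℤ)) k).image (fun n => t ^ n)) := by
      intro x hx
      obtain ⟨n, hn, h, hh, rfl⟩ := hword k x hx
      refine Finset.mul_mem_mul hh (Finset.mem_image_of_mem _ ?_)
      rw [Finset.mem_Icc]
      lia
    calc (W ^ k).card ≤ _ := Finset.card_le_card hsub
      _ ≤ _ := Finset.card_mul_le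
      _ ≤ (C * (k * (k + 1) ^ m + 1) ^ d) * (2 * (k + 1)) := by
        refine Nat.mul_le_mul (hC _) (Finset.card_image_le.trans ?_)
        rw [Int.card_Icc]
        lia
      _ ≤ (C * ((k + 1) ^ (m + 1)) ^ d) * (2 * (k + 1)) := by
        gcongr
        have : 1 ≤ (k + 1) ^ m := Nat.one_le_pow _ _ (by lia)
        rw [pow_succ]
        nlinarith
      _ = _ := by rw [← pow_mul, pow_succ]; ring
  obtain ⟨L, hL⟩ := exists_subset_pow_of_closure hW1 hWinv T (by
    intro x hx
    rw [hhe x hx]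
    refine mul_mem (Subgroup.subset_closure ?_) (zpow_mem (Subgroup.subset_closure ?_) _)
    · refine Finset.mem_coe.2 (Finset.mem_union_left _ (subset_symmSet _ ?_))
      exact Finset.mem_image_of_mem _ hx
    · simp [hW])
  refine ⟨(2 * C) * (L + 1) ^ ((m + 1) * d + 1), (m + 1) * d + 1, fun k => ?_⟩
  calc (T ^ k).card ≤ ((W ^ L) ^ k).card := Finset.card_le_card (Finset.pow_subset_pow_left hL)
    _ = (W ^ (L * k)).card := by rw [pow_mul]
    _ ≤ _ := hcard _
    _ ≤ (2 * C) * ((L + 1) * (k + 1)) ^ ((m + 1) * d + 1) := by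
      gcongr
      nlinarith
    _ = _ := by rw [mul_pow]; ring

lemma wpgs_derived_step {G : Type u} [Group G] [Group.IsNilpotent G] {D : Subgroup G}
    (hD : WPGS ⁅D, D⁆) : WPGS D := by
  have hle : ⁅D, D⁆ ≤ D := by
    rw [Subgroup.commutator_le]
    intro a ha b hb
    exact D.mul_mem (D.mul_mem (D.mul_mem ha hb) (D.inv_mem ha)) (D.inv_mem hb)
  have key : ∀ T : Finset G, (T : Set G) ⊆ D →
      WPGS (⁅D, D⁆ ⊔ Subgroup.closure (T : Set G)) := by
    intro T
    induction T using Finset.induction_on with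
    | empty => intro _; simpa using hD
    | insert a s _ ih =>
      intro hs
      have ha : a ∈ D := hs (by simp)
      have hs' : (s : Set G) ⊆ D := fun x hx => hs (by simp at hx ⊢; tauto)
      have hKD : ⁅D, D⁆ ⊔ Subgroup.closure (s : Set G) ≤ D :=
        sup_le hle ((Subgroup.closure_le D).2 hs')
      have hnorm : ∀ b ∈ D, ∀ h ∈ ⁅D, D⁆ ⊔ Subgroup.closure (s : Set G),
          b * h * b⁻¹ ∈ ⁅D, D⁆ ⊔ Subgroup.closure (s : Set G) := by
        intro b hb h hh
        have : b * h * b⁻¹ = ⁅b, h⁆ * h := by rw [commutatorElement_def]; group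
        rw [this]
        exact mul_mem (Subgroup.mem_sup_left (Subgroup.commutator_mem_commutator hb (hKD hh))) hh
      have h1 := (ih hs').sup_zpowers a (hnorm a ha)
        (by simpa using hnorm a⁻¹ (D.inv_mem ha))
      rw [sup_assoc, Subgroup.zpowers_eq_closure, ← Subgroup.closure_union] at h1
      rwa [Finset.coe_insert, Set.insert_eq, Set.union_comm]
  intro T hT
  exact key T hT T (fun x hx => Subgroup.mem_sup_right (Subgroup.subset_closure hx))

lemma wpg_of_nilpotent {G : Type u} [Group G] [Group.IsNilpotent G] : WPG G := by
  have hsolv : Group.IsSolvable G := inferInstance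
  obtain ⟨n, hn⟩ := hsolv.solvable
  have key : ∀ j ≤ n, WPGS (derivedSeries G (n - j)) := by
    intro j
    induction j with
    | zero =>
      intro _ T hT
      rw [Nat.sub_zero, hn] at hT
      refine ⟨1, 0, fun k => ?_⟩
      have : T ⊆ 1 := by
        intro x hx
        have := hT hx
        simpa using this
      calc (T ^ k).card ≤ ((1 : Finset G) ^ k).card :=
            Finset.card_le_card (Finset.pow_subset_pow_left this)
        _ ≤ _ := by simp
    | succ j ih =>
      intro hj
      apply wpgs_derived_step
      rw [← derivedSeries_succ]
      have : n - (j + 1) + 1 = n - j := by lia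
      rw [this]
      exact ih (by lia)
  have h0 := key n le_rfl
  simp only [Nat.sub_self, derivedSeries_zero] at h0
  intro T
  exact h0 T (by simp)

lemma wpg_of_virtually_nilpotent {G : Type u} [Group G] (H : Subgroup G)
    (hH : Group.IsNilpotent H) (hfin : H.FiniteIndex) : WPG G := by
  intro T
  have : Finite (G ⧸ H) := inferInstance
  have := Fintype.ofFinite (G ⧸ H)
  set R : Finset G := Finset.univ.image (fun q : G ⧸ H => (Quotient.out q)) with hR
  have hRcov : ∀ g : G, ∃ r ∈ R, r⁻¹ * g ∈ H := by
    intro g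
    refine ⟨Quotient.out (g : G ⧸ H), Finset.mem_image_of_mem _ (Finset.mem_univ _), ?_⟩
    rw [← QuotientGroup.eq]
    exact Quotient.out_eq _
  -- finite set of Schreier elements
  set U : Finset H := ((T * R) ×ˢ R).image (fun p =>
    if h : p.2⁻¹ * p.1 ∈ H then (⟨p.2⁻¹ * p.1, h⟩ : H) else 1) with hU
  obtain ⟨C, d, hC⟩ := (wpg_of_nilpotent (G := H)).dec U
  have hword : ∀ k : ℕ, T ^ k * R ⊆ R * (U ^ k).image H.subtype := by
    intro k
    induction k with
    | zero =>
      intro x hx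
      have : x ∈ R := by simpa using hx
      have h2 := Finset.mul_mem_mul this (Finset.mem_image_of_mem H.subtype
        (show (1 : H) ∈ U ^ 0 by simp))
      simpa using h2
    | succ k ih =>
      intro x hx
      rw [pow_succ', mul_assoc, Finset.mem_mul] at hx
      obtain ⟨s, hs, y, hy, rfl⟩ := hx
      obtain ⟨r, hr, v, hv, rfl⟩ := Finset.mem_mul.1 (ih hy)
      obtain ⟨w, hw, rfl⟩ := Finset.mem_image.1 hv
      obtain ⟨r', hr', hm⟩ := hRcov (s * r)
      have hu : (⟨r'⁻¹ * (s * r), hm⟩ : H) ∈ U := by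
        rw [hU, Finset.mem_image]
        refine ⟨(s * r, r'), Finset.mem_product.2 ⟨Finset.mul_mem_mul hs hr, hr'⟩, ?_⟩
        simp [hm]
      have h3 := Finset.mul_mem_mul hu hw
      rw [← pow_succ'] at h3
      have h4 := Finset.mul_mem_mul hr' (Finset.mem_image_of_mem H.subtype h3)
      convert h4 using 1
      simp [mul_assoc]
  refine ⟨R.card * C, d, fun k => ?_⟩
  have hRne : R.Nonempty := by
    obtain ⟨r, hr, _⟩ := hRcov 1
    exact ⟨r, hr⟩
  calc (T ^ k).card ≤ (T ^ k * R).card := Finset.card_le_card_mul_right hRne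
    _ ≤ _ := Finset.card_le_card (hword k)
    _ ≤ _ := Finset.card_mul_le
    _ ≤ R.card * (C * (k + 1) ^ d) := by
      gcongr
      exact Finset.card_image_le.trans (hC k)
    _ = _ := by ring

end Easy

end Gromov

namespace Gromov

section Milnor

open scoped Pointwise Classical commutatorElement

universe u

lemma exists_poly_lt_exp (C : ℝ) (d : ℕ) {x : ℝ} (hx : 1 < x) :
    ∃ k : ℕ, C * ((k : ℝ) + 1) ^ d < x ^ k := by
  have h1 := tendsto_pow_const_div_const_pow_of_one_lt d hx
  have h2 := (h1.comp (Filter.tendsto_add_atTop_nat 1)).const_mul (|C| * x)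
  rw [mul_zero] at h2
  obtain ⟨k, hk⟩ := (h2.eventually (gt_mem_nhds (show (0 : ℝ) < 1 by norm_num))).exists
  refine ⟨k, ?_⟩
  have hx0 : (0 : ℝ) < x := by linarith
  simp only [Function.comp] at hk
  push_cast at hk
  have hxk : 0 < x ^ k := pow_pos hx0 k
  have : |C| * x * (((k : ℝ) + 1) ^ d / x ^ (k + 1)) = |C| * ((k : ℝ) + 1) ^ d / x ^ k := by
    rw [pow_succ]
    field_simp
  rw [this, div_lt_one hxk] at hk
  refine lt_of_le_of_lt ?_ hk
  gcongr
  exact le_abs_self C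

/-- Products over subsets of the translates `u^j e u^{-j}`. -/
noncomputable def wset {G : Type u} [Group G] (e t : G) : ℕ → Finset G
  | 0 => {1}
  | k + 1 => wset e t k ∪ wset e t k * {t ^ k * e * (t ^ k)⁻¹}

lemma wset_mem_pow {G : Type u} [Group G] (e t : G) (k : ℕ) :
    ∀ w ∈ wset e t k, w * t ^ k ∈ ({t, e * t} : Finset G) ^ k := by
  induction k with
  | zero => intro w hw; simpa [wset] using hw
  | succ k ih =>
    intro w hw
    rw [wset, Finset.mem_union, Finset.mem_mul] at hw
    rcases hw with hw | ⟨v, hv, y, hy, rfl⟩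
    · rw [pow_succ t, ← mul_assoc, pow_succ]
      exact Finset.mul_mem_mul (ih w hw) (by simp)
    · rw [Finset.mem_singleton] at hy
      subst hy
      have : v * (t ^ k * e * (t ^ k)⁻¹) * t ^ (k + 1) = (v * t ^ k) * (e * t) := by
        rw [pow_succ]; group
      rw [this, pow_succ]
      exact Finset.mul_mem_mul (ih v hv) (by simp)

lemma wset_collision {G : Type u} [Group G] (hG : WPG G) (e t : G) :
    ∃ k : ℕ, ∃ w ∈ wset e t k, ∃ w' ∈ wset e t k, w * (t ^ k * e * (t ^ k)⁻¹) = w' := by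
  by_contra hcon
  push Not at hcon
  have hcard : ∀ k, (wset e t k).card = 2 ^ k := by
    intro k
    induction k with
    | zero => simp [wset]
    | succ k ih =>
      rw [wset, Finset.card_union_of_disjoint, Finset.card_mul_singleton, ih]
      · ring
      · rw [Finset.disjoint_left]
        intro x hx hx'
        obtain ⟨v, hv, y, hy, rfl⟩ := Finset.mem_mul.1 hx'
        rw [Finset.mem_singleton] at hy
        subst hy
        exact hcon k v hv _ hx rfl
  obtain ⟨C, d, hC⟩ := hG {t, e * t}
  obtain ⟨k, hk⟩ := exists_poly_lt_exp C d (show (1 : ℝ) < 2 by norm_num)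
  have h1 : (wset e t k).card ≤ (({t, e * t} : Finset G) ^ k).card := by
    refine Finset.card_le_card_of_injOn (fun w => w * t ^ k) (fun w hw => ?_) ?_
    · exact wset_mem_pow e t k w hw
    · intro a _ b _ hab
      exact mul_right_cancel hab
  have h2 := h1.trans (hC k)
  rw [hcard] at h2
  have h3 : ((2 ^ k : ℕ) : ℝ) ≤ ((C * (k + 1) ^ d : ℕ) : ℝ) := by exact_mod_cast h2
  push_cast at h3
  linarith

lemma orbit_fg {G : Type u} [Group G] (hG : WPG G) (e t : G) :
    ∃ F : Finset G, (∀ f ∈ F, ∃ n : ℕ, f = t ^ n * e * (t ^ n)⁻¹) ∧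
      ∀ n : ℕ, t ^ n * e * (t ^ n)⁻¹ ∈ Subgroup.closure (F : Set G) := by
  obtain ⟨k, w, hw, w', hw', hww⟩ := wset_collision hG e t
  set F : Finset G := (Finset.range k).image (fun n => t ^ n * e * (t ^ n)⁻¹) with hF
  have hlow : ∀ n < k, t ^ n * e * (t ^ n)⁻¹ ∈ Subgroup.closure (F : Set G) := by
    intro n hn
    refine Subgroup.subset_closure (Finset.mem_coe.2 (Finset.mem_image_of_mem _ ?_))
    simpa using hn
  have hW : ∀ j ≤ k, ∀ v ∈ wset e t j, v ∈ Subgroup.closure (F : Set G) := by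
    intro j
    induction j with
    | zero =>
      intro _ v hv
      have : v = 1 := by simpa [wset] using hv
      subst this
      exact one_mem _
    | succ j ih =>
      intro hj v hv
      rw [wset, Finset.mem_union, Finset.mem_mul] at hv
      rcases hv with hv | ⟨v, hv, y, hy, rfl⟩
      · exact ih (by lia) v hv
      · rw [Finset.mem_singleton] at hy
        subst hy
        exact mul_mem (ih (by lia) v hv) (hlow j (by lia))
  have hk : t ^ k * e * (t ^ k)⁻¹ ∈ Subgroup.closure (F : Set G) := by
    have : t ^ k * e * (t ^ k)⁻¹ = w⁻¹ * w' := by rw [← hww]; group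
    rw [this]
    exact mul_mem (inv_mem (hW k le_rfl w hw)) (hW k le_rfl w' hw')
  refine ⟨F, ?_, ?_⟩
  · intro f hf
    rw [hF, Finset.mem_image] at hf
    obtain ⟨n, _, rfl⟩ := hf
    exact ⟨n, rfl⟩
  · have hconj : ∀ x ∈ Subgroup.closure (F : Set G), t * x * t⁻¹ ∈ Subgroup.closure (F : Set G) := by
      intro x hx
      induction hx using Subgroup.closure_induction with
      | mem x hx =>
        rw [Finset.mem_coe, hF, Finset.mem_image] at hx
        obtain ⟨n, hn, rfl⟩ := hx
        rw [Finset.mem_range] at hn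
        have : t * (t ^ n * e * (t ^ n)⁻¹) * t⁻¹ = t ^ (n + 1) * e * (t ^ (n + 1))⁻¹ := by
          rw [pow_succ']; group
        rw [this]
        rcases Nat.lt_or_ge (n + 1) k with h | h
        · exact hlow _ h
        · have : n + 1 = k := by lia
          rw [this]
          exact hk
      | one => simpa using one_mem _
      | mul x y _ _ hx hy =>
        have : t * (x * y) * t⁻¹ = (t * x * t⁻¹) * (t * y * t⁻¹) := by group
        rw [this]
        exact mul_mem hx hy
      | inv x _ hx =>
        have : t * x⁻¹ * t⁻¹ = (t * x * t⁻¹)⁻¹ := by group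
        rw [this]
        exact inv_mem hx
    intro n
    induction n with
    | zero =>
      rcases Nat.eq_zero_or_pos k with h | h
      · rw [h] at hk
        exact hk
      · exact hlow 0 h
    | succ n ih =>
      have := hconj _ ih
      convert this using 1
      rw [pow_succ']; group

lemma ker_fg {G : Type u} [Group G] (hfg : Group.FG G) (hG : WPG G)
    (φ : G →* Multiplicative ℤ) (hφ : Function.Surjective φ) : φ.ker.FG := by
  obtain ⟨S, hS⟩ := Group.fg_def.1 hfg
  obtain ⟨t, ht⟩ := hφ (Multiplicative.ofAdd 1)
  choose F₁ hF₁ hF₁' using fun e => orbit_fg hG e t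
  choose F₂ hF₂ hF₂' using fun e => orbit_fg hG e t⁻¹
  set ε : G → G := fun s => s * t ^ (-(Multiplicative.toAdd (φ s))) with hε
  have htz : ∀ n : ℤ, φ (t ^ n) = Multiplicative.ofAdd n := by
    intro n
    rw [map_zpow, ht, ← ofAdd_zsmul]
    simp
  have hεk : ∀ s, ε s ∈ φ.ker := by
    intro s
    rw [MonoidHom.mem_ker, hε]
    simp only [map_mul, htz]
    simp
  set F : Finset G := S.biUnion (fun s => F₁ (ε s) ∪ F₂ (ε s)) with hF
  set M := Subgroup.closure (F : Set G) with hM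
  have hMk : M ≤ φ.ker := by
    rw [hM, Subgroup.closure_le]
    intro x hx
    rw [Finset.mem_coe, hF, Finset.mem_biUnion] at hx
    obtain ⟨s, _, hx⟩ := hx
    rcases Finset.mem_union.1 hx with hx | hx
    · obtain ⟨n, rfl⟩ := hF₁ _ x hx
      exact (MonoidHom.normal_ker φ).conj_mem _ (hεk s) _
    · obtain ⟨n, rfl⟩ := hF₂ _ x hx
      exact (MonoidHom.normal_ker φ).conj_mem _ (hεk s) _
  have hall : ∀ s ∈ S, ∀ n : ℤ, t ^ n * ε s * (t ^ n)⁻¹ ∈ M := by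
    intro s hs n
    obtain ⟨b, rfl | rfl⟩ := n.eq_nat_or_neg
    · rw [zpow_natCast]
      refine Subgroup.closure_mono ?_ (hF₁' (ε s) b)
      intro x hx
      exact Finset.mem_biUnion.2 ⟨s, hs, Finset.mem_union_left _ hx⟩
    · rw [zpow_neg, zpow_natCast, ← inv_pow]
      refine Subgroup.closure_mono ?_ (hF₂' (ε s) b)
      intro x hx
      exact Finset.mem_biUnion.2 ⟨s, hs, Finset.mem_union_right _ hx⟩
  have hconj : ∀ m : ℤ, ∀ x ∈ M, t ^ m * x * (t ^ m)⁻¹ ∈ M := by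
    intro m x hx
    rw [hM] at hx
    induction hx using Subgroup.closure_induction with
    | mem x hx =>
      rw [Finset.mem_coe, hF, Finset.mem_biUnion] at hx
      obtain ⟨s, hs, hx⟩ := hx
      rcases Finset.mem_union.1 hx with hx | hx
      · obtain ⟨n, rfl⟩ := hF₁ _ x hx
        have := hall s hs (m + n)
        convert this using 1
        rw [zpow_add, zpow_natCast]; group
      · obtain ⟨n, rfl⟩ := hF₂ _ x hx
        have := hall s hs (m - n)
        convert this using 1
        rw [zpow_sub, zpow_natCast]; group
    | one => simpa using one_mem _
    | mul x y _ _ hx hy =>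
      have : t ^ m * (x * y) * (t ^ m)⁻¹ = (t ^ m * x * (t ^ m)⁻¹) * (t ^ m * y * (t ^ m)⁻¹) := by
        group
      rw [this]
      exact mul_mem hx hy
    | inv x _ hx =>
      have : t ^ m * x⁻¹ * (t ^ m)⁻¹ = (t ^ m * x * (t ^ m)⁻¹)⁻¹ := by group
      rw [this]
      exact inv_mem hx
  have htop : (⊤ : Subgroup G) ≤ M ⊔ Subgroup.zpowers t := by
    rw [← hS, Subgroup.closure_le]
    intro s hs
    have h1 : s = ε s * t ^ (Multiplicative.toAdd (φ s)) := by
      rw [hε]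
      group
    rw [h1]
    refine mul_mem (Subgroup.mem_sup_left ?_) (Subgroup.mem_sup_right ?_)
    · simpa using hall s hs 0
    · exact Subgroup.zpow_mem_zpowers t _
  have hker : φ.ker = M := by
    apply le_antisymm _ hMk
    intro x hx
    obtain ⟨h, hh, n, rfl⟩ := mem_sup_zpowers M t (by simpa using hconj 1)
      (by simpa using hconj (-1)) (htop (Subgroup.mem_top x))
    rw [MonoidHom.mem_ker, map_mul, (MonoidHom.mem_ker).1 (hMk hh), one_mul, htz] at hx
    have : n = 0 := by simpa using hx
    subst this
    simpa using hh
  rw [hker]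
  exact ⟨F, rfl⟩

lemma pg_ker {G : Type u} [Group G] {d : ℕ} (hG : PG d G)
    (φ : G →* Multiplicative ℤ) (hφ : Function.Surjective φ) :
    ∃ d', d = d' + 1 ∧ PG d' φ.ker := by
  obtain ⟨t, ht⟩ := hφ (Multiplicative.ofAdd 1)
  have htz : ∀ n : ℕ, φ (t ^ n) = Multiplicative.ofAdd (n : ℤ) := by
    intro n
    rw [map_pow, ht, ← ofAdd_nsmul]
    simp
  have key : ∀ T : Finset φ.ker, ∃ C, ∀ k : ℕ, (T ^ k).card * (k + 1) ≤ C * (k + 1) ^ d := by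
    intro T
    obtain ⟨C, hC⟩ := hG (insert 1 (insert t (T.image φ.ker.subtype)))
    refine ⟨C * 2 ^ d, fun k => ?_⟩
    set U : Finset G := insert 1 (insert t (T.image φ.ker.subtype)) with hU
    have hsub : T.image φ.ker.subtype ⊆ U := by
      intro x hx
      simp only [hU, Finset.mem_insert]
      tauto
    have h1 : ((T ^ k) ×ˢ Finset.range (k + 1)).card ≤ (U ^ (2 * k)).card := by
      refine Finset.card_le_card_of_injOn (fun p => (p.1 : G) * t ^ p.2) ?_ ?_
      · rintro ⟨x, j⟩ hp
        rw [Finset.mem_coe, Finset.mem_product, Finset.mem_range] at hp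
        simp only [Finset.mem_coe]
        rw [two_mul, pow_add]
        refine Finset.mul_mem_mul ?_ ?_
        · have := Finset.mem_image_of_mem φ.ker.subtype hp.1
          rw [Finset.image_pow] at this
          exact Finset.pow_subset_pow_left hsub this
        · refine Finset.pow_subset_pow_right (by simp [hU]) (show j ≤ k by lia) ?_
          exact Finset.pow_mem_pow (by simp [hU])
      · rintro ⟨x, j⟩ _ ⟨y, i⟩ _ hxy
        simp only at hxy
        have h2 := congrArg φ hxy
        rw [map_mul, map_mul, (MonoidHom.mem_ker).1 x.2, (MonoidHom.mem_ker).1 y.2, one_mul,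
          one_mul, htz, htz] at h2
        have h3 : j = i := by simpa using h2
        subst h3
        have h4 : x = y := Subtype.ext (mul_right_cancel hxy)
        rw [h4]
    rw [Finset.card_product, Finset.card_range] at h1
    calc _ ≤ _ := h1
      _ ≤ _ := hC _
      _ ≤ C * (2 * (k + 1)) ^ d := by gcongr; lia
      _ = _ := by rw [mul_pow]; ring
  rcases d with _ | d
  · exfalso
    obtain ⟨C, hC⟩ := key {1}
    have := hC C
    simp at this
  · refine ⟨d, rfl, PG.of_dec fun T => ?_⟩
    obtain ⟨C, hC⟩ := key T
    refine ⟨C, fun k => ?_⟩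
    have := hC k
    rw [pow_succ, ← mul_assoc] at this
    exact Nat.le_of_mul_le_mul_right this (by lia)

end Milnor

section Nilp

open scoped Pointwise Classical commutatorElement

universe u

lemma finite_of_nilpotent_fg_aux (G : Type u) [Group G] [Group.IsNilpotent G] :
    Group.FG G → Finite (Abelianization G) → Finite G := by
  refine Group.nilpotent_center_quotient_ind
    (P := fun G _ _ => Group.FG G → Finite (Abelianization G) → Finite G) G ?_ ?_
  · intro G _ _ _ _
    infer_instance
  · intro G _ _ ih hfg hab
    have h1 : Group.FG (G ⧸ Subgroup.center G) := inferInstance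
    have h2 : Finite (Abelianization (G ⧸ Subgroup.center G)) := by
      refine Finite.of_surjective (Abelianization.map (QuotientGroup.mk' (Subgroup.center G))) ?_
      intro x
      obtain ⟨y, rfl⟩ := QuotientGroup.mk_surjective x
      obtain ⟨z, rfl⟩ := QuotientGroup.mk_surjective y
      exact ⟨Abelianization.of z, rfl⟩
    have h3 : Finite (G ⧸ Subgroup.center G) := ih h1 h2
    have h4 : Finite (commutatorSet G) := by
      refine Set.Finite.to_subtype (Set.Finite.subset (Set.finite_range
        (fun p : (G ⧸ Subgroup.center G) × (G ⧸ Subgroup.center G) =>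
          ⁅Quotient.out p.1, Quotient.out p.2⁆)) ?_)
      rintro _ ⟨a, b, rfl⟩
      refine ⟨((a : G ⧸ Subgroup.center G), (b : G ⧸ Subgroup.center G)), ?_⟩
      obtain ⟨z, hz⟩ := QuotientGroup.mk_out_eq_mul (Subgroup.center G) a
      obtain ⟨w, hw⟩ := QuotientGroup.mk_out_eq_mul (Subgroup.center G) b
      have hzc := fun g => (Subgroup.mem_center_iff.1 z.2 g)
      have hwc := fun g => (Subgroup.mem_center_iff.1 w.2 g)
      change ⁅Quotient.out (a : G ⧸ Subgroup.center G),
        Quotient.out (b : G ⧸ Subgroup.center G)⁆ = ⁅a, b⁆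
      have hz' : Quotient.out (a : G ⧸ Subgroup.center G) = a * z := hz
      have hw' : Quotient.out (b : G ⧸ Subgroup.center G) = b * w := hw
      rw [hz', hw', commutatorElement_def, commutatorElement_def]
      have e1 : a * (z : G) * (b * w) * (a * (z : G))⁻¹ * (b * w)⁻¹ =
          a * (z * (b * w * (z : G)⁻¹)) * a⁻¹ * (w : G)⁻¹ * b⁻¹ := by group
      have e2 : (z : G) * (b * w * (z : G)⁻¹) = b * w := by
        rw [← hzc]; group
      rw [e1, e2]
      have e3 : a * (b * (w : G)) * a⁻¹ * (w : G)⁻¹ * b⁻¹ =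
          a * b * (w * a⁻¹) * (w : G)⁻¹ * b⁻¹ := by group
      rw [e3, ← hwc]
      group
    have h5 : Finite (commutator G) := inferInstance
    have h6 : Finite (G ⧸ commutator G) := hab
    exact Finite.of_subgroup_quotient (commutator G)

lemma exists_surj_int_of_comm (A : Type u) [CommGroup A] [hfg : Group.FG A] [hinf : Infinite A] :
    ∃ φ : A →* Multiplicative ℤ, Function.Surjective φ := by
  have : AddGroup.FG (Additive A) := inferInstance
  obtain ⟨n, ι, hι, p, hp, e, ⟨f⟩⟩ := AddCommGroup.equiv_free_prod_directSum_zmod (Additive A)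
  have hn : n ≠ 0 := by
    rintro rfl
    have hfin : Finite (DirectSum ι fun i => ZMod (p i ^ e i)) := by
      have : ∀ i, NeZero (p i ^ e i) := fun i => ⟨pow_ne_zero _ (hp i).ne_zero⟩
      have : Finite (∀ i, ZMod (p i ^ e i)) := inferInstance
      exact Finite.of_injective (fun x : (DirectSum ι fun i => ZMod (p i ^ e i)) => fun i => x i)
        DFunLike.coe_injective
    have : Finite (Additive A) := Finite.of_equiv _ f.symm.toEquiv
    exact hinf.not_finite (Finite.of_equiv _ (Additive.toMul (α := A)))
  obtain ⟨m, rfl⟩ := Nat.exists_eq_succ_of_ne_zero hn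
  let g : Additive A →+ ℤ :=
    ((Finsupp.applyAddHom (0 : Fin (m + 1))).comp (AddMonoidHom.fst _ _)).comp f.toAddMonoidHom
  refine ⟨AddMonoidHom.toMultiplicativeRight g, ?_⟩
  intro z
  refine ⟨Additive.toMul (f.symm (Finsupp.single 0 (Multiplicative.toAdd z), 0)), ?_⟩
  simp [g]

lemma exists_surj_int_of_hom {G : Type u} [Group G] [hfg : Group.FG G] {A : Type*} [CommGroup A]
    (f : G →* A) (hf : Infinite f.range) : ∃ φ : G →* Multiplicative ℤ, Function.Surjective φ := by
  have : Group.FG f.range := inferInstance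
  obtain ⟨ψ, hψ⟩ := exists_surj_int_of_comm f.range
  exact ⟨ψ.comp f.rangeRestrict, hψ.comp f.rangeRestrict_surjective⟩

lemma exists_surj_int_of_nilpotent {G : Type u} [Group G] [hfg : Group.FG G]
    [Group.IsNilpotent G] [hinf : Infinite G] :
    ∃ φ : G →* Multiplicative ℤ, Function.Surjective φ := by
  apply exists_surj_int_of_hom (Abelianization.of (G := G))
  by_contra hcon
  rw [not_infinite_iff_finite] at hcon
  have : Finite (Abelianization G) := by
    refine Finite.of_surjective (fun x : (Abelianization.of (G := G)).range => (x : Abelianization G)) ?_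
    intro x
    obtain ⟨y, rfl⟩ := QuotientGroup.mk_surjective x
    exact ⟨⟨_, ⟨y, rfl⟩⟩, rfl⟩
  exact hinf.not_finite (finite_of_nilpotent_fg_aux G hfg this)

lemma isNilpotent_of_le {G : Type u} [Group G] {H K : Subgroup G} (h : H ≤ K)
    (hK : Group.IsNilpotent K) : Group.IsNilpotent H :=
  (Group.isNilpotent_congr (Subgroup.subgroupOfEquivOfLe h)).1 inferInstance

lemma exists_characteristic {N : Type u} [Group N] [hfg : Group.FG N] (H : Subgroup N)
    (hH : Group.IsNilpotent H) (hfin : H.FiniteIndex) :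
    ∃ M : Subgroup N, M.Characteristic ∧ Group.IsNilpotent M ∧ M.FiniteIndex := by
  set C := H.normalCore with hC
  have hCfin : C.FiniteIndex := inferInstance
  have hCnil : Group.IsNilpotent C := isNilpotent_of_le H.normalCore_le hH
  set m := C.index with hm
  have hm0 : m ≠ 0 := hCfin.index_ne_zero
  set M := Subgroup.closure (Set.range (fun x : N => x ^ m)) with hM
  have hchar : M.Characteristic := by
    rw [Subgroup.characteristic_iff_map_le]
    intro f
    rw [hM, MonoidHom.map_closure]
    apply Subgroup.closure_mono
    rintro _ ⟨_, ⟨x, rfl⟩, rfl⟩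
    exact ⟨f x, by simp⟩
  have hMC : M ≤ C := by
    rw [hM, Subgroup.closure_le]
    rintro _ ⟨x, rfl⟩
    exact C.pow_index_mem x
  refine ⟨M, hchar, isNilpotent_of_le hMC hCnil, ?_⟩
  have hMn : M.Normal := inferInstance
  have hCfg : Group.FG C := inferInstance
  have hQ : Finite (C ⧸ M.subgroupOf C) := by
    apply finite_of_nilpotent_fg_aux _ inferInstance
    have h1 : Group.FG (Abelianization (C ⧸ M.subgroupOf C)) :=
      inferInstanceAs (Group.FG ((C ⧸ M.subgroupOf C) ⧸ (commutator (C ⧸ M.subgroupOf C))))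
    apply CommGroup.finite_of_fg_isMulTorsion
    intro x
    obtain ⟨y, hy⟩ := QuotientGroup.mk_surjective x
    obtain ⟨z, hz⟩ := QuotientGroup.mk_surjective y
    refine isOfFinOrder_iff_pow_eq_one.2 ⟨m, Nat.pos_of_ne_zero hm0, ?_⟩
    have : ((z ^ m : C) : C ⧸ M.subgroupOf C) = 1 := by
      rw [QuotientGroup.eq_one_iff, Subgroup.mem_subgroupOf]
      exact Subgroup.subset_closure ⟨z, rfl⟩
    have hx : x = Abelianization.of y := hy.symm
    rw [hx, ← map_pow, ← hz, ← QuotientGroup.mk_pow, this, map_one]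
  constructor
  rw [← Subgroup.relIndex_mul_index hMC]
  refine mul_ne_zero ?_ hm0
  exact (Subgroup.finiteIndex_of_finite_quotient (H := M.subgroupOf C)).index_ne_zero

end Nilp

end Gromov

namespace Gromov

section Unip

open Polynomial

universe u

/-- Kronecker's theorem in the algebraic closure of `ℚ`. -/
lemma kronecker_closure (x : AlgebraicClosure ℚ) (hx0 : x ≠ 0) (hxi : IsIntegral ℤ x)
    (hx : ∀ σ : AlgebraicClosure ℚ →+* ℂ, ‖σ x‖ ≤ 1) : ∃ n : ℕ, 0 < n ∧ x ^ n = 1 := by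
  have hxq : IsIntegral ℚ x := hxi.tower_top
  let K := IntermediateField.adjoin ℚ {x}
  let : NumberField K :=
    { to_charZero := inferInstance
      to_finiteDimensional := IntermediateField.adjoin.finiteDimensional hxq }
  let y : K := ⟨x, IntermediateField.mem_adjoin_simple_self ℚ x⟩
  have key : ∃ (n : ℕ) (_ : 0 < n), y ^ n = 1 := by
    refine NumberField.Embeddings.pow_eq_one_of_norm_le_one K ℂ (x := y) ?_ ?_ ?_
    · intro h
      exact hx0 (congrArg Subtype.val h)
    · exact IntermediateField.coe_isIntegral_iff.mp hxi
    · intro φ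
      have hroot : φ y ∈ (minpoly ℚ x).rootSet ℂ := by
        rw [Polynomial.mem_rootSet]
        refine ⟨minpoly.ne_zero hxq, ?_⟩
        let ψ : K →ₐ[ℚ] ℂ := φ.toRatAlgHom
        have h1 : aeval (ψ y) (minpoly ℚ x) = ψ (aeval y (minpoly ℚ x)) :=
          Polynomial.aeval_algHom_apply ψ y _
        have h2 : aeval y (minpoly ℚ x) = 0 := by
          apply Subtype.val_injective
          have := Polynomial.aeval_algHom_apply K.val y (minpoly ℚ x)
          change K.val _ = _
          rw [← this]
          exact minpoly.aeval ℚ x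
        rw [h2, map_zero] at h1
        exact h1
      have halg : Algebra.IsAlgebraic ℚ (AlgebraicClosure ℚ) :=
        AlgebraicClosure.isAlgebraic ℚ
      rw [← Algebra.IsAlgebraic.range_eval_eq_rootSet_minpoly (F := ℚ) ℂ x] at hroot
      obtain ⟨σ, hσ⟩ := hroot
      have := hx σ.toRingHom
      have h3 : σ x = φ y := hσ
      rw [← h3]
      exact this
  obtain ⟨n, hn, h⟩ := key
  exact ⟨n, hn, congrArg Subtype.val h⟩

/-- A multiset of `b`-th roots of unity gives a divisor of a power of `X ^ b - 1`. -/
lemma prod_dvd_pow {K : Type*} [Field K] (b : ℕ) (s : Multiset K) (h : ∀ x ∈ s, x ^ b = 1) :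
    (s.map (fun a => X - C a)).prod ∣ (X ^ b - 1 : K[X]) ^ (Multiset.card s) := by
  induction s using Multiset.induction_on with
  | empty => simp
  | cons a s ih =>
    rw [Multiset.map_cons, Multiset.prod_cons, Multiset.card_cons, pow_succ, mul_comm]
    refine mul_dvd_mul (ih fun x hx => h x (Multiset.mem_cons_of_mem hx)) ?_
    rw [dvd_iff_isRoot]
    simp [h a (Multiset.mem_cons_self a s)]

/-- precomposition -/
def precomp {M : Type u} [AddCommGroup M] (K : Type) [Field K] (α : M →ₗ[ℤ] M) :
    (M →ₗ[ℤ] K) →ₗ[K] (M →ₗ[ℤ] K) where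
  toFun φ := φ.comp α
  map_add' _ _ := rfl
  map_smul' _ _ := rfl

lemma precomp_pow {M : Type u} [AddCommGroup M] (K : Type) [Field K] (α : M →ₗ[ℤ] M) (n : ℕ)
    (φ : M →ₗ[ℤ] K) : ((precomp K α) ^ n) φ = φ.comp (α ^ n) := by
  induction n with
  | zero => rfl
  | succ n ih =>
    rw [pow_succ', Module.End.mul_apply, ih]
    change (φ.comp (α ^ n)).comp α = _
    rw [LinearMap.comp_assoc]
    rfl

lemma finite_hom {M : Type u} [AddCommGroup M] [hM : Module.Finite ℤ M] (K : Type) [Field K] :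
    Module.Finite K (M →ₗ[ℤ] K) := by
  obtain ⟨S, hS⟩ := hM.fg_top
  let r : (M →ₗ[ℤ] K) →ₗ[K] (S → K) :=
    { toFun := fun φ s => φ s
      map_add' := fun _ _ => rfl
      map_smul' := fun _ _ => rfl }
  refine Module.Finite.of_injective r ?_
  intro φ ψ h
  apply LinearMap.ext_on hS
  intro s hs
  exact congrFun h ⟨s, hs⟩

lemma torsion_of_all_zero {M : Type u} [AddCommGroup M] [Module.Finite ℤ M] (K : Type) [Field K]
    [CharZero K] (y : M) (h : ∀ φ : M →ₗ[ℤ] K, φ y = 0) : y ∈ Submodule.torsion ℤ M := by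
  let Q := M ⧸ Submodule.torsion ℤ M
  have hfree : Module.Free ℤ Q := inferInstance
  let bs := Module.Free.chooseBasis ℤ Q
  rw [← Submodule.Quotient.mk_eq_zero]
  apply bs.repr.injective
  ext i
  have := h ((Algebra.linearMap ℤ K).comp ((bs.coord i).comp (Submodule.mkQ _)))
  have h2 : algebraMap ℤ K (bs.repr (Submodule.Quotient.mk y) i) = 0 := this
  rw [map_zero, Finsupp.zero_apply]
  exact (FaithfulSMul.algebraMap_injective ℤ K) (by rw [h2, map_zero])

lemma unip {M : Type u} [AddCommGroup M] [hM : Module.Finite ℤ M] (α : M ≃ₗ[ℤ] M)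
    (h : ∀ (φ : M →ₗ[ℤ] ℂ) (l : ℂ), φ ≠ 0 → (∀ m, φ (α m) = l * φ m) → ‖l‖ ≤ 1) :
    ∃ b : ℕ, 0 < b ∧ ∃ r : ℕ, ((α : M →ₗ[ℤ] M) ^ b - 1 : Module.End ℤ M) ^ r = 0 := by
  classical
  let K := AlgebraicClosure ℚ
  let a : Module.End ℤ M := (α : M →ₗ[ℤ] M)
  let f : Module.End K (M →ₗ[ℤ] K) := precomp K a
  have hfd : Module.Finite K (M →ₗ[ℤ] K) := finite_hom K
  have hroots : ∀ x ∈ (minpoly K f).roots, ∃ n : ℕ, 0 < n ∧ x ^ n = 1 := by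
    intro x hx
    have hx1 : (minpoly K f).IsRoot x := isRoot_of_mem_roots hx
    obtain ⟨φ, hφ⟩ := (Module.End.hasEigenvalue_of_isRoot hx1).exists_hasEigenvector
    have hφ1 : ∀ m, φ (α m) = x * φ m := by
      intro m
      have := hφ.apply_eq_smul
      exact LinearMap.congr_fun this m
    have hφ0 : φ ≠ 0 := hφ.2
    have hpow : ∀ (n : ℕ) m, φ ((a ^ n) m) = x ^ n * φ m := by
      intro n
      induction n with
      | zero => intro m; simp
      | succ n ih =>
        intro m
        rw [pow_succ', Module.End.mul_apply]
        change φ (α _) = _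
        rw [hφ1, ih]
        ring
    obtain ⟨m0, hm0⟩ : ∃ m, φ m ≠ 0 := by
      by_contra hcon
      push Not at hcon
      exact hφ0 (LinearMap.ext hcon)
    apply kronecker_closure
    · rintro rfl
      apply hm0
      have := hφ1 (α.symm m0)
      simpa using this
    · obtain ⟨p, hp, hp0⟩ := LinearMap.exists_monic_and_aeval_eq_zero ℤ a
      refine ⟨p, hp, ?_⟩
      have h1 : φ ((aeval a p) m0) = (eval₂ (algebraMap ℤ K) x p) * φ m0 := by
        rw [aeval_eq_sum_range, eval₂_eq_sum_range, Finset.sum_mul, LinearMap.sum_apply, map_sum]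
        apply Finset.sum_congr rfl
        intro i _
        rw [LinearMap.smul_apply, map_smul, hpow]
        simp [mul_assoc]
      rw [hp0] at h1
      simp only [LinearMap.zero_apply, map_zero] at h1
      exact (mul_eq_zero.1 h1.symm).resolve_right hm0
    · intro σ
      refine h ((σ.toAddMonoidHom.toIntLinearMap).comp φ) (σ x) ?_ ?_
      · intro h0
        apply hm0
        have := LinearMap.congr_fun h0 m0
        have h2 : σ (φ m0) = 0 := this
        exact (map_eq_zero σ).1 h2
      · intro m
        change σ (φ (α m)) = σ x * σ (φ m)
        rw [hφ1, map_mul]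
  choose! N hN0 hN1 using hroots
  let b1 := ∏ x ∈ (minpoly K f).roots.toFinset, N x
  have hb1 : 0 < b1 := Finset.prod_pos fun x hx => hN0 x (Multiset.mem_toFinset.1 hx)
  have hb1' : ∀ x ∈ (minpoly K f).roots, x ^ b1 = 1 := by
    intro x hx
    obtain ⟨c, hc⟩ : N x ∣ b1 := Finset.dvd_prod_of_mem N (Multiset.mem_toFinset.2 hx)
    rw [hc, pow_mul, hN1 x hx, one_pow]
  set r := Multiset.card (minpoly K f).roots with hr
  have hdiv : minpoly K f ∣ (X ^ b1 - 1) ^ r := by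
    have := prod_dvd_pow b1 _ hb1'
    have hs : (minpoly K f).Splits := IsAlgClosed.splits _
    have h2 := hs.eq_prod_roots_of_monic (minpoly.monic (Algebra.IsIntegral.isIntegral f))
    rwa [← h2] at this
  have hf0 : (f ^ b1 - 1) ^ r = 0 := by
    obtain ⟨q, hq⟩ := hdiv
    have := congrArg (aeval f) hq
    simpa using this
  have hcomm : ∀ (n : ℕ) (φ : M →ₗ[ℤ] K), ((f ^ b1 - 1) ^ n) φ = φ.comp ((a ^ b1 - 1) ^ n) := by
    intro n
    induction n with
    | zero => intro φ; rfl
    | succ n ih =>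
      intro φ
      rw [pow_succ, Module.End.mul_apply, ih, pow_succ']
      ext m
      simp [f, precomp_pow]
  have htors : ∀ m, ((a ^ b1 - 1) ^ r) m ∈ Submodule.torsion ℤ M := by
    intro m
    apply torsion_of_all_zero K
    intro φ
    have := hcomm r φ
    rw [hf0] at this
    exact (LinearMap.congr_fun this m).symm
  have hfin : Finite (Submodule.torsion ℤ M) :=
    Module.finite_of_fg_torsion _ Submodule.torsion_isTorsion
  have hmaps : ∀ m ∈ Submodule.torsion ℤ M, a m ∈ Submodule.torsion ℤ M := by
    intro m hm
    rw [Submodule.mem_torsion_iff] at hm ⊢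
    obtain ⟨c, hc⟩ := hm
    refine ⟨c, ?_⟩
    have : a ((c : ℤ) • m) = 0 := by
      have : (c : ℤ) • m = 0 := hc
      rw [this, map_zero]
    rw [map_smul] at this
    exact this
  let τ : Submodule.torsion ℤ M → Submodule.torsion ℤ M := fun m => ⟨a m, hmaps m m.2⟩
  have hτ : Function.Bijective τ := by
    apply Function.Injective.bijective_of_finite
    intro x y hxy
    exact Subtype.ext (α.injective (congrArg Subtype.val hxy))
  let e : Equiv.Perm (Submodule.torsion ℤ M) := Equiv.ofBijective τ hτ
  obtain ⟨b2, hb2, he⟩ := isOfFinOrder_iff_pow_eq_one.1 (isOfFinOrder_of_finite e)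
  have hepow : ∀ (n : ℕ) x, (((e ^ n) x : Submodule.torsion ℤ M) : M) = (a ^ n) x := by
    intro n
    induction n with
    | zero => intro x; rfl
    | succ n ih =>
      intro x
      rw [pow_succ', Equiv.Perm.mul_apply, pow_succ', Module.End.mul_apply, ← ih]
      rfl
  have h2 : ∀ m ∈ Submodule.torsion ℤ M, (a ^ b2) m = m := by
    intro m hm
    have := hepow b2 ⟨m, hm⟩
    rw [he] at this
    exact this.symm
  refine ⟨b1 * b2, Nat.mul_pos hb1 hb2, 1 + r, ?_⟩
  change (a ^ (b1 * b2) - 1) ^ (1 + r) = 0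
  have hzero : (a ^ b2 - 1) * (a ^ b1 - 1) ^ r = 0 := by
    ext m
    rw [Module.End.mul_apply, LinearMap.sub_apply, h2 _ (htors m)]
    simp
  have hd1 : (X ^ b2 - 1 : ℤ[X]) ∣ X ^ (b1 * b2) - 1 := by
    have := sub_dvd_pow_sub_pow (X ^ b2 : ℤ[X]) 1 b1
    rwa [← pow_mul, one_pow, mul_comm] at this
  have hd2 : (X ^ b1 - 1 : ℤ[X]) ∣ X ^ (b1 * b2) - 1 := by
    have := sub_dvd_pow_sub_pow (X ^ b1 : ℤ[X]) 1 b2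
    rwa [← pow_mul, one_pow] at this
  have hd3 : (X ^ b2 - 1 : ℤ[X]) * (X ^ b1 - 1) ^ r ∣ (X ^ (b1 * b2) - 1) ^ (1 + r) := by
    rw [pow_add, pow_one]
    exact mul_dvd_mul hd1 (pow_dvd_pow_of_dvd hd2 r)
  obtain ⟨q, hq⟩ := hd3
  have := congrArg (aeval a) hq
  simp only [map_pow, map_sub, map_mul, aeval_X, map_one] at this
  rw [this, hzero, zero_mul]

/-- Passing to multiples. -/
lemma unip_mul {R : Type*} [Ring R] (a : R) (b r : ℕ) (h : (a ^ b - 1) ^ r = 0) (m : ℕ) :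
    (a ^ (b * m) - 1) ^ r = 0 := by
  have hd2 : (X ^ b - 1 : ℤ[X]) ∣ X ^ (b * m) - 1 := by
    have := sub_dvd_pow_sub_pow (X ^ b : ℤ[X]) 1 m
    rwa [← pow_mul, one_pow] at this
  obtain ⟨q, hq⟩ := pow_dvd_pow_of_dvd hd2 r
  have := congrArg (aeval a) hq
  simp only [map_pow, map_sub, map_mul, aeval_X, map_one] at this
  rw [this, h, zero_mul]

end Unip

end Gromov

namespace Gromov

section NilExt

open scoped Pointwise Classical commutatorElement IsMulCommutative

universe u

lemma WPG.of_surjective {G H : Type u} [Group G] [Group H] (f : G →* H)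
    (hf : Function.Surjective f) (h : WPG G) : WPG H := fun T => by
  obtain ⟨g, hg⟩ := hf.hasRightInverse
  obtain ⟨C, d, hC⟩ := h (T.image g)
  refine ⟨C, d, fun k => le_trans ?_ (hC k)⟩
  have h1 : T = (T.image g).image f := by
    rw [Finset.image_image]
    conv_lhs => rw [← Finset.image_id (s := T)]
    congr 1
    ext x
    simp [hg x]
  conv_lhs => rw [h1, ← Finset.image_pow]
  exact Finset.card_image_le

/-- left-normed iterated commutators -/
def lnc {G : Type u} [Group G] (S : Set G) : ℕ → Set G
  | 0 => S
  | n + 1 => {z | ∃ x ∈ lnc S n, ∃ s ∈ S, ⁅x, s⁆ = z}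

lemma lnc_finite {G : Type u} [Group G] (S : Set G) (hS : S.Finite) (n : ℕ) : (lnc S n).Finite := by
  induction n with
  | zero => exact hS
  | succ n ih =>
    have : lnc S (n + 1) = Set.image2 (fun x s => ⁅x, s⁆) (lnc S n) S := by
      ext z
      simp [lnc, Set.mem_image2]
    rw [this]
    exact Set.Finite.image2 _ ih hS

lemma lnc_subset_lcs {G : Type u} [Group G] (S : Set G) (n : ℕ) :
    lnc S n ⊆ (⊤ : Subgroup G).lowerCentralSeries n := by
  induction n with
  | zero => intro x _; exact Subgroup.mem_top x
  | succ n ih =>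
    rintro _ ⟨x, hx, s, hs, rfl⟩
    exact Subgroup.commutator_mem_commutator (ih hx) (Subgroup.mem_top s)

lemma lcs_eq_normalClosure {G : Type u} [Group G] (S : Set G) (hS : Subgroup.closure S = ⊤)
    (n : ℕ) : (⊤ : Subgroup G).lowerCentralSeries n = Subgroup.normalClosure (lnc S n) := by
  apply le_antisymm
  · induction n with
    | zero =>
      rw [Subgroup.lowerCentralSeries_zero, ← hS]
      exact Subgroup.closure_le_normalClosure
    | succ n ih =>
      rw [Subgroup.lowerCentralSeries_succ]
      set R := Subgroup.normalClosure (lnc S (n + 1)) with hR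
      have hRn : R.upperCentralSeriesStep.Normal := by
        rw [Subgroup.upperCentralSeriesStep_eq_comap_center]
        infer_instance
      have h1 : Subgroup.normalClosure (lnc S n) ≤ R.upperCentralSeriesStep := by
        apply Subgroup.normalClosure_le_normal
        intro c hc
        change c ∈ R.upperCentralSeriesStep
        rw [Subgroup.upperCentralSeriesStep_eq_comap_center, Subgroup.mem_comap,
          Subgroup.mem_center_iff]
        intro g
        obtain ⟨g, rfl⟩ := QuotientGroup.mk'_surjective R g
        have hg : g ∈ Subgroup.closure S := by rw [hS]; exact Subgroup.mem_top g
        induction hg using Subgroup.closure_induction with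
        | mem s hs =>
          have : ⁅c, s⁆ ∈ R := Subgroup.subset_normalClosure ⟨c, hc, s, hs, rfl⟩
          have h2 : (QuotientGroup.mk' R) ⁅c, s⁆ = 1 := (QuotientGroup.eq_one_iff _).2 this
          rw [map_commutatorElement, commutatorElement_eq_one_iff_mul_comm] at h2
          exact h2.symm
        | one => simp
        | mul x y _ _ hx hy => 
          rw [map_mul, mul_assoc, hy, ← mul_assoc, hx, mul_assoc]
        | inv x _ hx =>
          rw [map_inv]
          exact (Commute.inv_left (show Commute _ _ from hx)).eq
      rw [Subgroup.commutator_le]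
      intro x hx g _
      have := h1 (ih hx)
      exact this g
  · apply Subgroup.normalClosure_le_normal
    exact lnc_subset_lcs S n

lemma nilpotent_of_lnc {G : Type u} [Group G] (S : Set G) (hS : Subgroup.closure S = ⊤) (n : ℕ)
    (h : ∀ x ∈ lnc S n, x = 1) : Group.IsNilpotent G := by
  rw [Subgroup.nilpotent_iff_lowerCentralSeries]
  refine ⟨n, ?_⟩
  rw [lcs_eq_normalClosure S hS, eq_bot_iff]
  apply Subgroup.normalClosure_le_normal
  intro x hx
  exact h x hx

lemma lcs_last_fg {G : Type u} [Group G] [hfg : Group.FG G] (n : ℕ)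
    (h : (⊤ : Subgroup G).lowerCentralSeries (n + 1) = ⊥) :
    ((⊤ : Subgroup G).lowerCentralSeries n).FG := by
  obtain ⟨S, hS⟩ := hfg.out
  have hcent : ∀ x ∈ (⊤ : Subgroup G).lowerCentralSeries n, ∀ g : G, g * x = x * g := by
    intro x hx g
    have : ⁅x, g⁆ ∈ (⊤ : Subgroup G).lowerCentralSeries (n + 1) :=
      Subgroup.commutator_mem_commutator hx (Subgroup.mem_top g)
    rw [h, Subgroup.mem_bot, commutatorElement_eq_one_iff_mul_comm] at this
    exact this.symm
  have hle : Subgroup.closure (lnc (S : Set G) n) ≤ (⊤ : Subgroup G).lowerCentralSeries n :=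
    (Subgroup.closure_le _).2 (lnc_subset_lcs _ n)
  have hnorm : (Subgroup.closure (lnc (S : Set G) n)).Normal := by
    constructor
    intro x hx g
    rw [hcent x (hle hx) g, mul_inv_cancel_right]
    exact hx
  have heq : (⊤ : Subgroup G).lowerCentralSeries n = Subgroup.closure (lnc (S : Set G) n) := by
    apply le_antisymm _ hle
    rw [lcs_eq_normalClosure _ hS]
    exact Subgroup.normalClosure_le_normal Subgroup.subset_closure
  rw [heq]
  have hf := lnc_finite (S : Set G) S.finite_toSet n
  exact ⟨hf.toFinset, by simp⟩

/-- Growth forces eigenvalues of conjugation to be bounded by one. -/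
lemma eigen_le_one {G : Type u} [Group G] (hG : WPG G) (A : Subgroup G) [hA : A.Normal] (t : G)
    (φ : A →* Multiplicative ℂ) (l : ℂ)
    (h : ∀ a, (φ (MulAut.conjNormal t a)).toAdd = l * (φ a).toAdd)
    (hφ : ∃ e, (φ e).toAdd ≠ 0) : ‖l‖ ≤ 1 := by
  by_contra hl
  push Not at hl
  obtain ⟨e, he⟩ := hφ
  obtain ⟨p, hp⟩ := pow_unbounded_of_one_lt 3 hl
  set u := t ^ p with hu
  have hpow : ∀ (n : ℕ) a, (φ (MulAut.conjNormal (t ^ n) a)).toAdd = l ^ n * (φ a).toAdd := by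
    intro n
    induction n with
    | zero => intro a; simp
    | succ n ih =>
      intro a
      rw [pow_succ', map_mul, MulAut.mul_apply, h, ih]
      ring
  set x := ‖l‖ ^ p with hx
  have key : ∀ k, ∀ w ∈ wset (e : G) u k, ∃ hw : w ∈ A,
      2 * ‖(φ ⟨w, hw⟩).toAdd‖ ≤ (x ^ k - 1) * ‖(φ e).toAdd‖ := by
    intro k
    induction k with
    | zero =>
      intro w hw
      have : w = 1 := by simpa [wset] using hw
      subst this
      refine ⟨one_mem _, ?_⟩
      have : (⟨1, one_mem A⟩ : A) = 1 := rfl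
      rw [this, map_one]
      simp
    | succ k ih =>
      intro w hw
      rw [wset, Finset.mem_union, Finset.mem_mul] at hw
      have hx3 : 0 ≤ x ^ k := by positivity
      rcases hw with hw | ⟨v, hv, z, hz, rfl⟩
      · obtain ⟨h1, h2⟩ := ih w hw
        refine ⟨h1, h2.trans ?_⟩
        gcongr
        · linarith
        · lia
      · obtain ⟨h1, h2⟩ := ih v hv
        rw [Finset.mem_singleton] at hz
        subst hz
        have hz : u ^ k * e * (u ^ k)⁻¹ ∈ A := hA.conj_mem _ e.2 _
        refine ⟨mul_mem h1 hz, ?_⟩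
        have h3 : (⟨v * (u ^ k * e * (u ^ k)⁻¹), mul_mem h1 hz⟩ : A)
            = ⟨v, h1⟩ * MulAut.conjNormal (t ^ (p * k)) e := by
          apply Subtype.ext
          rw [Subgroup.coe_mul, MulAut.conjNormal_apply, pow_mul]
        rw [h3, map_mul, toAdd_mul, hpow]
        have h4 := norm_add_le (φ ⟨v, h1⟩).toAdd (l ^ (p * k) * (φ e).toAdd)
        rw [norm_mul, norm_pow, pow_mul ‖l‖, ← hx] at h4
        have h5 : x ^ (k + 1) ≥ 3 * x ^ k := by
          rw [pow_succ]; nlinarith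
        nlinarith [norm_nonneg (φ e).toAdd]
  obtain ⟨k, w, hw, w', hw', hww⟩ := wset_collision hG (e : G) u
  obtain ⟨h1, h2⟩ := key k w hw
  obtain ⟨h1', h2'⟩ := key k w' hw'
  have h3 : (⟨w', h1'⟩ : A) = ⟨w, h1⟩ * MulAut.conjNormal (t ^ (p * k)) e := by
    apply Subtype.ext
    rw [Subgroup.coe_mul, MulAut.conjNormal_apply, pow_mul]
    exact hww.symm
  have h4 : (φ ⟨w', h1'⟩).toAdd = (φ ⟨w, h1⟩).toAdd + l ^ (p * k) * (φ e).toAdd := by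
    rw [h3, map_mul, toAdd_mul, hpow]
  have h5 : l ^ (p * k) * (φ e).toAdd = (φ ⟨w', h1'⟩).toAdd - (φ ⟨w, h1⟩).toAdd := by
    rw [h4]; ring
  have h6 := norm_sub_le (φ ⟨w', h1'⟩).toAdd (φ ⟨w, h1⟩).toAdd
  rw [← h5, norm_mul, norm_pow, pow_mul ‖l‖, ← hx] at h6
  have h7 : 0 < ‖(φ e).toAdd‖ := norm_pos_iff.2 he
  nlinarith

lemma fg_map {G H : Type u} [Group G] [Group H] {P : Subgroup G} (h : P.FG) (f : G →* H) :
    (P.map f).FG := by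
  obtain ⟨S, rfl⟩ := h
  refine ⟨S.image f, ?_⟩
  rw [MonoidHom.map_closure, Finset.coe_image]

/-- Conjugation action on a normal abelian subgroup. -/
def cj {G : Type u} [Group G] (Z : Subgroup G) [Z.Normal] [IsMulCommutative Z] :
    G →* Module.End ℤ (Additive Z) where
  toFun g := AddMonoidHom.toIntLinearMap (MonoidHom.toAdditive (MulAut.conjNormal g).toMonoidHom)
  map_one' := by
    ext z
    simp
  map_mul' g h := by
    ext z
    simp

lemma cj_apply {G : Type u} [Group G] (Z : Subgroup G) [Z.Normal] [IsMulCommutative Z] (g : G)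
    (z : Z) : (((cj Z g (Additive.ofMul z)).toMul : Z) : G) = g * z * g⁻¹ := rfl

lemma unip_conj {G : Type u} [Group G] (hG : WPG G) (Z : Subgroup G) [Z.Normal]
    [IsMulCommutative Z] (hZ : Z.FG) (t : G) :
    ∃ b : ℕ, 0 < b ∧ ∃ r : ℕ, (cj Z t ^ b - 1) ^ r = 0 := by
  have h1 : Group.FG Z := (Group.fg_iff_subgroup_fg Z).2 hZ
  have h2 : AddGroup.FG (Additive Z) := inferInstance
  have h3 : Module.Finite ℤ (Additive Z) := Module.Finite.iff_addGroup_fg.2 h2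
  let α : Additive Z ≃ₗ[ℤ] Additive Z :=
    (MulEquiv.toAdditive (MulAut.conjNormal t : MulAut Z)).toIntLinearEquiv
  have hα : (α : Additive Z →ₗ[ℤ] Additive Z) = cj Z t := by
    ext z
    rfl
  have key := unip α ?_
  · rw [hα] at key
    exact key
  intro φ l hφ hl
  refine eigen_le_one hG Z t (AddMonoidHom.toMultiplicativeRight φ.toAddMonoidHom) l ?_ ?_
  · intro a
    exact hl (Additive.ofMul a)
  · by_contra hcon
    push Not at hcon
    apply hφ
    apply LinearMap.ext
    intro z
    exact hcon z.toMul

lemma nil_ext (c : ℕ) : ∀ (G : Type u) [Group G], WPG G → ∀ (N : Subgroup G) [N.Normal], N.FG →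
    N.lowerCentralSeries c = ⊥ → ∀ t : G, ∃ a : ℕ, 0 < a ∧
      Group.IsNilpotent (N ⊔ Subgroup.zpowers (t ^ a) : Subgroup G) := by
  induction c with
  | zero =>
    intro G _ _ N _ _ hN t
    refine ⟨1, one_pos, ?_⟩
    rw [Subgroup.lowerCentralSeries_zero] at hN
    subst hN
    rw [bot_sup_eq]
    exact CommGroup.isNilpotent (G := Subgroup.zpowers (t ^ 1))
  | succ c ih =>
    intro G _ hG N _ hfg hN t
    set Z := N.lowerCentralSeries c with hZ
    have hZN : Z ≤ N := Subgroup.lowerCentralSeries_le_self N c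
    have hcent : ∀ z ∈ Z, ∀ n ∈ N, z * n = n * z := by
      intro z hz n hn
      have : ⁅z, n⁆ ∈ N.lowerCentralSeries (c + 1) := Subgroup.commutator_mem_commutator hz hn
      rw [hN, Subgroup.mem_bot, commutatorElement_eq_one_iff_mul_comm] at this
      exact this
    have hZnorm : Z.Normal := inferInstance
    have hZcomm : IsMulCommutative Z :=
      ⟨⟨fun x y => Subtype.ext (hcent x x.2 y (hZN y.2))⟩⟩
    have hZfg : Z.FG := by
      have h1 : Group.FG N := (Group.fg_iff_subgroup_fg N).2 hfg
      have h2 : ((⊤ : Subgroup N).lowerCentralSeries c).FG := by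
        apply lcs_last_fg
        have := Subgroup.top_subtype_lowerCentralSeries N (c + 1)
        rw [hN] at this
        exact (Subgroup.map_eq_bot_iff_of_injective _ N.subtype_injective).1 this
      have h3 := Subgroup.top_subtype_lowerCentralSeries N c
      rw [← hZ] at h3
      rw [← h3]
      exact fg_map h2 _
    obtain ⟨a, ha, hnil⟩ := ih (G ⧸ Z) (hG.of_surjective _ (QuotientGroup.mk'_surjective Z))
      (N.map (QuotientGroup.mk' Z)) (fg_map hfg _) (by
        rw [← Subgroup.map_lowerCentralSeries, ← hZ]
        exact (Subgroup.map_eq_bot_iff _).2 (by simp)) (QuotientGroup.mk' Z t)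
    obtain ⟨b, hb, r, hr⟩ := unip_conj hG Z hZfg t
    have hu := unip_mul _ b r hr a
    refine ⟨b * a, Nat.mul_pos hb ha, ?_⟩
    set L := N ⊔ Subgroup.zpowers (t ^ (b * a)) with hL
    obtain ⟨m, hm⟩ := (Subgroup.isNilpotent_iff_lowerCentralSeries _).1 hnil
    have hLm : L.lowerCentralSeries m ≤ Z := by
      have h1 : L.map (QuotientGroup.mk' Z) ≤ N.map (QuotientGroup.mk' Z) ⊔
          Subgroup.zpowers ((QuotientGroup.mk' Z t) ^ a) := by
        rw [hL, Subgroup.map_sup, MonoidHom.map_zpowers, map_pow]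
        refine sup_le_sup_left ?_ _
        rw [Subgroup.zpowers_le, mul_comm, pow_mul]
        exact pow_mem (Subgroup.mem_zpowers _) _
      have h2 := Subgroup.lowerCentralSeries_mono m h1
      beta_reduce at h2
      rw [hm, ← Subgroup.map_lowerCentralSeries, le_bot_iff, Subgroup.map_eq_bot_iff] at h2
      simpa using h2
    set α := cj Z t ^ (b * a) with hα
    have hstep : ∀ j ≤ r, ∀ x ∈ L.lowerCentralSeries (m + j), ∃ hx : x ∈ Z,
        ((α - 1) ^ (r - j)) (Additive.ofMul ⟨x, hx⟩) = 0 := by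
      intro j
      induction j with
      | zero =>
        intro _ x hx
        refine ⟨hLm hx, ?_⟩
        rw [Nat.sub_zero, hu]
        rfl
      | succ j ihj =>
        intro hj
        let P : Subgroup G := 
          { carrier := {x | ∃ hx : x ∈ Z,
              ((α - 1) ^ (r - (j + 1))) (Additive.ofMul ⟨x, hx⟩) = 0}
            one_mem' := ⟨one_mem _, map_zero _⟩
            mul_mem' := by
              rintro x y ⟨hx, hx'⟩ ⟨hy, hy'⟩
              refine ⟨mul_mem hx hy, ?_⟩
              have := map_add ((α - 1) ^ (r - (j + 1))) (Additive.ofMul ⟨x, hx⟩)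
                (Additive.ofMul ⟨y, hy⟩)
              rw [hx', hy', add_zero] at this
              exact this
            inv_mem' := by
              rintro x ⟨hx, hx'⟩
              refine ⟨inv_mem hx, ?_⟩
              have := map_neg ((α - 1) ^ (r - (j + 1))) (Additive.ofMul ⟨x, hx⟩)
              rw [hx', neg_zero] at this
              exact this }
        have hP : L.lowerCentralSeries (m + (j + 1)) ≤ P := by
          rw [← add_assoc, Subgroup.lowerCentralSeries_succ, Subgroup.commutator_le]
          intro x hx g hg
          obtain ⟨hxZ, hx0⟩ := ihj (by lia) x hx
          have hNn : N.Normal := inferInstance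
          obtain ⟨n, hn, i, rfl⟩ := mem_sup_zpowers N (t ^ (b * a))
            (fun h hh => hNn.conj_mem h hh _) (fun h hh => by
              simpa using hNn.conj_mem h hh (t ^ (b * a))⁻¹) hg
          set u := t ^ (b * a) with hu'
          have hαu : α = cj Z u := by rw [hα, hu', map_pow]
          set k := r - (j + 1) with hk
          rw [show r - j = k + 1 by lia] at hx0
          set z : Additive Z := Additive.ofMul ⟨x, hxZ⟩ with hz
          set y := ((α - 1) ^ k) z with hy
          have hy1 : cj Z u y = y := by
            rw [pow_succ', Module.End.mul_apply, ← hy, LinearMap.sub_apply, hαu] at hx0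
            exact sub_eq_zero.1 hx0
          have hyi : cj Z (u ^ i) y = y := by
            have : u ^ i ∈ Subgroup.zpowers u := Subgroup.zpow_mem_zpowers u i
            let F : Subgroup G :=
              { carrier := {g | cj Z g y = y}
                one_mem' := by
                  change cj Z 1 y = y
                  rw [map_one]; rfl
                mul_mem' := by
                  intro g h (hg : cj Z g y = y) (hh : cj Z h y = y)
                  change cj Z (g * h) y = y
                  rw [map_mul, Module.End.mul_apply, hh, hg]
                inv_mem' := by
                  intro g (hg : cj Z g y = y)
                  change cj Z g⁻¹ y = y
                  conv_lhs => rw [← hg]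
                  rw [← Module.End.mul_apply, ← map_mul, inv_mul_cancel, map_one]
                  rfl }
            have hF : Subgroup.zpowers u ≤ F := by
              rw [Subgroup.zpowers_le]
              exact hy1
            exact hF this
          have hcom : Commute ((α - 1) ^ k) (cj Z (u ^ i)) := by
            have h1 : Commute α (cj Z (u ^ i)) := by
              rw [hαu]
              exact ((Commute.refl u).zpow_right i).map (cj Z)
            exact (h1.sub_left (Commute.one_left _)).pow_left k
          have hconjZ : u ^ i * x⁻¹ * (u ^ i)⁻¹ ∈ Z := hZnorm.conj_mem _ (inv_mem hxZ) _
          have hcalc : ⁅x, n * u ^ i⁆ = x * (u ^ i * x⁻¹ * (u ^ i)⁻¹) := by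
            have h1 := hcent _ hconjZ n hn
            calc ⁅x, n * u ^ i⁆ = x * (n * (u ^ i * x⁻¹ * (u ^ i)⁻¹) * n⁻¹) := by
                  rw [commutatorElement_def]; group
              _ = _ := by rw [← h1]; group
          rw [hcalc]
          refine ⟨mul_mem hxZ hconjZ, ?_⟩
          have h3 : (Additive.ofMul (⟨x * (u ^ i * x⁻¹ * (u ^ i)⁻¹), mul_mem hxZ hconjZ⟩ : Z))
              = z - cj Z (u ^ i) z := by
            apply Additive.toMul.injective
            apply Subtype.ext
            rw [sub_eq_add_neg, toMul_add, toMul_neg]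
            change _ = x * (u ^ i * x * (u ^ i)⁻¹)⁻¹
            rw [toMul_ofMul]
            group
          rw [h3, map_sub, ← Module.End.mul_apply, hcom.eq, Module.End.mul_apply, ← hy, hyi,
            sub_self]
        exact fun x hx => hP hx
    apply Subgroup.isNilpotent_of_lowerCentralSeries_eq_bot (n := m + r)
    rw [eq_bot_iff]
    intro x hx
    obtain ⟨hxZ, hx0⟩ := hstep r le_rfl x hx
    rw [Nat.sub_self, pow_zero] at hx0
    have : (⟨x, hxZ⟩ : Z) = 1 := hx0
    exact congrArg Subtype.val this

end NilExt

end Gromov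

namespace Gromov

section Compact

open scoped Pointwise Classical commutatorElement

universe u v

variable {G : Type u} [Group G] {A : Type v} [NormedRing A] [NormedAlgebra ℝ A]

lemma norm_pow_sub_one_le (a : A) (ha : ‖a‖ ≤ 1) (e : ℕ) : ‖a ^ e - 1‖ ≤ e * ‖a - 1‖ := by
  induction e with
  | zero => simp
  | succ e ih =>
    have h1 : a ^ (e + 1) - 1 = (a ^ e - 1) * a + (a - 1) := by
      rw [pow_succ]; noncomm_ring
    rw [h1]
    calc _ ≤ ‖(a ^ e - 1) * a‖ + ‖a - 1‖ := norm_add_le _ _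
      _ ≤ ‖a ^ e - 1‖ * ‖a‖ + ‖a - 1‖ := by gcongr; exact norm_mul_le _ _
      _ ≤ ‖a ^ e - 1‖ * 1 + ‖a - 1‖ := by gcongr
      _ ≤ _ := by push_cast; linarith

lemma norm_pow_sub_one_ge (a : A) (ha : ‖a‖ ≤ 1) (e : ℕ) (he : 1 ≤ e)
    (h : e * ‖a - 1‖ ≤ 1 / 4) : ‖a - 1‖ / 2 ≤ ‖a ^ e - 1‖ := by
  set δ := ‖a - 1‖ with hδ
  have hδ0 : 0 ≤ δ := norm_nonneg _
  have key : ∀ e : ℕ, ‖a ^ e - 1 - (e : ℝ) • (a - 1)‖ ≤ (e : ℝ) ^ 2 * δ ^ 2 := by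
    intro e
    induction e with
    | zero => simp
    | succ e ih =>
      have h1 : a ^ (e + 1) - 1 - ((e + 1 : ℕ) : ℝ) • (a - 1)
          = (a ^ e - 1 - (e : ℝ) • (a - 1)) + (a ^ e - 1) * (a - 1) := by
        push_cast
        rw [add_smul, one_smul, pow_succ]; noncomm_ring
      rw [h1]
      calc _ ≤ ‖a ^ e - 1 - (e : ℝ) • (a - 1)‖ + ‖(a ^ e - 1) * (a - 1)‖ := norm_add_le _ _
        _ ≤ (e : ℝ) ^ 2 * δ ^ 2 + ‖a ^ e - 1‖ * ‖a - 1‖ := by gcongr; exact norm_mul_le _ _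
        _ ≤ (e : ℝ) ^ 2 * δ ^ 2 + (e * δ) * δ := by
          gcongr; exact norm_pow_sub_one_le a ha e
        _ ≤ _ := by push_cast; nlinarith [sq_nonneg δ, (Nat.cast_nonneg e : (0 : ℝ) ≤ e)]
  have h1 := key e
  have h2 : ‖(e : ℝ) • (a - 1)‖ = e * δ := by
    rw [norm_smul, Real.norm_natCast]
  have h3 := norm_sub_norm_le ((e : ℝ) • (a - 1)) (a ^ e - 1)
  rw [norm_sub_rev, h2] at h3
  rw [norm_sub_rev] at h1
  rw [norm_sub_rev] at h3
  have he' : (1 : ℝ) ≤ e := by exact_mod_cast he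
  have h4 : (e : ℝ) ^ 2 * δ ^ 2 ≤ e * δ * (1 / 4) := by
    have : (e : ℝ) ^ 2 * δ ^ 2 = (e * δ) * (e * δ) := by ring
    rw [this]; gcongr
  have h5 : δ ≤ e * δ := le_mul_of_one_le_left hδ0 he'
  linarith

variable (ρ : G →* A)

lemma norm_mul_inv_sub (hρ : ∀ g, ‖ρ g‖ ≤ 1) (g h : G) : ‖ρ (g * h⁻¹) - 1‖ ≤ ‖ρ g - ρ h‖ := by
  have h1 : ρ (g * h⁻¹) - 1 = (ρ g - ρ h) * ρ h⁻¹ := by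
    rw [sub_mul, ← map_mul, ← map_mul, mul_inv_cancel, map_one]
  rw [h1]
  calc _ ≤ ‖ρ g - ρ h‖ * ‖ρ h⁻¹‖ := norm_mul_le _ _
    _ ≤ ‖ρ g - ρ h‖ * 1 := by gcongr; exact hρ _
    _ = _ := mul_one _

lemma norm_comm_sub (hρ : ∀ g, ‖ρ g‖ ≤ 1) (g h : G) : ‖ρ ⁅g, h⁆ - 1‖ ≤ 2 * ‖ρ g - 1‖ * ‖ρ h - 1‖ := by
  have h1 : ⁅g, h⁆ = (g * h) * (h * g)⁻¹ := by rw [commutatorElement_def]; group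
  rw [h1]
  refine (norm_mul_inv_sub ρ hρ _ _).trans ?_
  have h2 : ρ (g * h) - ρ (h * g) = (ρ g - 1) * (ρ h - 1) - (ρ h - 1) * (ρ g - 1) := by
    rw [map_mul, map_mul]; noncomm_ring
  rw [h2]
  refine (norm_sub_le _ _).trans ?_
  have := norm_mul_le (ρ g - 1) (ρ h - 1)
  have := norm_mul_le (ρ h - 1) (ρ g - 1)
  nlinarith

lemma step (hρ : ∀ g, ‖ρ g‖ ≤ 1) (N : ℕ) (hN : 1 ≤ N) (x : G) (hx : ρ x ≠ 1) (hxN : N * ‖ρ x - 1‖ ≤ 1 / 4) (Q : Finset G)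
    (hQ : ∀ p ∈ Q, ‖ρ p - 1‖ ≤ ‖ρ x - 1‖ / 8) :
    ∃ Q' : Finset G, Q'.card = N * Q.card ∧ (∀ p ∈ Q', ‖ρ p - 1‖ ≤ 2 * N * ‖ρ x - 1‖) ∧
      ∀ q ∈ Q', ∃ i < N, ∃ p ∈ Q, q = x ^ i * p := by
  set δ := ‖ρ x - 1‖ with hδ
  have hδ0 : 0 < δ := norm_pos_iff.2 (sub_ne_zero.2 hx)
  have haux : ∀ e : ℕ, 1 ≤ e → e < N → ∀ p ∈ Q, ∀ p' ∈ Q, p ≠ x ^ e * p' := by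
    intro e he heN p hp p' hp' heq
    have h1 : x ^ e = p * p'⁻¹ := by rw [heq]; group
    have h2 := norm_mul_inv_sub ρ hρ p p'
    rw [← h1, map_pow] at h2
    have h3 : (e : ℝ) * ‖ρ x - 1‖ ≤ 1 / 4 := by
      refine le_trans ?_ hxN
      gcongr
    have h4 := norm_pow_sub_one_ge (ρ x) (hρ x) e he h3
    have h5 : ‖ρ p - ρ p'‖ ≤ δ / 8 + δ / 8 := by
      have : ρ p - ρ p' = (ρ p - 1) - (ρ p' - 1) := by abel
      rw [this]
      exact (norm_sub_le _ _).trans (add_le_add (hQ p hp) (hQ p' hp'))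
    rw [← hδ] at h4
    linarith
  refine ⟨(Finset.range N ×ˢ Q).image (fun q => x ^ q.1 * q.2), ?_, ?_, ?_⟩
  · rw [Finset.card_image_of_injOn, Finset.card_product, Finset.card_range]
    rintro ⟨i, p⟩ hip ⟨j, q⟩ hjq heq
    simp only [Finset.coe_product, Set.mem_prod, Finset.mem_coe, Finset.mem_range] at hip hjq heq
    rcases lt_trichotomy i j with hij | hij | hij
    · exfalso
      refine haux (j - i) (by lia) (by lia) p hip.2 q hjq.2 ?_
      apply mul_left_cancel (a := x ^ i)
      rw [heq, ← mul_assoc, ← pow_add]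
      congr 2
      lia
    · subst hij
      rw [mul_left_cancel heq]
    · exfalso
      refine haux (i - j) (by lia) (by lia) q hjq.2 p hip.2 ?_
      apply mul_left_cancel (a := x ^ j)
      rw [← heq, ← mul_assoc, ← pow_add]
      congr 2
      lia
  · intro q hq
    obtain ⟨⟨i, p⟩, hip, rfl⟩ := Finset.mem_image.1 hq
    rw [Finset.mem_product, Finset.mem_range] at hip
    simp only at hip ⊢
    have h1 : ρ (x ^ i * p) - 1 = (ρ x ^ i - 1) * ρ p + (ρ p - 1) := by
      rw [map_mul, map_pow]; noncomm_ring
    rw [h1]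
    have h2 := norm_pow_sub_one_le (ρ x) (hρ x) i
    have hiN : (i : ℝ) ≤ N := by exact_mod_cast hip.1.le
    have hN1 : (1 : ℝ) ≤ N := by exact_mod_cast hN
    calc _ ≤ ‖(ρ x ^ i - 1) * ρ p‖ + ‖ρ p - 1‖ := norm_add_le _ _
      _ ≤ ‖ρ x ^ i - 1‖ * ‖ρ p‖ + ‖ρ p - 1‖ := by gcongr; exact norm_mul_le _ _
      _ ≤ ‖ρ x ^ i - 1‖ * 1 + ‖ρ p - 1‖ := by gcongr; exact hρ p
      _ ≤ N * δ * 1 + δ / 8 := by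
        gcongr
        · exact h2.trans (by gcongr)
        · exact hQ p hip.2
      _ ≤ _ := by nlinarith
  · intro q hq
    obtain ⟨⟨i, p⟩, hip, rfl⟩ := Finset.mem_image.1 hq
    rw [Finset.mem_product, Finset.mem_range] at hip
    exact ⟨i, hip.1, p, hip.2, rfl⟩

lemma lnc_word (T W : Finset G) (hTW : T ⊆ W) (h1 : 1 ∈ W) (hinv : ∀ w ∈ W, w⁻¹ ∈ W) (k : ℕ) :
    ∀ x ∈ lnc (T : Set G) k, x ∈ W ^ (3 * 2 ^ k) := by
  have hpinv : ∀ n : ℕ, ∀ x ∈ W ^ n, x⁻¹ ∈ W ^ n := by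
    intro n x hx
    have hW : W⁻¹ = W := by
      ext w
      rw [Finset.mem_inv']
      exact ⟨fun h => by simpa using hinv _ h, fun h => hinv _ h⟩
    have : x⁻¹ ∈ (W ^ n)⁻¹ := Finset.inv_mem_inv hx
    rwa [← inv_pow, hW] at this
  have key : ∀ k, ∀ x ∈ lnc (T : Set G) k, x ∈ W ^ (3 * 2 ^ k - 2) := by
    intro k
    induction k with
    | zero =>
      intro x hx
      simpa using hTW hx
    | succ k ih =>
      rintro _ ⟨x, hx, s, hs, rfl⟩
      have hsW : s ∈ W := hTW hs
      have hk : 1 ≤ 2 ^ k := Nat.one_le_two_pow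
      have : 3 * 2 ^ (k + 1) - 2 = (3 * 2 ^ k - 2) + 1 + (3 * 2 ^ k - 2) + 1 := by
        rw [pow_succ]; lia
      rw [this, pow_succ, pow_add, pow_succ, commutatorElement_def]
      exact Finset.mul_mem_mul (Finset.mul_mem_mul (Finset.mul_mem_mul (ih x hx) hsW)
        (hpinv _ _ (ih x hx))) (hinv s hsW)
  intro x hx
  exact Finset.pow_subset_pow_right h1 (Nat.sub_le _ _) (key k x hx)

lemma many (hρ : ∀ g, ‖ρ g‖ ≤ 1) (N : ℕ) (hN : 1 ≤ N) (T W : Finset G) (hTW : T ⊆ W) (h1 : 1 ∈ W)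
    (hinv : ∀ w ∈ W, w⁻¹ ∈ W) (hT : ∀ s ∈ T, ‖ρ s - 1‖ ≤ 1 / (32 * N)) (k : ℕ) :
    ∀ x ∈ lnc (T : Set G) k, ρ x ≠ 1 → ∀ Q : Finset G, (∀ p ∈ Q, ‖ρ p - 1‖ ≤ ‖ρ x - 1‖ / 8) →
      ∃ Q' : Finset G, Q'.card = N ^ (k + 1) * Q.card ∧ Q' ⊆ W ^ (3 * N * 2 ^ (k + 1)) * Q := by
  have hN1 : (1 : ℝ) ≤ N := by exact_mod_cast hN
  have hsmall : ∀ k, ∀ x ∈ lnc (T : Set G) k, ‖ρ x - 1‖ ≤ 1 / (32 * N) := by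
    intro k
    induction k with
    | zero => exact fun x hx => hT x hx
    | succ k ih =>
      rintro _ ⟨x, hx, s, hs, rfl⟩
      refine (norm_comm_sub ρ hρ x s).trans ?_
      have h2 := hT s hs
      have h3 : (1 : ℝ) / (32 * N) ≤ 1 / 2 := by
        apply one_div_le_one_div_of_le <;> linarith
      have h4 := ih x hx
      nlinarith [norm_nonneg (ρ x - 1), norm_nonneg (ρ s - 1)]
  have hNx : ∀ k, ∀ x ∈ lnc (T : Set G) k, N * ‖ρ x - 1‖ ≤ 1 / 4 := by
    intro k x hx
    calc (N : ℝ) * ‖ρ x - 1‖ ≤ N * (1 / (32 * N)) := by gcongr; exact hsmall k x hx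
      _ = 1 / 32 := by field_simp
      _ ≤ _ := by norm_num
  have hword : ∀ k, ∀ x ∈ lnc (T : Set G) k, ∀ i < N, x ^ i ∈ W ^ (3 * N * 2 ^ k) := by
    intro k x hx i hi
    have h2 := Finset.pow_mem_pow (n := i) (lnc_word T W hTW h1 hinv k x hx)
    rw [← pow_mul] at h2
    refine Finset.pow_subset_pow_right h1 ?_ h2
    calc 3 * 2 ^ k * i ≤ 3 * 2 ^ k * N := by gcongr
      _ = _ := by ring
  induction k with
  | zero =>
    intro x hx hx1 Q hQ
    obtain ⟨Q', hc, -, hw⟩ := step ρ hρ N hN x hx1 (hNx 0 x hx) Q hQ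
    refine ⟨Q', by simpa using hc, ?_⟩
    intro q hq
    obtain ⟨i, hi, p, hp, rfl⟩ := hw q hq
    refine Finset.mul_mem_mul ?_ hp
    refine Finset.pow_subset_pow_right h1 ?_ (hword 0 x hx i hi)
    gcongr <;> lia
  | succ k ih =>
    rintro x hx hx1 Q hQ
    obtain ⟨y, hy, s, hs, hxy⟩ := id hx
    obtain ⟨Q1, hc, hn, hw⟩ := step ρ hρ N hN x hx1 (hNx _ x hx) Q hQ
    have hy1 : ρ y ≠ 1 := by
      intro hy1
      apply hx1
      have : y ∈ ρ.ker := hy1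
      have h2 : ⁅y, s⁆ ∈ ρ.ker := by
        rw [commutatorElement_def, mul_assoc, mul_assoc]
        refine mul_mem this ?_
        rw [← mul_assoc]
        exact (inferInstance : ρ.ker.Normal).conj_mem _ (inv_mem this) _
      rw [hxy] at h2
      exact h2
    obtain ⟨Q', hc', hw'⟩ := ih y hy hy1 Q1 (by
      intro p hp
      refine (hn p hp).trans ?_
      have h2 := norm_comm_sub ρ hρ y s
      rw [hxy] at h2
      have h3 := hT s hs
      have h4 : 2 * (N : ℝ) * ‖ρ x - 1‖ ≤ 2 * N * (2 * ‖ρ y - 1‖ * (1 / (32 * N))) := by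
        gcongr
        exact h2.trans (by gcongr)
      refine h4.trans (le_of_eq ?_)
      field_simp
      ring)
    refine ⟨Q', by rw [hc', hc]; ring, hw'.trans ?_⟩
    have h2 : Q1 ⊆ W ^ (3 * N * 2 ^ (k + 1)) * Q := by
      intro q hq
      obtain ⟨i, hi, p, hp, rfl⟩ := hw q hq
      exact Finset.mul_mem_mul (hword _ x hx i hi) hp
    calc W ^ (3 * N * 2 ^ (k + 1)) * Q1
        ⊆ W ^ (3 * N * 2 ^ (k + 1)) * (W ^ (3 * N * 2 ^ (k + 1)) * Q) :=
          Finset.mul_subset_mul_left h2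
      _ = W ^ (3 * N * 2 ^ (k + 1 + 1)) * Q := by
        rw [← mul_assoc, ← pow_add]
        congr 2
        ring

lemma nilpotent_quot_of_near (hρ : ∀ g, ‖ρ g‖ ≤ 1) {d : ℕ} (hG : PG d G) (T : Finset G)
    (hgen : Subgroup.closure (T : Set G) = ⊤)
    (hT : ∀ s ∈ T, ‖ρ s - 1‖ ≤ 1 / (32 * (2 ^ (d + 1) : ℕ))) : Group.IsNilpotent (G ⧸ ρ.ker) := by
  set N := 2 ^ (d + 1) with hN
  have hN1 : 1 ≤ N := Nat.one_le_two_pow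
  set W := symmSet T with hW
  obtain ⟨C, hC⟩ := hG W
  have hk : ∃ k, ∀ x ∈ lnc (T : Set G) k, ρ x = 1 := by
    by_contra hcon
    push Not at hcon
    have hall : ∀ k, 2 ^ (k + 1) ≤ C * (4 * N) ^ d := by
      intro k
      obtain ⟨x, hx, hx1⟩ := hcon k
      obtain ⟨Q', hc, hw⟩ := many ρ hρ N hN1 T W (subset_symmSet T) (one_mem_symmSet T)
        (inv_mem_symmSet T) hT k x hx hx1 {1} (by
          intro p hp
          rw [Finset.mem_singleton] at hp
          subst hp
          rw [map_one, sub_self, norm_zero]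
          positivity)
      rw [Finset.singleton_one, mul_one] at hw
      have h1 := (Finset.card_le_card hw).trans (hC _)
      rw [hc, Finset.card_singleton, mul_one] at h1
      have h2 : 3 * N * 2 ^ (k + 1) + 1 ≤ 4 * N * 2 ^ (k + 1) := by
        have : 1 ≤ N * 2 ^ (k + 1) := Nat.mul_pos hN1 (by positivity)
        nlinarith
      have h3 : N ^ (k + 1) ≤ C * (4 * N) ^ d * (2 ^ (k + 1)) ^ d := by
        calc N ^ (k + 1) ≤ C * (4 * N * 2 ^ (k + 1)) ^ d := h1.trans (by gcongr)
          _ = _ := by rw [mul_pow]; ring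
      have h4 : N ^ (k + 1) = 2 ^ (k + 1) * (2 ^ (k + 1)) ^ d := by
        rw [hN]; ring
      rw [h4] at h3
      exact Nat.le_of_mul_le_mul_right h3 (by positivity)
    have := hall (C * (4 * N) ^ d)
    have h5 := Nat.lt_two_pow_self (n := C * (4 * N) ^ d)
    rw [pow_succ] at this
    lia
  obtain ⟨k, hk⟩ := hk
  have hle : (⊤ : Subgroup G).lowerCentralSeries k ≤ ρ.ker := by
    rw [lcs_eq_normalClosure _ hgen]
    exact Subgroup.normalClosure_le_normal hk
  rw [Subgroup.nilpotent_iff_lowerCentralSeries]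
  refine ⟨k, ?_⟩
  have := Subgroup.map_lowerCentralSeries (⊤ : Subgroup G) (QuotientGroup.mk' ρ.ker) k
  rw [Subgroup.map_top_of_surjective _ (QuotientGroup.mk'_surjective _)] at this
  rw [← this, Subgroup.map_eq_bot_iff]
  simpa using hle

lemma finite_subset_gen (U : Set G) (hfg : (Subgroup.closure U).FG) :
    ∃ T : Finset G, (T : Set G) ⊆ U ∧ Subgroup.closure (T : Set G) = Subgroup.closure U := by
  obtain ⟨S, hS⟩ := hfg
  have h1 : ∀ x ∈ Subgroup.closure U, ∃ T : Finset G, (T : Set G) ⊆ U ∧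
      x ∈ Subgroup.closure (T : Set G) := by
    intro x hx
    induction hx using Subgroup.closure_induction with
    | mem x hx => exact ⟨{x}, by simpa using hx, Subgroup.subset_closure (by simp)⟩
    | one => exact ⟨∅, by simp, one_mem _⟩
    | mul x y _ _ hx hy =>
      obtain ⟨T, hT, h⟩ := hx
      obtain ⟨T', hT', h'⟩ := hy
      refine ⟨T ∪ T', by simp [hT, hT'], mul_mem ?_ ?_⟩
      · exact Subgroup.closure_mono (by simp) h
      · exact Subgroup.closure_mono (by simp) h'
    | inv x _ hx =>
      obtain ⟨T, hT, h⟩ := hx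
      exact ⟨T, hT, inv_mem h⟩
  have h2 : ∀ s ∈ S, ∃ T : Finset G, (T : Set G) ⊆ U ∧ s ∈ Subgroup.closure (T : Set G) := by
    intro s hs
    apply h1
    rw [← hS]
    exact Subgroup.subset_closure hs
  choose! T hT hT' using h2
  refine ⟨S.biUnion T, ?_, le_antisymm ?_ ?_⟩
  · simpa using hT
  · apply Subgroup.closure_mono
    simpa using hT
  · rw [← hS, Subgroup.closure_le]
    intro s hs
    refine Subgroup.closure_mono ?_ (hT' s hs)
    intro x hx
    simp only [Finset.coe_biUnion, Set.mem_iUnion]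
    exact ⟨s, hs, hx⟩

/-- The compact Lie group case. -/
lemma compact_case (hρ : ∀ g, ‖ρ g‖ ≤ 1) {d : ℕ} (hfg : Group.FG G) (hG : PG d G)
    (htb : TotallyBounded (Set.range ρ)) :
    (∃ K : Subgroup G, K.FiniteIndex ∧ ∃ φ : K →* Multiplicative ℤ, Function.Surjective φ) ∨
      ρ.ker.FiniteIndex := by
  set ε : ℝ := 1 / (32 * (2 ^ (d + 1) : ℕ)) with hε
  have hε0 : 0 < ε := by positivity
  set U : Set G := {g | ‖ρ g - 1‖ ≤ ε} with hU
  set K := Subgroup.closure U with hK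
  have hKfin : K.FiniteIndex := by
    have hq : Finite (G ⧸ K) := by
      obtain ⟨t, ht, hcov⟩ := Metric.totallyBounded_iff.1 htb (ε / 2) (by positivity)
      have h1 : ∀ q : G ⧸ K, ∃ y : t, ‖ρ (q.out)⁻¹ - y‖ < ε / 2 := by
        intro q
        have := hcov ⟨(q.out)⁻¹, rfl⟩
        simp only [Set.mem_iUnion] at this
        obtain ⟨y, hy, h⟩ := this
        exact ⟨⟨y, hy⟩, by rwa [Metric.mem_ball, dist_eq_norm] at h⟩
      choose f hf using h1
      have : Finite t := ht
      refine Finite.of_injective f ?_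
      intro p q hpq
      have h2 := hf p
      have h3 := hf q
      rw [← hpq] at h3
      have h4 := norm_mul_inv_sub ρ hρ (p.out)⁻¹ (q.out)⁻¹
      have h5 : ‖ρ (p.out)⁻¹ - ρ (q.out)⁻¹‖ ≤ ε := by
        have : ρ (p.out)⁻¹ - ρ (q.out)⁻¹ = (ρ (p.out)⁻¹ - f p) - (ρ (q.out)⁻¹ - f p) := by abel
        rw [this]
        refine (norm_sub_le _ _).trans ?_
        linarith
      have h6 : (p.out)⁻¹ * q.out ∈ K := by
        apply Subgroup.subset_closure
        have := h4.trans h5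
        rwa [inv_inv] at this
      rw [← p.out_eq', ← q.out_eq']
      exact QuotientGroup.eq.2 h6
    exact Subgroup.finiteIndex_of_finite_quotient
  have hKfg : Group.FG K := inferInstance
  obtain ⟨T, hTU, hTK⟩ := finite_subset_gen U ((Group.fg_iff_subgroup_fg K).1 hKfg)
  let ρ' : K →* A := ρ.comp K.subtype
  have hnil : Group.IsNilpotent (K ⧸ ρ'.ker) := by
    have hTK' : (T : Set G) ⊆ K := hTU.trans Subgroup.subset_closure
    refine nilpotent_quot_of_near ρ' (fun g => hρ g) (hG.subgroup K)
      (T.preimage K.subtype (K.subtype_injective.injOn)) ?_ ?_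
    · rw [Finset.coe_preimage]
      apply Subgroup.map_injective K.subtype_injective
      rw [MonoidHom.map_closure, Set.image_preimage_eq_of_subset, hTK]
      · rw [← MonoidHom.range_eq_map, Subgroup.range_subtype]
      · simpa using hTK'
    · intro s hs
      rw [Finset.mem_preimage] at hs
      exact hTU hs
  rcases finite_or_infinite (K ⧸ ρ'.ker) with hf | hinf
  · right
    have h1 : ρ'.ker.FiniteIndex := Subgroup.finiteIndex_of_finite_quotient
    have h2 : (ρ'.ker.map K.subtype).FiniteIndex := by
      constructor
      rw [Subgroup.index_map_subtype]
      exact mul_ne_zero h1.index_ne_zero hKfin.index_ne_zero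
    refine Subgroup.finiteIndex_of_le (H := ρ'.ker.map K.subtype) ?_
    rintro _ ⟨x, hx, rfl⟩
    exact hx
  · left
    obtain ⟨φ, hφ⟩ := exists_surj_int_of_nilpotent (G := K ⧸ ρ'.ker)
    exact ⟨K, hKfin, φ.comp (QuotientGroup.mk' _), hφ.comp (QuotientGroup.mk'_surjective _)⟩

end Compact

end Gromov

namespace Gromov

section Walk

open scoped Pointwise Classical

universe u

variable {G : Type u} [Group G]

/-- Left translation on finitely supported functions. -/
noncomputable def lt (g : G) : (G →₀ ℝ) →ₗ[ℝ] (G →₀ ℝ) := Finsupp.lmapDomain ℝ ℝ (fun x => g * x)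

lemma lt_apply (g : G) (u : G →₀ ℝ) (x : G) : lt g u x = u (g⁻¹ * x) := by
  have h := Finsupp.mapDomain_apply (mul_right_injective g) u (g⁻¹ * x)
  rw [mul_inv_cancel_left] at h
  exact h

lemma lt_mul (g h : G) (u : G →₀ ℝ) : lt (g * h) u = lt g (lt h u) := by
  ext x
  simp [lt_apply, mul_assoc]

lemma lt_one (u : G →₀ ℝ) : lt (1 : G) u = u := by
  ext x
  simp [lt_apply]

/-- Averaging of left translations. -/
noncomputable def av (S : Finset G) : (G →₀ ℝ) →ₗ[ℝ] (G →₀ ℝ) :=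
  (S.card : ℝ)⁻¹ • ∑ s ∈ S, lt s

lemma av_apply (S : Finset G) (u : G →₀ ℝ) (x : G) :
    av S u x = (S.card : ℝ)⁻¹ * ∑ s ∈ S, u (s⁻¹ * x) := by
  simp [av, LinearMap.sum_apply, Finsupp.finsetSum_apply, lt_apply]

lemma av_eq (S : Finset G) (u : G →₀ ℝ) :
    av S u = (S.card : ℝ)⁻¹ • ∑ s ∈ S, lt s u := by
  simp [av, LinearMap.sum_apply]

/-- Law of the random walk. -/
noncomputable def p (S : Finset G) : ℕ → (G →₀ ℝ)
  | 0 => Finsupp.single 1 1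
  | n + 1 => av S (p S n)

/-- The Markov operator. -/
noncomputable def mk (S : Finset G) : (G → ℝ) →ₗ[ℝ] (G → ℝ) where
  toFun f x := (S.card : ℝ)⁻¹ * ∑ s ∈ S, f (x * s)
  map_add' f g := by
    ext x
    simp [Finset.sum_add_distrib, mul_add]
  map_smul' c f := by
    ext x
    simp [← Finset.mul_sum]
    ring

lemma mk_apply (S : Finset G) (f : G → ℝ) (x : G) :
    mk S f x = (S.card : ℝ)⁻¹ * ∑ s ∈ S, f (x * s) := rfl

/-- Pairing of functions with finitely supported functions. -/
noncomputable def pair (f : G → ℝ) : (G →₀ ℝ) →ₗ[ℝ] ℝ := Finsupp.linearCombination ℝ f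

lemma pair_lt (f : G → ℝ) (g : G) (u : G →₀ ℝ) : pair f (lt g u) = pair (fun x => f (g * x)) u := by
  unfold pair lt
  rw [Finsupp.lmapDomain_apply, Finsupp.linearCombination_mapDomain]
  rfl

lemma pair_eq (f : G → ℝ) (u : G →₀ ℝ) {B : Finset G} (hB : ∀ x, u x ≠ 0 → x ∈ B) :
    pair f u = ∑ x ∈ B, u x * f x := by
  unfold pair
  rw [Finsupp.linearCombination_apply, Finsupp.sum_of_support_subset]
  · rfl
  · intro x hx
    exact hB x (Finsupp.mem_support_iff.1 hx)
  · simp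

lemma pair_av (S : Finset G) (f : G → ℝ) (u : G →₀ ℝ) :
    pair f (av S u) = (S.card : ℝ)⁻¹ * ∑ s ∈ S, pair (fun x => f (s * x)) u := by
  rw [av_eq, map_smul, map_sum]
  simp [pair_lt]

lemma mk_pow_eq_pair (S : Finset G) (f : G → ℝ) (n : ℕ) (x : G) :
    (mk S ^ n) f x = pair (fun y => f (x * y)) (p S n) := by
  induction n generalizing x with
  | zero => simp [p, pair]
  | succ n ih =>
    rw [pow_succ', Module.End.mul_apply, mk_apply, p, pair_av]
    simp [ih, mul_assoc]

lemma mk_shift (S : Finset G) (f : G → ℝ) (g x : G) :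
    mk S (fun y => f (g * y)) x = mk S f (g * x) := by
  simp [mk_apply, mul_assoc]

lemma mk_pow_shift (S : Finset G) (f : G → ℝ) (n : ℕ) (g x : G) :
    (mk S ^ n) (fun y => f (g * y)) x = (mk S ^ n) f (g * x) := by
  simp [mk_pow_eq_pair, mul_assoc]

lemma mk_mono {S : Finset G} {f g : G → ℝ} (h : ∀ x, f x ≤ g x) (x : G) : mk S f x ≤ mk S g x := by
  rw [mk_apply, mk_apply]
  gcongr
  exact h _

lemma mk_const {S : Finset G} (hS : S.Nonempty) (c : ℝ) : mk S (fun _ => c) = fun _ => c := by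
  ext x
  have : (S.card : ℝ) ≠ 0 := by exact_mod_cast hS.card_pos.ne'
  simp [mk_apply]
  field_simp

lemma mk_pow_mono {S : Finset G} {f g : G → ℝ} (h : ∀ x, f x ≤ g x) (n : ℕ) (x : G) :
    (mk S ^ n) f x ≤ (mk S ^ n) g x := by
  induction n generalizing x with
  | zero => exact h x
  | succ n ih =>
    rw [pow_succ', Module.End.mul_apply, Module.End.mul_apply]
    exact mk_mono ih x

lemma mk_pow_fix {S : Finset G} {f : G → ℝ} (h : mk S f = f) (n : ℕ) : (mk S ^ n) f = f := by
  induction n with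
  | zero => rfl
  | succ n ih => rw [pow_succ', Module.End.mul_apply, ih, h]

lemma mk_pow_const {S : Finset G} (hS : S.Nonempty) (c : ℝ) (n : ℕ) :
    (mk S ^ n) (fun _ => c) = fun _ => c := mk_pow_fix (mk_const hS c) n

lemma mk_pow_abs {S : Finset G} (hS : S.Nonempty) {f : G → ℝ} {c : ℝ} (h : ∀ x, |f x| ≤ c) (n : ℕ)
    (x : G) : |(mk S ^ n) f x| ≤ c := by
  rw [abs_le]
  constructor
  · have := mk_pow_mono (S := S) (f := fun _ => -c) (g := f) (fun x => (abs_le.1 (h x)).1) n x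
    rwa [mk_pow_const hS] at this
  · have := mk_pow_mono (S := S) (f := f) (g := fun _ => c) (fun x => (abs_le.1 (h x)).2) n x
    rwa [mk_pow_const hS] at this

lemma p_nonneg (S : Finset G) (n : ℕ) (x : G) : 0 ≤ p S n x := by
  induction n generalizing x with
  | zero =>
    rw [p, Finsupp.single_apply]
    split_ifs <;> simp
  | succ n ih =>
    rw [p, av_apply]
    exact mul_nonneg (by positivity) (Finset.sum_nonneg fun s _ => ih _)

lemma p_supp (S : Finset G) (n : ℕ) (x : G) (hx : p S n x ≠ 0) : x ∈ S ^ n := by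
  induction n generalizing x with
  | zero =>
    rw [p, Finsupp.single_apply] at hx
    split_ifs at hx with h
    · simp [← h]
    · simp at hx
  | succ n ih =>
    rw [p, av_apply] at hx
    have h1 : ∑ s ∈ S, p S n (s⁻¹ * x) ≠ 0 := right_ne_zero_of_mul hx
    obtain ⟨s, hs, h2⟩ := Finset.exists_ne_zero_of_sum_ne_zero h1
    rw [pow_succ']
    have := Finset.mul_mem_mul hs (ih _ h2)
    rwa [mul_inv_cancel_left] at this

lemma p_sum {S : Finset G} (hS : S.Nonempty) (n : ℕ) {B : Finset G} (hB : S ^ n ⊆ B) :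
    ∑ x ∈ B, p S n x = 1 := by
  have h := mk_pow_eq_pair S (fun _ => (1 : ℝ)) n 1
  rw [mk_pow_const hS, pair_eq _ _ (fun x hx => hB (p_supp S n x hx))] at h
  simpa using h.symm

lemma kl_pt {q r : ℝ} (hq : 0 ≤ q) (hr : 0 ≤ r) (h : r = 0 → q = 0) :
    (√q - √r) ^ 2 ≤ q * Real.log q - q * Real.log r - q + r := by
  rcases hq.eq_or_lt with rfl | hq
  · simp [Real.sq_sqrt hr]
  have hr' : 0 < r := lt_of_le_of_ne hr (fun h' => hq.ne' (h h'.symm))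
  have h1 := Real.log_le_sub_one_of_pos (div_pos (Real.sqrt_pos.2 hr') (Real.sqrt_pos.2 hq))
  rw [Real.log_div (Real.sqrt_pos.2 hr').ne' (Real.sqrt_pos.2 hq).ne', Real.log_sqrt hr,
    Real.log_sqrt hq.le] at h1
  have h2 := mul_le_mul_of_nonneg_left h1 hq.le
  have h3 : q * (√r / √q - 1) = √q * √r - q := by
    have : √q ≠ 0 := (Real.sqrt_pos.2 hq).ne'
    have h4 : √q ^ 2 = q := Real.sq_sqrt hq.le
    nth_rewrite 1 [← h4]
    field_simp
    linear_combination -h4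
  rw [h3] at h2
  have h4 : √q ^ 2 = q := Real.sq_sqrt hq.le
  have h5 : √r ^ 2 = r := Real.sq_sqrt hr
  nlinarith

/-- Entropy of the walk at time `n`. -/
noncomputable def ent (S : Finset G) (n : ℕ) : ℝ := ∑ x ∈ S ^ n, - (p S n x * Real.log (p S n x))

lemma ent_eq (S : Finset G) (n : ℕ) {B : Finset G} (hB : S ^ n ⊆ B) :
    ent S n = - ∑ x ∈ B, p S n x * Real.log (p S n x) := by
  rw [ent, ← Finset.sum_neg_distrib]
  apply Finset.sum_subset hB
  intro x _ hx
  have : p S n x = 0 := by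
    by_contra h
    exact hx (p_supp S n x h)
  simp [this]

lemma ent_le {S : Finset G} (hS : S.Nonempty) (n : ℕ) : ent S n ≤ Real.log ((S ^ n).card) := by
  have hc : (0 : ℝ) < (S ^ n).card := by exact_mod_cast (hS.pow).card_pos
  have h : ∀ x ∈ S ^ n, - (p S n x * Real.log (p S n x)) ≤
      p S n x * Real.log ((S ^ n).card) - p S n x + ((S ^ n).card : ℝ)⁻¹ := by
    intro x _
    have := (sq_nonneg _).trans
      (kl_pt (p_nonneg S n x) (inv_pos.2 hc).le (fun h => absurd h (inv_pos.2 hc).ne'))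
    rw [Real.log_inv] at this
    linarith
  refine (Finset.sum_le_sum h).trans (le_of_eq ?_)
  rw [Finset.sum_add_distrib, Finset.sum_sub_distrib, ← Finset.sum_mul, p_sum hS n subset_rfl]
  simp
  field_simp
  ring

lemma p_succ_ge {S : Finset G} (n : ℕ) {s : G} (hs : s ∈ S) (x : G) :
    p S n (s⁻¹ * x) ≤ S.card * p S (n + 1) x := by
  have : (S.card : ℝ) ≠ 0 := by exact_mod_cast (Finset.card_pos.2 ⟨s, hs⟩).ne'
  rw [p, av_apply, mul_inv_cancel_left₀ this]
  exact Finset.single_le_sum (f := fun s => p S n (s⁻¹ * x)) (fun t _ => p_nonneg S n _) hs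

lemma sum_shift (S : Finset G) (n : ℕ) {s : G} (hs : s ∈ S) (F : ℝ → G → ℝ) (hF : ∀ x, F 0 x = 0) :
    ∑ x ∈ S ^ (n + 1), F (p S n (s⁻¹ * x)) x = ∑ x ∈ S ^ n, F (p S n x) (s * x) := by
  have h1 : (S ^ n).image (fun x => s * x) ⊆ S ^ (n + 1) := by
    intro y hy
    obtain ⟨x, hx, rfl⟩ := Finset.mem_image.1 hy
    rw [pow_succ']
    exact Finset.mul_mem_mul hs hx
  rw [← Finset.sum_subset h1, Finset.sum_image]
  · simp
  · intro a _ b _ hab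
    exact mul_left_cancel hab
  · intro x _ hx
    have : p S n (s⁻¹ * x) = 0 := by
      by_contra h
      exact hx (Finset.mem_image.2 ⟨_, p_supp S n _ h, by simp⟩)
    rw [this, hF]

lemma ent_succ_ge {S : Finset G} (n : ℕ) {s : G} (hs : s ∈ S) :
    ∑ x ∈ S ^ (n + 1), (√(p S n (s⁻¹ * x)) - √(p S (n + 1) x)) ^ 2 ≤
      S.card * (ent S (n + 1) - ent S n) := by
  have hS : S.Nonempty := ⟨s, hs⟩
  have hc : (S.card : ℝ) ≠ 0 := by exact_mod_cast hS.card_pos.ne'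
  have key : ∀ t ∈ S, ∑ x ∈ S ^ (n + 1), (√(p S n (t⁻¹ * x)) - √(p S (n + 1) x)) ^ 2 ≤
      - ent S n - ∑ x ∈ S ^ (n + 1), p S n (t⁻¹ * x) * Real.log (p S (n + 1) x) := by
    intro t ht
    have h1 : ∀ x ∈ S ^ (n + 1), (√(p S n (t⁻¹ * x)) - √(p S (n + 1) x)) ^ 2 ≤
        p S n (t⁻¹ * x) * Real.log (p S n (t⁻¹ * x))
          - p S n (t⁻¹ * x) * Real.log (p S (n + 1) x) - p S n (t⁻¹ * x) + p S (n + 1) x := by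
      intro x _
      apply kl_pt (p_nonneg _ _ _) (p_nonneg _ _ _)
      intro h
      have := p_succ_ge n ht x
      rw [h, mul_zero] at this
      exact le_antisymm this (p_nonneg _ _ _)
    refine (Finset.sum_le_sum h1).trans (le_of_eq ?_)
    rw [Finset.sum_add_distrib, Finset.sum_sub_distrib, Finset.sum_sub_distrib,
      p_sum hS (n + 1) subset_rfl, sum_shift S n ht (fun a _ => a * Real.log a) (by simp),
      sum_shift S n ht (fun a _ => a) (by simp), p_sum hS n subset_rfl, ent_eq S n subset_rfl]
    ring
  have h2 : ∑ t ∈ S, ∑ x ∈ S ^ (n + 1), p S n (t⁻¹ * x) * Real.log (p S (n + 1) x)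
      = - (S.card * ent S (n + 1)) := by
    rw [Finset.sum_comm, ent_eq S (n + 1) subset_rfl, mul_neg, neg_neg, Finset.mul_sum]
    apply Finset.sum_congr rfl
    intro x _
    rw [← Finset.sum_mul, ← mul_assoc]
    congr 1
    rw [p, av_apply, mul_inv_cancel_left₀ hc]
  calc _ ≤ ∑ t ∈ S, ∑ x ∈ S ^ (n + 1), (√(p S n (t⁻¹ * x)) - √(p S (n + 1) x)) ^ 2 :=
        Finset.single_le_sum
          (f := fun t => ∑ x ∈ S ^ (n + 1), (√(p S n (t⁻¹ * x)) - √(p S (n + 1) x)) ^ 2)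
          (fun t _ => Finset.sum_nonneg fun x _ => sq_nonneg _) hs
    _ ≤ ∑ t ∈ S, (- ent S n -
          ∑ x ∈ S ^ (n + 1), p S n (t⁻¹ * x) * Real.log (p S (n + 1) x)) := Finset.sum_le_sum key
    _ = _ := by
      rw [Finset.sum_sub_distrib, h2]
      simp
      ring

lemma ent_mono {S : Finset G} (hS : S.Nonempty) (n : ℕ) : ent S n ≤ ent S (n + 1) := by
  obtain ⟨s, hs⟩ := hS
  have h := (Finset.sum_nonneg (fun x _ => sq_nonneg _)).trans (ent_succ_ge n hs)
  have hc : (0 : ℝ) < S.card := by exact_mod_cast (Finset.card_pos.2 ⟨s, hs⟩)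
  have := nonneg_of_mul_nonneg_right h hc
  linarith

lemma ent_good {S : Finset G} (hS : S.Nonempty) {d : ℕ} (hG : PG d G) :
    ∃ᶠ n in Filter.atTop, ent S (n + 1) - ent S n ≤ (d + 1) / ((n : ℝ) + 1) := by
  intro hcon
  rw [Filter.eventually_atTop] at hcon
  obtain ⟨n0, hn0⟩ := hcon
  obtain ⟨C, hC⟩ := hG S
  set a : ℕ → ℝ := fun n => ent S n - (d + 1) * Real.log ((n : ℝ) + 1) with ha
  have hmono : ∀ n, n0 ≤ n → a n0 ≤ a n := by
    intro n hn
    induction n, hn using Nat.le_induction with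
    | base => exact le_rfl
    | succ n hn ih =>
      refine ih.trans ?_
      have h1 := hn0 n hn
      push Not at h1
      have hpos : (0 : ℝ) < (n : ℝ) + 1 := by positivity
      have h2 : Real.log ((n : ℝ) + 1 + 1) - Real.log ((n : ℝ) + 1) ≤ 1 / ((n : ℝ) + 1) := by
        rw [← Real.log_div (by positivity) hpos.ne']
        refine (Real.log_le_sub_one_of_pos (by positivity)).trans (le_of_eq ?_)
        field_simp
        ring
      have h3 : (0 : ℝ) ≤ d + 1 := by positivity
      have h4 := mul_le_mul_of_nonneg_left h2 h3
      rw [mul_one_div] at h4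
      simp only [ha]
      push_cast
      linarith
  have hC0 : 0 < C := by
    by_contra h
    have h0 : C = 0 := by omega
    have := hC 0
    rw [h0] at this
    simp at this
  have hub : ∀ n, n0 ≤ n → Real.log ((n : ℝ) + 1) ≤ Real.log C - a n0 := by
    intro n hn
    have h1 := hmono n hn
    have h2 := ent_le hS n
    have hcard : (0 : ℝ) < (S ^ n).card := by exact_mod_cast (hS.pow).card_pos
    have h3 : Real.log ((S ^ n).card) ≤ Real.log C + d * Real.log ((n : ℝ) + 1) := by
      rw [← Real.log_pow, ← Real.log_mul (by positivity) (by positivity)]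
      apply Real.log_le_log hcard
      exact_mod_cast hC n
    simp only [ha] at h1 ⊢
    linarith
  have ht : Filter.Tendsto (fun n : ℕ => Real.log ((n : ℝ) + 1)) Filter.atTop Filter.atTop :=
    Real.tendsto_log_atTop.comp
      (Filter.tendsto_atTop_add_const_right _ _ tendsto_natCast_atTop_atTop)
  obtain ⟨n, hn1, hn2⟩ := ((Filter.eventually_ge_atTop n0).and
    (ht.eventually (Filter.eventually_gt_atTop (Real.log C - a n0)))).exists
  exact absurd (hub n hn1) (not_le.2 hn2)

/-- Key inequality. -/
lemma key_ineq {S : Finset G} (h1S : (1 : G) ∈ S) {f : G → ℝ} (hf : mk S f = f) (n : ℕ) {s : G}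
    (hs : s ∈ S) :
    (f s - f 1) ^ 2 ≤ S.card * (ent S (n + 1) - ent S n) *
      (2 * (S.card + 1) * (mk S ^ (n + 1)) (fun x => (f x - f 1) ^ 2) 1) := by
  have hS : S.Nonempty := ⟨s, hs⟩
  set B := S ^ (n + 1) with hB
  set q : G → ℝ := fun x => p S n (s⁻¹ * x) with hq
  set r : G → ℝ := fun x => p S (n + 1) x with hr
  have e1 : f s = ∑ x ∈ B, q x * f x := by
    have h := mk_pow_eq_pair S f n s
    rw [mk_pow_fix hf, pair_eq _ _ (p_supp S n)] at h
    rw [h, hq, hB, sum_shift S n hs (fun a x => a * f x) (by simp)]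
  have e2 : f 1 = ∑ x ∈ B, r x * f x := by
    have h := mk_pow_eq_pair S f (n + 1) 1
    rw [mk_pow_fix hf, pair_eq _ _ (p_supp S (n + 1))] at h
    simpa using h
  have e3 : ∑ x ∈ B, q x = 1 := by
    rw [hq, hB, sum_shift S n hs (fun a x => a) (by simp), p_sum hS n subset_rfl]
  have e4 : ∑ x ∈ B, r x = 1 := p_sum hS (n + 1) subset_rfl
  have e5 : f s - f 1 = ∑ x ∈ B, (√(q x) - √(r x)) * ((√(q x) + √(r x)) * (f x - f 1)) := by
    have : ∀ x ∈ B, (√(q x) - √(r x)) * ((√(q x) + √(r x)) * (f x - f 1))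
        = q x * f x - r x * f x - (q x - r x) * f 1 := by
      intro x _
      have a1 : √(q x) ^ 2 = q x := Real.sq_sqrt (p_nonneg _ _ _)
      have a2 : √(r x) ^ 2 = r x := Real.sq_sqrt (p_nonneg _ _ _)
      linear_combination (f x - f 1) * (a1 - a2)
    rw [Finset.sum_congr rfl this, Finset.sum_sub_distrib, Finset.sum_sub_distrib,
      ← Finset.sum_mul, Finset.sum_sub_distrib, ← e1, ← e2, e3, e4]
    ring
  have e6 : (mk S ^ (n + 1)) (fun x => (f x - f 1) ^ 2) 1 = ∑ x ∈ B, r x * (f x - f 1) ^ 2 := by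
    rw [mk_pow_eq_pair, pair_eq _ _ (p_supp S (n + 1))]
    simp [hr, hB]
  rw [e5, e6]
  refine (Finset.sum_mul_sq_le_sq_mul_sq _ _ _).trans ?_
  apply mul_le_mul (ent_succ_ge n hs) _ (Finset.sum_nonneg fun x _ => sq_nonneg _)
  · exact (Finset.sum_nonneg (fun x _ => sq_nonneg _)).trans (ent_succ_ge n hs)
  · rw [Finset.mul_sum]
    apply Finset.sum_le_sum
    intro x _
    have a1 : √(q x) ^ 2 = q x := Real.sq_sqrt (p_nonneg _ _ _)
    have a2 : √(r x) ^ 2 = r x := Real.sq_sqrt (p_nonneg _ _ _)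
    have a3 : q x ≤ S.card * r x := p_succ_ge n hs x
    have a4 : (√(q x) + √(r x)) ^ 2 ≤ 2 * (S.card + 1) * r x := by
      nlinarith [sq_nonneg (√(q x) - √(r x))]
    rw [mul_pow]
    calc _ ≤ (2 * (S.card + 1) * r x) * (f x - f 1) ^ 2 :=
          mul_le_mul_of_nonneg_right a4 (sq_nonneg _)
      _ = _ := by ring

/-- Key inequality, along a good subsequence. -/
lemma key_good {S : Finset G} (h1S : (1 : G) ∈ S) {d : ℕ} (hG : PG d G) :
    ∃ K : ℝ, 0 ≤ K ∧ ∃ᶠ m : ℕ in Filter.atTop, ∀ f : G → ℝ, mk S f = f → ∀ x, ∀ s ∈ S,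
      (f (x * s) - f x) ^ 2 ≤ K * ((m : ℝ)⁻¹ * (mk S ^ m) (fun y => (f y - f x) ^ 2) x) := by
  have hS : S.Nonempty := ⟨1, h1S⟩
  refine ⟨S.card * (d + 1) * (2 * (S.card + 1)), by positivity, ?_⟩
  have h := ent_good hS hG
  have h2 := (Filter.tendsto_add_atTop_nat 1).frequently (p := fun m : ℕ => ∀ f : G → ℝ,
    mk S f = f → ∀ x, ∀ s ∈ S, (f (x * s) - f x) ^ 2 ≤ S.card * (d + 1) * (2 * (S.card + 1)) *
      ((m : ℝ)⁻¹ * (mk S ^ m) (fun y => (f y - f x) ^ 2) x)) (h.mono ?_)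
  · exact h2
  intro n hn f hf x s hs
  have hf' : mk S (fun y => f (x * y)) = fun y => f (x * y) := by
    ext y
    rw [mk_shift, hf]
  have h3 := key_ineq h1S hf' n hs
  have h4 := mk_pow_shift S (fun y => (f y - f x) ^ 2) (n + 1) x 1
  simp only [mul_one] at h3 h4
  rw [h4] at h3
  refine h3.trans ?_
  have h5 : 0 ≤ (mk S ^ (n + 1)) (fun y => (f y - f x) ^ 2) x := by
    have := mk_pow_mono (S := S) (f := fun _ => (0 : ℝ)) (g := fun y => (f y - f x) ^ 2)
      (fun y => sq_nonneg _) (n + 1) x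
    rwa [mk_pow_const hS] at this
  calc _ ≤ S.card * ((d + 1) / ((n : ℝ) + 1)) *
        (2 * (S.card + 1) * (mk S ^ (n + 1)) (fun y => (f y - f x) ^ 2) x) := by gcongr
    _ = _ := by
      push_cast
      field_simp

end Walk

end Gromov

namespace Gromov

section Mean

open scoped Pointwise Classical Topology

universe u

variable {G : Type u} [Group G]

lemma exists_lim (U : Ultrafilter ℕ) {a : ℕ → ℝ} {c : ℝ} (h : ∀ n, |a n| ≤ c) :
    ∃ l, Filter.Tendsto a U (𝓝 l) := by
  obtain ⟨l, _, hl⟩ := (isCompact_Icc (a := -c) (b := c)).ultrafilter_le_nhds (U.map a) (by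
    rw [Filter.le_principal_iff]
    exact Ultrafilter.mem_map.2 (Filter.mem_of_superset Filter.univ_mem (fun n _ => abs_le.1 (h n))))
  exact ⟨l, hl⟩

/-- Bounded functions. -/
def Bd (f : G → ℝ) : Prop := ∃ c : ℝ, ∀ x, |f x| ≤ c

/-- Carre du champ. -/
noncomputable def Ga (S : Finset G) (f g : G → ℝ) (x : G) : ℝ :=
  (S.card : ℝ)⁻¹ * ∑ s ∈ S, (f (x * s) - f x) * (g (x * s) - g x)

/-- Lipschitz functions. -/
def Lip (S : Finset G) (f : G → ℝ) : Prop := ∃ c : ℝ, ∀ x, ∀ s ∈ S, |f (x * s) - f x| ≤ c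

lemma Ga_bd {S : Finset G} {f g : G → ℝ} (hf : Lip S f) (hg : Lip S g) : Bd (Ga S f g) := by
  obtain ⟨a, ha⟩ := hf
  obtain ⟨b, hb⟩ := hg
  rcases S.eq_empty_or_nonempty with rfl | hS
  · exact ⟨0, fun x => by simp [Ga]⟩
  have hc : (0 : ℝ) < S.card := by exact_mod_cast hS.card_pos
  refine ⟨a * b, fun x => ?_⟩
  unfold Ga
  rw [abs_mul, abs_of_pos (inv_pos.2 hc), inv_mul_le_iff₀ hc, ← nsmul_eq_mul]
  refine (Finset.abs_sum_le_sum_abs _ _).trans (Finset.sum_le_card_nsmul _ _ _ fun s hs => ?_)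
  rw [abs_mul]
  exact mul_le_mul (ha x s hs) (hb x s hs) (abs_nonneg _) ((abs_nonneg _).trans (ha x s hs))

lemma mk_sq {S : Finset G} (hS : S.Nonempty) {f : G → ℝ} (hf : mk S f = f) (c : ℝ) :
    mk S (fun y => (f y - c) ^ 2) = (fun y => (f y - c) ^ 2) + Ga S f f := by
  ext y
  have hc : (S.card : ℝ) ≠ 0 := by exact_mod_cast hS.card_pos.ne'
  have h1 : ∑ s ∈ S, f (y * s) = S.card * f y := by
    have := congrFun hf y
    rw [mk_apply] at this
    rw [← this, mul_inv_cancel_left₀ hc]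
  have h2 : ∀ s ∈ S, (f (y * s) - c) ^ 2 = (f (y * s) - f y) * (f (y * s) - f y)
      + 2 * (f y - c) * f (y * s) - 2 * (f y - c) * f y + (f y - c) ^ 2 := by
    intro s _
    ring
  rw [mk_apply, Finset.sum_congr rfl h2, Finset.sum_add_distrib, Finset.sum_sub_distrib,
    Finset.sum_add_distrib, ← Finset.mul_sum, h1, Pi.add_apply, Ga]
  simp only [Finset.sum_const, nsmul_eq_mul]
  field_simp
  ring

lemma mk_pow_sq {S : Finset G} (hS : S.Nonempty) {f : G → ℝ} (hf : mk S f = f) (x : G) (m : ℕ) :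
    (mk S ^ m) (fun y => (f y - f x) ^ 2) x = ∑ k ∈ Finset.range m, (mk S ^ k) (Ga S f f) x := by
  induction m with
  | zero => simp
  | succ m ih =>
    rw [Finset.sum_range_succ, ← ih, pow_succ, Module.End.mul_apply, mk_sq hS hf, map_add,
      Pi.add_apply]

lemma const_of_step {S : Finset G} (hgen : ∀ g : G, ∃ k, g ∈ S ^ k) {α : Type*} {f : G → α}
    (h : ∀ x, ∀ s ∈ S, f (x * s) = f x) (x : G) : f x = f 1 := by
  obtain ⟨k, hk⟩ := hgen x
  induction k generalizing x with
  | zero =>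
    rw [pow_zero, Finset.mem_one] at hk
    rw [hk]
  | succ k ih =>
    rw [pow_succ] at hk
    obtain ⟨y, hy, s, hs, rfl⟩ := Finset.mem_mul.1 hk
    rw [h y s hs, ih y hy]

lemma exists_mean {S : Finset G} (h1S : (1 : G) ∈ S) (hgen : ∀ g : G, ∃ k, g ∈ S ^ k) {d : ℕ}
    (hG : PG d G) :
    ∃ K : ℝ, 0 ≤ K ∧ ∃ M : (G → ℝ) → ℝ,
      (∀ f g, Bd f → Bd g → M (f + g) = M f + M g) ∧
      (∀ (c : ℝ) f, Bd f → M (c • f) = c * M f) ∧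
      (∀ f g, Bd f → Bd g → (∀ x, f x ≤ g x) → M f ≤ M g) ∧
      (∀ c, M (fun _ => c) = c) ∧
      (∀ f g, Bd f → M (fun x => f (g * x)) = M f) ∧
      (∀ f, mk S f = f → Lip S f → ∀ x, ∀ s ∈ S, (f (x * s) - f x) ^ 2 ≤ K * M (Ga S f f)) := by
  have hS : S.Nonempty := ⟨1, h1S⟩
  obtain ⟨K, hK, hgood⟩ := key_good h1S hG
  refine ⟨K, hK, ?_⟩
  have hliou : ∀ f : G → ℝ, mk S f = f → Bd f → ∀ x, f x = f 1 := by
    rintro f hf ⟨c, hc⟩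
    apply const_of_step hgen
    intro x s hs
    have h0 : (f (x * s) - f x) ^ 2 ≤ 0 := by
      have ht : Filter.Tendsto (fun m : ℕ => K * ((m : ℝ)⁻¹ * (2 * c) ^ 2)) Filter.atTop (𝓝 0) := by
        have := ((tendsto_inv_atTop_nhds_zero_nat (𝕜 := ℝ)).mul_const ((2 * c) ^ 2)).const_mul K
        simpa using this
      apply le_of_forall_pos_le_add
      intro ε hε
      obtain ⟨m, hm1, hm2⟩ := (hgood.and_eventually (ht.eventually (gt_mem_nhds hε))).exists
      refine (hm1 f hf x s hs).trans ?_
      rw [zero_add]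
      refine le_trans ?_ hm2.le
      gcongr
      have := mk_pow_abs hS (f := fun y => (f y - f x) ^ 2) (c := (2 * c) ^ 2) (fun y => by
        rw [abs_of_nonneg (sq_nonneg _)]
        apply sq_le_sq'
        · have h1 := abs_le.1 (hc y)
          have h2 := abs_le.1 (hc x)
          linarith
        · have h1 := abs_le.1 (hc y)
          have h2 := abs_le.1 (hc x)
          linarith) m x
      exact (le_abs_self _).trans this
    have := pow_eq_zero_iff (two_ne_zero) |>.1 (le_antisymm h0 (sq_nonneg _))
    linarith
  let good : Set ℕ := {m : ℕ | ∀ f : G → ℝ, mk S f = f → ∀ x, ∀ s ∈ S,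
      (f (x * s) - f x) ^ 2 ≤ K * ((m : ℝ)⁻¹ * (mk S ^ m) (fun y => (f y - f x) ^ 2) x)}
  have hne : (Filter.atTop ⊓ Filter.principal good).NeBot := Filter.frequently_mem_iff_neBot.1 hgood
  let U : Ultrafilter ℕ := Ultrafilter.of (Filter.atTop ⊓ Filter.principal good)
  have hU1 : (U : Filter ℕ) ≤ Filter.atTop := (Ultrafilter.of_le _).trans inf_le_left
  have hU2 : ∀ᶠ m in (U : Filter ℕ), m ∈ good := by
    have : (U : Filter ℕ) ≤ Filter.principal good := (Ultrafilter.of_le _).trans inf_le_right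
    exact Filter.le_principal_iff.1 this
  let A : ℕ → (G → ℝ) → G → ℝ := fun m f x =>
    (m : ℝ)⁻¹ * ∑ k ∈ Finset.range m, (mk S ^ k) f x
  have hAb : ∀ (f : G → ℝ) (c : ℝ), (∀ x, |f x| ≤ c) → ∀ m x, |A m f x| ≤ c := by
    intro f c hc m x
    have hc0 : 0 ≤ c := (abs_nonneg _).trans (hc 1)
    rcases Nat.eq_zero_or_pos m with rfl | hm
    · simpa [A] using hc0
    have hm' : (0 : ℝ) < m := by exact_mod_cast hm
    simp only [A]
    rw [abs_mul, abs_of_pos (inv_pos.2 hm'), inv_mul_le_iff₀ hm']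
    refine (Finset.abs_sum_le_sum_abs _ _).trans ?_
    have := Finset.sum_le_card_nsmul (Finset.range m) (fun k => |(mk S ^ k) f x|) c
      (fun k _ => mk_pow_abs hS hc k x)
    simpa using this
  let L : (G → ℝ) → G → ℝ := fun f x => Filter.limUnder (U : Filter ℕ) (fun m => A m f x)
  have hL : ∀ f, Bd f → ∀ x, Filter.Tendsto (fun m => A m f x) U (𝓝 (L f x)) := by
    rintro f ⟨c, hc⟩ x
    exact tendsto_nhds_limUnder (exists_lim U (fun m => hAb f c hc m x))
  have hLb : ∀ f, Bd f → Bd (L f) := by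
    rintro f ⟨c, hc⟩
    refine ⟨c, fun x => ?_⟩
    exact le_of_tendsto (hL f ⟨c, hc⟩ x).abs (Filter.Eventually.of_forall fun m => hAb f c hc m x)
  have hLh : ∀ f, Bd f → mk S (L f) = L f := by
    rintro f ⟨c, hc⟩
    ext x
    have h1 : Filter.Tendsto (fun m => mk S (A m f) x) U (𝓝 (mk S (L f) x)) := by
      simp only [mk_apply]
      exact (tendsto_finsetSum _ fun s _ => hL f ⟨c, hc⟩ (x * s)).const_mul _
    have h2 : ∀ m, mk S (A m f) x - A m f x = (m : ℝ)⁻¹ * ((mk S ^ m) f x - f x) := by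
      intro m
      have e : A m f = (m : ℝ)⁻¹ • ∑ k ∈ Finset.range m, (mk S ^ k) f := by
        ext y
        simp [A]
      rw [e, map_smul, map_sum]
      simp only [Pi.smul_apply, smul_eq_mul, Finset.sum_apply]
      rw [← mul_sub, ← Finset.sum_sub_distrib]
      congr 1
      have := Finset.sum_range_sub (fun k => (mk S ^ k) f x) m
      simp only [pow_succ', Module.End.mul_apply, pow_zero, Module.End.one_apply] at this
      exact this
    have h3 : Filter.Tendsto (fun m => mk S (A m f) x - A m f x) U (𝓝 0) := by
      have h4 : Filter.Tendsto (fun m : ℕ => (m : ℝ)⁻¹ * (2 * c)) U (𝓝 0) := by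
        have := ((tendsto_inv_atTop_nhds_zero_nat (𝕜 := ℝ)).mul_const (2 * c)).mono_left hU1
        simpa using this
      apply squeeze_zero_norm _ h4
      intro m
      rw [h2, Real.norm_eq_abs, abs_mul, abs_of_nonneg (by positivity : (0 : ℝ) ≤ (m : ℝ)⁻¹)]
      gcongr
      have a1 := abs_le.1 (mk_pow_abs hS hc m x)
      have a2 := abs_le.1 (hc x)
      rw [abs_le]
      constructor <;> linarith
    have h5 := tendsto_nhds_unique h3 (h1.sub (hL f ⟨c, hc⟩ x))
    linarith
  have hLc : ∀ f, Bd f → ∀ x, L f x = L f 1 := fun f hf => hliou _ (hLh f hf) (hLb f hf)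
  have hAadd : ∀ m f g x, A m (f + g) x = A m f x + A m g x := by
    intro m f g x
    simp [A, Finset.sum_add_distrib, mul_add]
  have hAsmul : ∀ m (c : ℝ) f x, A m (c • f) x = c * A m f x := by
    intro m c f x
    simp [A, ← Finset.mul_sum]
    ring
  refine ⟨fun f => L f 1, ?_, ?_, ?_, ?_, ?_, ?_⟩
  · rintro f g hf hg
    have hfg : Bd (f + g) := by
      obtain ⟨a, ha⟩ := hf
      obtain ⟨b, hb⟩ := hg
      exact ⟨a + b, fun x => (abs_add_le _ _).trans (add_le_add (ha x) (hb x))⟩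
    refine tendsto_nhds_unique (hL _ hfg 1) ?_
    simp only [hAadd]
    exact (hL f hf 1).add (hL g hg 1)
  · rintro c f hf
    have hcf : Bd (c • f) := by
      obtain ⟨a, ha⟩ := hf
      refine ⟨|c| * a, fun x => ?_⟩
      rw [Pi.smul_apply, smul_eq_mul, abs_mul]
      exact mul_le_mul_of_nonneg_left (ha x) (abs_nonneg _)
    refine tendsto_nhds_unique (hL _ hcf 1) ?_
    simp only [hAsmul]
    exact (hL f hf 1).const_mul c
  · intro f g hf hg hfg
    refine le_of_tendsto_of_tendsto' (hL f hf 1) (hL g hg 1) fun m => ?_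
    simp only [A]
    gcongr with k hk
    exact mk_pow_mono hfg k 1
  · intro c
    have hb : Bd (fun _ : G => c) := ⟨|c|, fun _ => le_rfl⟩
    refine tendsto_nhds_unique (hL _ hb 1) ?_
    apply tendsto_const_nhds.congr'
    filter_upwards [hU1 (Filter.eventually_gt_atTop 0)] with m hm
    simp only [A, mk_pow_const hS]
    have hm' : (m : ℝ) ≠ 0 := by exact_mod_cast hm.ne'
    simp
    field_simp
  · intro f g hf
    have hb : Bd (fun x => f (g * x)) := by
      obtain ⟨a, ha⟩ := hf
      exact ⟨a, fun x => ha _⟩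
    have : L (fun x => f (g * x)) 1 = L f g := by
      refine tendsto_nhds_unique (hL _ hb 1) ?_
      simp only [A, mk_pow_shift, mul_one]
      exact hL f hf g
    exact this.trans (hLc f hf g)
  · intro f hf hlip x s hs
    have hb := Ga_bd hlip hlip
    beta_reduce
    rw [← hLc _ hb x]
    refine ge_of_tendsto ((hL _ hb x).const_mul K) ?_
    filter_upwards [hU2] with m hm
    have := hm f hf x s hs
    rwa [mk_pow_sq hS hf] at this

end Mean

end Gromov

namespace Gromov

section Rep

open scoped Pointwise Classical Topology

universe u v

lemma fd_of_core {V : Type v} [AddCommGroup V] [Module ℝ V] (c : InnerProductSpace.Core ℝ V) (N : ℕ)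
    (h : ∀ (D : ℕ) (f : Fin D → V),
      (∀ i j, c.inner (f i) (f j) = if i = j then 1 else 0) → D ≤ N) : FiniteDimensional ℝ V := by
  let _ : NormedAddCommGroup V := c.toNormedAddCommGroup
  let _ : InnerProductSpace ℝ V := InnerProductSpace.ofCore c.toCore
  have h1 : Module.rank ℝ V ≤ N := by
    apply rank_le
    intro s hs
    let W : Submodule ℝ V := Submodule.span ℝ (s : Set V)
    have hW : Module.finrank ℝ W = s.card := finrank_span_finset_eq_card hs
    rw [← hW]
    let b := stdOrthonormalBasis ℝ W
    apply h _ (fun i => (b i : V))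
    intro i j
    have := orthonormal_iff_ite.1 b.orthonormal i j
    exact this
  exact Module.rank_lt_aleph0_iff.1 (h1.trans_lt (Cardinal.natCast_lt_aleph0))

variable {G : Type u} [Group G]

lemma isometric_case_aux {V : Type v} [NormedAddCommGroup V] [InnerProductSpace ℝ V]
    [FiniteDimensional ℝ V] (π : G →* Module.End ℝ V)
    (hinv : ∀ g v, inner ℝ (π g v) (π g v) = inner ℝ v v)
    {d : ℕ} (hfg : Group.FG G) (hG : PG d G) :
    (∃ K : Subgroup G, K.FiniteIndex ∧ ∃ φ : K →* Multiplicative ℤ, Function.Surjective φ) ∨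
      π.ker.FiniteIndex := by
  let ρ : G →* (V →L[ℝ] V) :=
    { toFun := fun g => LinearMap.toContinuousLinearMap (π g)
      map_one' := by
        ext v
        simp
      map_mul' := fun g h => by
        ext v
        simp }
  have hρ1 : ∀ g v, ρ g v = π g v := fun g v => rfl
  have hρ : ∀ g, ‖ρ g‖ ≤ 1 := by
    intro g
    apply ContinuousLinearMap.opNorm_le_bound _ zero_le_one
    intro v
    rw [one_mul, hρ1]
    have h1 := hinv g v
    rw [real_inner_self_eq_norm_sq, real_inner_self_eq_norm_sq] at h1
    exact (pow_le_pow_iff_left₀ (norm_nonneg _) (norm_nonneg _) two_ne_zero).1 h1.le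
  have htb : TotallyBounded (Set.range ρ) := by
    have : ProperSpace (V →L[ℝ] V) := FiniteDimensional.proper ℝ (V →L[ℝ] V)
    apply ((isCompact_closedBall (0 : V →L[ℝ] V) 1).totallyBounded).subset
    rintro _ ⟨g, rfl⟩
    simpa using hρ g
  have hker : ρ.ker = π.ker := by
    ext g
    rw [MonoidHom.mem_ker, MonoidHom.mem_ker]
    constructor
    · intro h
      ext v
      rw [← hρ1, h]
      rfl
    · intro h
      ext v
      rw [hρ1, h]
      rfl
  rw [← hker]
  exact compact_case ρ hρ hfg hG htb

lemma isometric_case {V : Type v} [AddCommGroup V] [Module ℝ V] (c : InnerProductSpace.Core ℝ V)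
    (hfd : FiniteDimensional ℝ V) (π : G →* Module.End ℝ V)
    (hinv : ∀ g v, c.inner (π g v) (π g v) = c.inner v v)
    {d : ℕ} (hfg : Group.FG G) (hG : PG d G) :
    (∃ K : Subgroup G, K.FiniteIndex ∧ ∃ φ : K →* Multiplicative ℤ, Function.Surjective φ) ∨
      π.ker.FiniteIndex := by
  let i1 : NormedAddCommGroup V := c.toNormedAddCommGroup
  let i2 : InnerProductSpace ℝ V := InnerProductSpace.ofCore c.toCore
  exact isometric_case_aux π hinv hfg hG

/-- Lipschitz harmonic functions vanishing at the identity. -/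
def LH (S : Finset G) : Submodule ℝ (G → ℝ) where
  carrier := {f | Lip S f ∧ mk S f = f ∧ f 1 = 0}
  add_mem' := by
    rintro f g ⟨⟨a, ha⟩, hf1, hf2⟩ ⟨⟨b, hb⟩, hg1, hg2⟩
    refine ⟨⟨a + b, fun x s hs => ?_⟩, by rw [map_add, hf1, hg1], by simp [hf2, hg2]⟩
    have : (f + g) (x * s) - (f + g) x = (f (x * s) - f x) + (g (x * s) - g x) := by
      simp only [Pi.add_apply]
      ring
    rw [this]
    exact (abs_add_le _ _).trans (add_le_add (ha x s hs) (hb x s hs))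
  zero_mem' := ⟨⟨0, by simp⟩, map_zero _, rfl⟩
  smul_mem' := by
    rintro c f ⟨⟨a, ha⟩, hf1, hf2⟩
    refine ⟨⟨|c| * a, fun x s hs => ?_⟩, by rw [map_smul, hf1], by simp [hf2]⟩
    simp only [Pi.smul_apply, smul_eq_mul]
    rw [← mul_sub, abs_mul]
    exact mul_le_mul_of_nonneg_left (ha x s hs) (abs_nonneg _)

lemma Ga_symm (S : Finset G) (f g : G → ℝ) : Ga S f g = Ga S g f := by
  ext x
  simp only [Ga, mul_comm]

lemma Ga_add (S : Finset G) (f g h : G → ℝ) : Ga S (f + g) h = Ga S f h + Ga S g h := by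
  ext x
  simp only [Ga, Pi.add_apply]
  rw [← mul_add, ← Finset.sum_add_distrib]
  congr 1
  apply Finset.sum_congr rfl
  intro s _
  ring

lemma Ga_smul (S : Finset G) (c : ℝ) (f h : G → ℝ) : Ga S (c • f) h = c • Ga S f h := by
  ext x
  simp only [Ga, Pi.smul_apply, smul_eq_mul]
  rw [mul_left_comm]
  congr 1
  rw [Finset.mul_sum]
  apply Finset.sum_congr rfl
  intro s _
  ring

/-- Translation action on `LH`. -/
noncomputable def act (S : Finset G) : G →* Module.End ℝ (LH S) where
  toFun g :=
    { toFun := fun f => ⟨fun x => f.1 (g⁻¹ * x) - f.1 g⁻¹, by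
        obtain ⟨f, ⟨a, ha⟩, hf1, hf2⟩ := f
        refine ⟨⟨a, fun x s hs => ?_⟩, ?_, by simp⟩
        · have := ha (g⁻¹ * x) s hs
          rw [mul_assoc] at this
          simpa using this
        · rcases S.eq_empty_or_nonempty with rfl | hS
          · have : f = 0 := by
              rw [← hf1]
              ext x
              simp [mk_apply]
            subst this
            ext x
            simp [mk_apply]
          have e : (fun x => f (g⁻¹ * x) - f g⁻¹) =
            (fun x => f (g⁻¹ * x)) - (fun _ => f g⁻¹) := rfl
          change mk S (fun x => f (g⁻¹ * x) - f g⁻¹) = fun x => f (g⁻¹ * x) - f g⁻¹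
          rw [e, map_sub, mk_const hS]
          congr 1
          ext x
          rw [mk_shift, hf1]⟩
      map_add' := fun f h => by
        ext x
        simp
        ring
      map_smul' := fun c f => by
        ext x
        simp
        ring }
  map_one' := by
    ext f x
    simp [f.2.2.2]
  map_mul' g h := by
    ext f x
    simp [mul_assoc]

lemma act_apply (S : Finset G) (g : G) (f : LH S) (x : G) :
    (act S g f).1 x = f.1 (g⁻¹ * x) - f.1 g⁻¹ := rfl

lemma main_of_harmonic {S : Finset G} (h1S : (1 : G) ∈ S) (hgen : ∀ g : G, ∃ k, g ∈ S ^ k) {d : ℕ}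
    (hfg : Group.FG G) (hG : PG d G) (f : G → ℝ) (hf : f ∈ LH S) (hf0 : f ≠ 0) :
    ∃ K : Subgroup G, K.FiniteIndex ∧ ∃ φ : K →* Multiplicative ℤ, Function.Surjective φ := by
  have hS : S.Nonempty := ⟨1, h1S⟩
  have hcard : (0 : ℝ) < S.card := by exact_mod_cast hS.card_pos
  obtain ⟨K, hK, M, madd, msmul, mmono, mconst, minv, mkey⟩ := exists_mean h1S hgen hG
  have hb : ∀ f g : LH S, Bd (Ga S f.1 g.1) := fun f g => Ga_bd f.2.1 g.2.1
  have hkey : ∀ f : LH S, ∀ x, ∀ s ∈ S, (f.1 (x * s) - f.1 x) ^ 2 ≤ K * M (Ga S f.1 f.1) :=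
    fun f => mkey f.1 f.2.2.1 f.2.1
  have hpos : ∀ f : LH S, 0 ≤ M (Ga S f.1 f.1) := by
    intro f
    rw [← mconst 0]
    apply mmono _ _ ⟨0, by simp⟩ (hb f f)
    intro x
    exact mul_nonneg (by positivity) (Finset.sum_nonneg fun s _ => mul_self_nonneg _)
  let c : InnerProductSpace.Core ℝ (LH S) :=
    { inner := fun f g => M (Ga S f.1 g.1)
      conj_inner_symm := fun f g => by
        simp [Ga_symm S g.1 f.1]
      re_inner_nonneg := hpos
      add_left := fun f g h => by
        rw [Submodule.coe_add, Ga_add, madd _ _ (hb f h) (hb g h)]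
      smul_left := fun f h r => by
        rw [Submodule.coe_smul, Ga_smul, msmul _ _ (hb f h)]
        simp
      definite := fun f h => by
        ext x
        have h1 : f.1 x = f.1 1 := by
          apply const_of_step hgen
          intro x s hs
          have h2 := hkey f x s hs
          rw [h, mul_zero] at h2
          have := pow_eq_zero_iff (two_ne_zero) |>.1 (le_antisymm h2 (sq_nonneg _))
          linarith
        rw [h1, f.2.2.2]
        rfl }
  have hcin : ∀ f g, c.inner f g = M (Ga S f.1 g.1) := fun f g => rfl
  have hfd : FiniteDimensional ℝ (LH S) := by
    apply fd_of_core c ⌈K⌉₊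
    intro D e he
    have hsum : ∀ a : Fin D → ℝ, c.inner (∑ i, a i • e i) (∑ i, a i • e i) = ∑ i, a i ^ 2 := by
      intro a
      let _ : NormedAddCommGroup (LH S) := c.toNormedAddCommGroup
      let _ : InnerProductSpace ℝ (LH S) := InnerProductSpace.ofCore c.toCore
      have ho : Orthonormal ℝ e := orthonormal_iff_ite.2 he
      have := ho.inner_sum a a Finset.univ
      refine this.trans ?_
      simp [sq]
    have hpt : ∀ x, ∀ s ∈ S, ∑ i, ((e i).1 (x * s) - (e i).1 x) ^ 2 ≤ K := by
      intro x s hs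
      set a : Fin D → ℝ := fun i => (e i).1 (x * s) - (e i).1 x with ha
      have h1 := hkey (∑ i, a i • e i) x s hs
      rw [← hcin, hsum] at h1
      have h2 : (∑ i, a i • e i : LH S).1 (x * s) - (∑ i, a i • e i : LH S).1 x = ∑ i, a i ^ 2 := by
        simp only [Submodule.coe_sum, Submodule.coe_smul, Finset.sum_apply, Pi.smul_apply,
          smul_eq_mul]
        rw [← Finset.sum_sub_distrib]
        apply Finset.sum_congr rfl
        intro i _
        rw [ha]
        ring
      rw [h2] at h1
      rcases (Finset.sum_nonneg (fun i _ => sq_nonneg (a i)) : 0 ≤ ∑ i, a i ^ 2).eq_or_lt with h | h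
      · rw [← h]
        exact hK
      · rw [sq] at h1
        exact le_of_mul_le_mul_right h1 h
    have hM : ∀ s : Finset (Fin D), Bd (∑ i ∈ s, Ga S (e i).1 (e i).1) ∧
        M (∑ i ∈ s, Ga S (e i).1 (e i).1) = s.card := by
      intro s
      induction s using Finset.induction_on with
      | empty =>
        refine ⟨⟨0, by simp⟩, ?_⟩
        rw [Finset.sum_empty, Finset.card_empty, Nat.cast_zero]
        exact mconst 0
      | insert i s hi ih =>
        obtain ⟨⟨b, hb'⟩, ih2⟩ := ih
        rw [Finset.sum_insert hi, madd _ _ (hb _ _) ⟨b, hb'⟩, ih2, ← hcin, he,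
          Finset.card_insert_of_notMem hi]
        refine ⟨?_, by simp; ring⟩
        obtain ⟨a, ha⟩ := hb (e i) (e i)
        exact ⟨a + b, fun x => (abs_add_le _ _).trans (add_le_add (ha x) (hb' x))⟩
    have hle : (D : ℝ) ≤ K := by
      have h1 := (hM Finset.univ).2
      rw [Finset.card_univ, Fintype.card_fin] at h1
      rw [← h1, ← mconst K]
      apply mmono _ _ (hM Finset.univ).1 ⟨|K|, fun _ => le_rfl⟩
      intro x
      simp only [Finset.sum_apply, Ga]
      rw [← Finset.mul_sum, Finset.sum_comm, inv_mul_le_iff₀ hcard, ← nsmul_eq_mul]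
      apply Finset.sum_le_card_nsmul
      intro s hs
      simpa only [sq] using hpt x s hs
    exact_mod_cast hle.trans (Nat.le_ceil K)
  have hinv : ∀ g v, c.inner (act S g v) (act S g v) = c.inner v v := by
    intro g v
    rw [hcin, hcin, ← minv _ g⁻¹ (hb v v)]
    congr 1
    ext x
    simp [Ga, act_apply, mul_assoc]
  rcases isometric_case c hfd (act S) hinv hfg hG with h | h
  · exact h
  refine ⟨(act S).ker, h, ?_⟩
  have hmem : ∀ g ∈ (act S).ker, ∀ x, f (g * x) = f g + f x := by
    intro g hg x
    have h1 : act S g⁻¹ = 1 := inv_mem hg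
    have h2 := act_apply S g⁻¹ ⟨f, hf⟩ x
    rw [h1, inv_inv] at h2
    have h3 : f x = f (g * x) - f g := h2
    linarith
  let φ : (act S).ker →* Multiplicative ℝ :=
    { toFun := fun g => Multiplicative.ofAdd (f g)
      map_one' := by
        have : f 1 = 0 := hf.2.2
        simp [this]
      map_mul' := fun a b => by
        rw [← ofAdd_add, ← hmem a a.2 b]
        rfl }
  have : Group.FG (act S).ker := inferInstance
  apply exists_surj_int_of_hom φ
  by_contra hfin
  rw [not_infinite_iff_finite] at hfin
  have hz : ∀ g ∈ (act S).ker, f g = 0 := by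
    intro g hg
    have ho : IsOfFinOrder (⟨φ ⟨g, hg⟩, ⟨⟨g, hg⟩, rfl⟩⟩ : φ.range) := isOfFinOrder_of_finite _
    obtain ⟨n, hn, h1⟩ := ho.exists_pow_eq_one
    have h2 : (φ ⟨g, hg⟩) ^ n = 1 := congrArg Subtype.val h1
    have h3 : (n : ℝ) * f g = 0 := by
      have := congrArg Multiplicative.toAdd h2
      simpa [φ] using this
    rcases mul_eq_zero.1 h3 with h4 | h4
    · exact absurd (by exact_mod_cast h4) hn.ne'
    · exact h4
  have hcos : ∀ x y : G, (QuotientGroup.mk x : G ⧸ (act S).ker) = QuotientGroup.mk y →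
      f x = f y := by
    intro x y hxy
    have h1 : x⁻¹ * y ∈ (act S).ker := QuotientGroup.eq.1 hxy
    have h2 : y * x⁻¹ ∈ (act S).ker :=
      (inferInstance : ((act S).ker).Normal).mem_comm h1
    have h3 := hmem _ h2 x
    rw [inv_mul_cancel_right, hz _ h2] at h3
    linarith
  have hrange : (Set.range f).Finite := by
    have := h
    have : Finite (G ⧸ (act S).ker) := Subgroup.finite_quotient_of_finiteIndex
    apply (Set.finite_range (fun q : G ⧸ (act S).ker => f q.out)).subset
    rintro _ ⟨x, rfl⟩
    refine ⟨QuotientGroup.mk x, hcos _ _ ?_⟩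
    exact Quotient.out_eq' _
  obtain ⟨_, ⟨x0, rfl⟩, hmax⟩ := hrange.exists_maximal ⟨f 1, 1, rfl⟩
  have hmax' : ∀ y, f y ≤ f x0 := by
    intro y
    by_contra hcon
    push Not at hcon
    exact absurd (hmax ⟨y, rfl⟩ hcon.le) (not_le.2 hcon)
  have hall : ∀ x, f (x0 * x) = f x0 := by
    intro x
    have key : ∀ k, ∀ y ∈ S ^ k, f (x0 * y) = f x0 := by
      intro k
      induction k with
      | zero =>
        intro y hy
        rw [pow_zero, Finset.mem_one] at hy
        rw [hy, mul_one]
      | succ k ih =>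
        intro y hy
        rw [pow_succ] at hy
        obtain ⟨z, hz', s, hs, rfl⟩ := Finset.mem_mul.1 hy
        have h1 := ih z hz'
        have h2 := congrFun hf.2.1 (x0 * z)
        rw [mk_apply, h1, inv_mul_eq_iff_eq_mul₀ hcard.ne', ← nsmul_eq_mul,
          ← Finset.sum_const] at h2
        have h3 := (Finset.sum_eq_sum_iff_of_le (fun t _ => hmax' (x0 * z * t))).1 h2 s hs
        rw [← mul_assoc]
        exact h3
    obtain ⟨k, hk⟩ := hgen x
    exact key k x hk
  apply hf0
  ext x
  have h1 := hall (x0⁻¹ * x)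
  have h2 := hall (x0⁻¹ * 1)
  rw [mul_inv_cancel_left] at h1 h2
  rw [h1, ← h2, hf.2.2]
  rfl

end Rep

end Gromov

namespace Gromov

section Harmonic

open scoped Pointwise Classical Topology

universe u

variable {G : Type u} [Group G]

lemma pair_symm (u v : G →₀ ℝ) : pair v u = pair u v := by
  rw [pair_eq v u (B := u.support ∪ v.support) (fun x hx => by simp [hx]),
    pair_eq u v (B := u.support ∪ v.support) (fun x hx => by simp [hx])]
  simp only [mul_comm]

/-- Inner product of finitely supported functions. -/
noncomputable def ip : (G →₀ ℝ) →ₗ[ℝ] (G →₀ ℝ) →ₗ[ℝ] ℝ :=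
  LinearMap.mk₂ ℝ (fun u v => pair v u) (fun _ _ _ => map_add _ _ _) (fun _ _ _ => map_smul _ _ _)
    (fun m n n' => by
      rw [pair_symm, map_add, pair_symm, pair_symm m n'])
    (fun c m n => by
      rw [pair_symm, map_smul, pair_symm])

lemma ip_def (u v : G →₀ ℝ) : ip u v = pair v u := rfl

lemma ip_symm (u v : G →₀ ℝ) : ip u v = ip v u := pair_symm u v

lemma ip_eq (u v : G →₀ ℝ) {B : Finset G} (hB : ∀ x, u x ≠ 0 → x ∈ B) :
    ip u v = ∑ x ∈ B, u x * v x := pair_eq v u hB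

lemma ip_self_nonneg (u : G →₀ ℝ) : 0 ≤ ip u u := by
  rw [ip_eq u u (B := u.support) (fun x hx => by simp [hx])]
  exact Finset.sum_nonneg fun x _ => mul_self_nonneg _

lemma sq_le_ip (u : G →₀ ℝ) (x : G) : u x ^ 2 ≤ ip u u := by
  rw [ip_eq u u (B := insert x u.support) (fun y hy => by simp [hy]), sq]
  exact Finset.single_le_sum (f := fun x => u x * u x) (fun y _ => mul_self_nonneg _)
    (Finset.mem_insert_self _ _)

lemma ip_cs (u v : G →₀ ℝ) : ip u v ^ 2 ≤ ip u u * ip v v := by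
  have hu : ∀ x, u x ≠ 0 → x ∈ u.support ∪ v.support := fun x hx => by simp [hx]
  have hv : ∀ x, v x ≠ 0 → x ∈ u.support ∪ v.support := fun x hx => by simp [hx]
  rw [ip_eq u v hu, ip_eq u u hu, ip_eq v v hv]
  simpa only [sq] using Finset.sum_mul_sq_le_sq_mul_sq (u.support ∪ v.support) u v

lemma ip_lt (g : G) (u v : G →₀ ℝ) : ip (lt g u) (lt g v) = ip u v := by
  rw [ip_def, ip_def, pair_lt]
  congr 1
  congr 1
  ext x
  simp [lt_apply]

lemma ip_lt_left (g : G) (u v : G →₀ ℝ) : ip (lt g u) v = ip u (lt g⁻¹ v) := by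
  rw [← ip_lt g u, ← lt_mul, mul_inv_cancel, lt_one]

lemma ip_av_left (S : Finset G) (u v : G →₀ ℝ) :
    ip (av S u) v = (S.card : ℝ)⁻¹ * ∑ s ∈ S, ip (lt s u) v := by
  rw [av_eq]
  simp [LinearMap.sum_apply]

lemma ip_av_symm {S : Finset G} (hinv : ∀ x ∈ S, x⁻¹ ∈ S) (u v : G →₀ ℝ) :
    ip (av S u) v = ip u (av S v) := by
  rw [ip_av_left, ip_symm u, ip_av_left]
  congr 1
  refine Finset.sum_nbij' (fun s => s⁻¹) (fun s => s⁻¹) hinv hinv (by simp) (by simp) ?_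
  intro s _
  rw [ip_lt_left, ip_symm]

/-- Dirichlet energy. -/
noncomputable def en (S : Finset G) (u : G →₀ ℝ) : ℝ := ip (u - av S u) u

lemma en_sum {S : Finset G} (hS : S.Nonempty) (u : G →₀ ℝ) :
    ∑ s ∈ S, ip (lt s u - u) (lt s u - u) = 2 * S.card * en S u := by
  have hc : (S.card : ℝ) ≠ 0 := by exact_mod_cast hS.card_pos.ne'
  have h1 : ∀ s ∈ S, ip (lt s u - u) (lt s u - u) = 2 * ip u u - 2 * ip (lt s u) u := by
    intro s _
    simp only [map_sub, LinearMap.sub_apply]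
    rw [ip_lt, ip_symm u (lt s u)]
    ring
  rw [Finset.sum_congr rfl h1, Finset.sum_sub_distrib, en, map_sub,
    LinearMap.sub_apply, ip_av_left]
  simp
  field_simp
  rw [← Finset.mul_sum]
  ring

lemma en_ge {S : Finset G} (u : G →₀ ℝ) {s : G} (hs : s ∈ S) :
    ip (lt s u - u) (lt s u - u) ≤ 2 * S.card * en S u := by
  rw [← en_sum ⟨s, hs⟩]
  exact Finset.single_le_sum (f := fun s => ip (lt s u - u) (lt s u - u))
    (fun _ _ => ip_self_nonneg _) hs

lemma en_nonneg {S : Finset G} (hS : S.Nonempty) (u : G →₀ ℝ) : 0 ≤ en S u := by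
  obtain ⟨s, hs⟩ := hS
  have h := (ip_self_nonneg _).trans (en_ge u hs)
  have hc : (0 : ℝ) < S.card := by exact_mod_cast (Finset.card_pos.2 ⟨s, hs⟩)
  exact nonneg_of_mul_nonneg_right h (by positivity)

lemma step_bound {S : Finset G} (u : G →₀ ℝ) (k : ℕ) (g : G) (hg : g ∈ S ^ k)
    (x : G) : |u (g⁻¹ * x) - u x| ≤ k * √(2 * S.card * en S u) := by
  induction k generalizing g x with
  | zero =>
    rw [pow_zero, Finset.mem_one] at hg
    simp [hg]
  | succ k ih =>
    rw [pow_succ] at hg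
    obtain ⟨h, hh, s, hs, rfl⟩ := Finset.mem_mul.1 hg
    have h1 := ih h hh x
    have h2 : |u (s⁻¹ * (h⁻¹ * x)) - u (h⁻¹ * x)| ≤ √(2 * S.card * en S u) := by
      apply Real.abs_le_sqrt
      refine le_trans ?_ (en_ge u hs)
      have := sq_le_ip (lt s u - u) (h⁻¹ * x)
      rwa [Finsupp.sub_apply, lt_apply] at this
    have h3 : u ((h * s)⁻¹ * x) - u x =
        (u (s⁻¹ * (h⁻¹ * x)) - u (h⁻¹ * x)) + (u (h⁻¹ * x) - u x) := by
      rw [mul_inv_rev, mul_assoc]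
      ring
    rw [h3]
    refine (abs_add_le _ _).trans ?_
    push_cast
    linarith

lemma exists_boundary [Infinite G] {S : Finset G} (h1S : (1 : G) ∈ S)
    (hgen : ∀ g : G, ∃ k, g ∈ S ^ k) (k : ℕ) : ∃ y ∈ S ^ (k + 1), y ∉ S ^ k := by
  by_contra hcon
  push Not at hcon
  have h1 : ∀ j, S ^ j ⊆ S ^ k := by
    intro j
    induction j with
    | zero =>
      intro x hx
      rw [pow_zero, Finset.mem_one] at hx
      rw [hx]
      exact Finset.one_mem_pow h1S
    | succ j ih =>
      intro x hx
      apply hcon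
      rw [pow_succ] at hx ⊢
      exact Finset.mul_subset_mul_right ih hx
  obtain ⟨y, hy⟩ := Infinite.exists_notMem_finset (S ^ k)
  obtain ⟨j, hj⟩ := hgen y
  exact hy (h1 j hj)

lemma inv_mem_pow {S : Finset G} (hinv : ∀ x ∈ S, x⁻¹ ∈ S) (k : ℕ) :
    ∀ x ∈ S ^ k, x⁻¹ ∈ S ^ k := by
  induction k with
  | zero =>
    intro x hx
    rw [pow_zero, Finset.mem_one] at hx ⊢
    rw [hx, inv_one]
  | succ k ih =>
    intro x hx
    rw [pow_succ] at hx
    obtain ⟨y, hy, s, hs, rfl⟩ := Finset.mem_mul.1 hx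
    rw [pow_succ', mul_inv_rev]
    exact Finset.mul_mem_mul (hinv s hs) (ih y hy)

lemma en_p_lower [Infinite G] {S : Finset G} (h1S : (1 : G) ∈ S) (hinv : ∀ x ∈ S, x⁻¹ ∈ S)
    (hgen : ∀ g : G, ∃ k, g ∈ S ^ k) (k : ℕ) :
    1 ≤ ((S ^ k).card : ℝ) ^ 2 * ((2 * k + 1) ^ 2 * (2 * S.card * en S (p S k))) := by
  have hS : S.Nonempty := ⟨1, h1S⟩
  have hc : (0 : ℝ) < (S ^ k).card := by exact_mod_cast (hS.pow).card_pos
  obtain ⟨y, hy1, hy2⟩ := exists_boundary h1S hgen k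
  have hx : ∃ x ∈ S ^ k, 1 / ((S ^ k).card : ℝ) ≤ p S k x := by
    by_contra hcon
    push Not at hcon
    have h1 := Finset.sum_lt_sum_of_nonempty (hS.pow) hcon
    rw [p_sum hS k subset_rfl, Finset.sum_const, nsmul_eq_mul, mul_one_div_cancel hc.ne'] at h1
    exact lt_irrefl _ h1
  obtain ⟨x, hx1, hx2⟩ := hx
  have hg : x * y⁻¹ ∈ S ^ (2 * k + 1) := by
    have e : 2 * k + 1 = k + (k + 1) := by ring
    rw [e, pow_add]
    exact Finset.mul_mem_mul hx1 (inv_mem_pow hinv _ _ hy1)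
  have h1 := step_bound (p S k) _ _ hg x
  have h2 : p S k y = 0 := by
    by_contra h
    exact hy2 (p_supp S k y h)
  rw [mul_inv_rev, inv_inv, inv_mul_cancel_right, h2, zero_sub, abs_neg,
    abs_of_nonneg (p_nonneg _ _ _)] at h1
  have hen : 0 ≤ 2 * S.card * en S (p S k) := mul_nonneg (by positivity) (en_nonneg hS _)
  have h3 := hx2.trans h1
  rw [div_le_iff₀ hc] at h3
  have h4 := pow_le_pow_left₀ zero_le_one h3 2
  rw [one_pow, mul_pow, mul_pow, Real.sq_sqrt hen] at h4
  push_cast at h4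
  linarith

lemma ip_p {S : Finset G} (hinv : ∀ x ∈ S, x⁻¹ ∈ S) (i j : ℕ) :
    ip (p S i) (p S j) = ip (p S (i + j)) (p S 0) := by
  induction j generalizing i with
  | zero => rfl
  | succ j ih =>
    have : p S (j + 1) = av S (p S j) := rfl
    rw [this, ← ip_av_symm hinv]
    have h2 : av S (p S i) = p S (i + 1) := rfl
    rw [h2, ih]
    congr 2
    congr 1
    ring

lemma ip_av_ge {S : Finset G} (h1S : (1 : G) ∈ S) (v : G →₀ ℝ) :
    - (1 - 2 / S.card) * ip v v ≤ ip (av S v) v := by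
  have hS : S.Nonempty := ⟨1, h1S⟩
  have hc : (0 : ℝ) < S.card := by exact_mod_cast hS.card_pos
  have h1 : ∀ s, 0 ≤ ip (lt s v) v + ip v v := by
    intro s
    have := ip_self_nonneg (lt s v + v)
    simp only [map_add, LinearMap.add_apply] at this
    rw [ip_lt, ip_symm v (lt s v)] at this
    linarith
  have h2 := Finset.single_le_sum (f := fun s => ip (lt s v) v + ip v v) (fun s _ => h1 s) h1S
  simp only [lt_one] at h2
  rw [Finset.sum_add_distrib, Finset.sum_const, nsmul_eq_mul] at h2
  rw [ip_av_left]
  have h3 : ∑ s ∈ S, ip (lt s v) v ≥ (2 - S.card) * ip v v := by linarith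
  calc - (1 - 2 / S.card) * ip v v = (S.card : ℝ)⁻¹ * ((2 - S.card) * ip v v) := by
        field_simp
        ring
    _ ≤ _ := by gcongr

lemma exists_almost [Infinite G] {S : Finset G} (h1S : (1 : G) ∈ S) (hinv : ∀ x ∈ S, x⁻¹ ∈ S)
    (hgen : ∀ g : G, ∃ k, g ∈ S ^ k) {d : ℕ} (hG : PG d G) {ε : ℝ} (hε : 0 < ε) :
    ∃ u : G →₀ ℝ, 0 < en S u ∧ ip (u - av S u) (u - av S u) ≤ ε * en S u := by
  have hS : S.Nonempty := ⟨1, h1S⟩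
  have hc : (0 : ℝ) < S.card := by exact_mod_cast hS.card_pos
  have h2c : 0 < 2 / (S.card : ℝ) := by positivity
  by_contra hcon
  push Not at hcon
  have hpos : ∀ k, 0 < en S (p S k) := by
    intro k
    refine lt_of_le_of_ne (en_nonneg hS _) (fun h => ?_)
    have := en_p_lower h1S hinv hgen k
    rw [← h] at this
    norm_num at this
  set c : ℕ → ℝ := fun n => ip (p S n) (p S 0) with hcdef
  have hav : ∀ k, av S (p S k) = p S (k + 1) := fun k => rfl
  have hic : ∀ i j m, i + j = m → ip (p S i) (p S j) = c m := by
    rintro i j m rfl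
    exact ip_p hinv i j
  have hd : ∀ k, en S (p S k) = c (2 * k) - c (2 * k + 1) := by
    intro k
    rw [en, hav, map_sub, LinearMap.sub_apply, hic k k (2 * k) (by ring),
      hic (k + 1) k (2 * k + 1) (by ring)]
  have hT : ∀ k, ip (p S k - av S (p S k)) (p S k - av S (p S k)) =
      c (2 * k) - 2 * c (2 * k + 1) + c (2 * k + 2) := by
    intro k
    rw [hav]
    simp only [map_sub, LinearMap.sub_apply]
    rw [hic k k (2 * k) (by ring), hic (k + 1) k (2 * k + 1) (by ring),
      hic k (k + 1) (2 * k + 1) (by ring), hic (k + 1) (k + 1) (2 * k + 2) (by ring)]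
    ring
  have hPT : ∀ k, ip (av S (p S k - av S (p S k))) (p S k - av S (p S k)) =
      c (2 * k + 1) - 2 * c (2 * k + 2) + c (2 * k + 3) := by
    intro k
    simp only [map_sub, LinearMap.sub_apply, hav]
    rw [hic (k + 1) k (2 * k + 1) (by ring), hic (k + 1 + 1) k (2 * k + 2) (by ring),
      hic (k + 1) (k + 1) (2 * k + 2) (by ring), hic (k + 1 + 1) (k + 1) (2 * k + 3) (by ring)]
    ring
  set r : ℝ := 1 - 2 / S.card * ε with hr
  have hr1 : r < 1 := by
    have : 0 < 2 / (S.card : ℝ) * ε := mul_pos h2c hε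
    linarith
  have hdec : ∀ k, en S (p S (k + 1)) ≤ r * en S (p S k) := by
    intro k
    have h1 := hcon (p S k) (hpos k)
    have h2 := ip_av_ge h1S (p S k - av S (p S k))
    rw [hPT, hT] at h2
    rw [hT] at h1
    have h3 := hd (k + 1)
    have e1 : 2 * (k + 1) = 2 * k + 2 := by ring
    rw [e1] at h3
    have h4 : 2 / (S.card : ℝ) * (ε * en S (p S k)) ≤
        2 / (S.card : ℝ) * (c (2 * k) - 2 * c (2 * k + 1) + c (2 * k + 2)) :=
      mul_le_mul_of_nonneg_left h1.le h2c.le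
    have h5 := hd k
    rw [h3, hr]
    have h6 : 2 * k + 2 + 1 = 2 * k + 3 := by ring
    rw [h6]
    linarith
  have hr0 : 0 < r := by
    have h1 := (hpos 1).trans_le (hdec 0)
    exact pos_of_mul_pos_left h1 (hpos 0).le
  have hexp : ∀ k, en S (p S k) ≤ r ^ k * en S (p S 0) := by
    intro k
    induction k with
    | zero => simp
    | succ k ih =>
      refine (hdec k).trans ?_
      rw [pow_succ', mul_assoc]
      exact mul_le_mul_of_nonneg_left ih hr0.le
  obtain ⟨C, hC⟩ := hG S
  obtain ⟨k, hk⟩ := exists_poly_lt_exp ((C : ℝ) ^ 2 * (4 * (2 * S.card * en S (p S 0))))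
    (2 * d + 2) ((one_lt_inv₀ hr0).2 hr1)
  have h1 := en_p_lower h1S hinv hgen k
  have hCk : ((S ^ k).card : ℝ) ≤ C * ((k : ℝ) + 1) ^ d := by exact_mod_cast hC k
  have h2 : 1 ≤ (C * ((k : ℝ) + 1) ^ d) ^ 2 * ((2 * (k + 1)) ^ 2 *
      (2 * S.card * (r ^ k * en S (p S 0)))) := by
    refine h1.trans ?_
    have h3 := (hpos k).le
    have h4 := hexp k
    clear_value c r
    clear hdec hT hPT hd hic hav hcon hexp hpos hcdef hr
    clear c
    generalize en S (p S 0) = e0 at *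
    generalize en S (p S k) = e1 at *
    gcongr
    linarith
  rw [inv_pow, ← one_div, lt_div_iff₀ (pow_pos hr0 k)] at hk
  exact absurd hk (not_lt.2 (h2.trans_eq (by ring)))

lemma mk_ip {S : Finset G} (hS : S.Nonempty) (u v : G →₀ ℝ) (x : G) :
    mk S (fun y => ip (lt y u - u) v) x - ip (lt x u - u) v = - ip (lt x (u - av S u)) v := by
  have hc : (S.card : ℝ) ≠ 0 := by exact_mod_cast hS.card_pos.ne'
  rw [mk_apply, av_eq]
  simp only [map_sub, LinearMap.sub_apply, lt_mul, map_smul, map_sum, LinearMap.smul_apply,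
    LinearMap.sum_apply, smul_eq_mul]
  rw [Finset.sum_sub_distrib]
  simp
  field_simp
  ring

lemma exists_approx [Infinite G] {S : Finset G} (h1S : (1 : G) ∈ S) (hinv : ∀ x ∈ S, x⁻¹ ∈ S)
    (hgen : ∀ g : G, ∃ k, g ∈ S ^ k) {d : ℕ} (hG : PG d G) {ε : ℝ} (hε : 0 < ε) :
    ∃ f : G → ℝ, f 1 = 0 ∧ (∀ x, ∀ s ∈ S, |f (x * s) - f x| ≤ 2 * S.card) ∧
      (∀ x, |mk S f x - f x| ≤ ε) ∧ ∃ s ∈ S, 1 ≤ f s := by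
  have hS : S.Nonempty := ⟨1, h1S⟩
  have hc : (1 : ℝ) ≤ S.card := by exact_mod_cast hS.card_pos
  obtain ⟨u, hu1, hu2⟩ := exists_almost h1S hinv hgen hG (pow_pos hε 2)
  have hs : ∃ s ∈ S, 2 * en S u ≤ ip (lt s u - u) (lt s u - u) := by
    by_contra hcon
    push Not at hcon
    have h1 := Finset.sum_lt_sum_of_nonempty hS hcon
    rw [en_sum hS, Finset.sum_const, nsmul_eq_mul] at h1
    linarith
  obtain ⟨s, hs, hs2⟩ := hs
  set v := lt s u - u with hv
  set a := ip v v with ha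
  have ha0 : 0 < a := by linarith
  set b := √(en S u * a) with hb
  have hb0 : 0 < b := Real.sqrt_pos.2 (mul_pos hu1 ha0)
  have hb2 : b ^ 2 = en S u * a := Real.sq_sqrt (mul_pos hu1 ha0).le
  have hcs : ∀ w : G →₀ ℝ, ∀ t : ℝ, 0 ≤ t → ip w w ≤ t ^ 2 * en S u → |b⁻¹ * ip w v| ≤ t := by
    intro w t ht hw
    rw [abs_mul, abs_of_pos (inv_pos.2 hb0), inv_mul_le_iff₀ hb0]
    apply abs_le_of_sq_le_sq _ (mul_nonneg hb0.le ht)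
    refine (ip_cs w v).trans ?_
    rw [mul_pow, hb2]
    calc ip w w * ip v v ≤ (t ^ 2 * en S u) * ip v v :=
          mul_le_mul_of_nonneg_right hw (ip_self_nonneg v)
      _ = _ := by rw [← ha]; ring
  refine ⟨fun x => b⁻¹ * ip (lt x u - u) v, ?_, ?_, ?_, s, hs, ?_⟩
  · simp [lt_one]
  · intro x t ht
    have e : b⁻¹ * ip (lt (x * t) u - u) v - b⁻¹ * ip (lt x u - u) v =
        b⁻¹ * ip (lt x (lt t u - u)) v := by
      simp only [map_sub, LinearMap.sub_apply, lt_mul]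
      ring
    beta_reduce
    rw [e]
    apply hcs _ _ (by positivity)
    rw [ip_lt]
    refine (en_ge u ht).trans ?_
    apply mul_le_mul_of_nonneg_right _ hu1.le
    nlinarith
  · intro x
    have e : mk S (fun x => b⁻¹ * ip (lt x u - u) v) = b⁻¹ • mk S (fun x => ip (lt x u - u) v) := by
      rw [← map_smul]
      rfl
    rw [e, Pi.smul_apply, smul_eq_mul, ← mul_sub, mk_ip hS, mul_neg, abs_neg]
    apply hcs _ _ hε.le
    rw [ip_lt]
    exact hu2
  · change 1 ≤ b⁻¹ * ip v v
    rw [← ha, le_inv_mul_iff₀ hb0, mul_one]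
    apply Real.sqrt_le_iff.2 ⟨ha0.le, ?_⟩
    nlinarith

lemma exists_harmonic [Infinite G] {S : Finset G} (h1S : (1 : G) ∈ S) (hinv : ∀ x ∈ S, x⁻¹ ∈ S)
    (hgen : ∀ g : G, ∃ k, g ∈ S ^ k) {d : ℕ} (hG : PG d G) : ∃ f ∈ LH S, f ≠ 0 := by
  have hS : S.Nonempty := ⟨1, h1S⟩
  have happ : ∀ n : ℕ, ∃ f : G → ℝ, f 1 = 0 ∧ (∀ x, ∀ s ∈ S, |f (x * s) - f x| ≤ 2 * S.card) ∧
      (∀ x, |mk S f x - f x| ≤ 1 / ((n : ℝ) + 1)) ∧ ∃ s ∈ S, 1 ≤ f s :=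
    fun n => exists_approx h1S hinv hgen hG (by positivity)
  choose F hF1 hF2 hF3 hF4 using happ
  have hbd : ∀ x : G, ∃ c : ℝ, ∀ n, |F n x| ≤ c := by
    intro x
    obtain ⟨k, hk⟩ := hgen x
    refine ⟨k * (2 * S.card), fun n => ?_⟩
    induction k generalizing x with
    | zero =>
      rw [pow_zero, Finset.mem_one] at hk
      rw [hk, hF1]
      simp
    | succ k ih =>
      rw [pow_succ] at hk
      obtain ⟨y, hy, s, hs, rfl⟩ := Finset.mem_mul.1 hk
      have h1 := ih y hy
      have h2 := hF2 n y s hs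
      have h3 : F n (y * s) = (F n (y * s) - F n y) + F n y := by ring
      rw [h3]
      refine (abs_add_le _ _).trans ?_
      push_cast
      linarith
  let U : Ultrafilter ℕ := Ultrafilter.of Filter.atTop
  have hU : (U : Filter ℕ) ≤ Filter.atTop := Ultrafilter.of_le _
  have hlim : ∀ x, ∃ l, Filter.Tendsto (fun n => F n x) U (𝓝 l) := by
    intro x
    obtain ⟨c, hc⟩ := hbd x
    exact exists_lim U hc
  choose f hf using hlim
  refine ⟨f, ⟨⟨2 * S.card, ?_⟩, ?_, ?_⟩, ?_⟩
  · intro x s hs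
    exact le_of_tendsto ((hf (x * s)).sub (hf x)).abs
      (Filter.Eventually.of_forall fun n => hF2 n x s hs)
  · ext x
    have h1 : Filter.Tendsto (fun n => mk S (F n) x) U (𝓝 (mk S f x)) := by
      simp only [mk_apply]
      exact (tendsto_finsetSum _ fun s _ => hf (x * s)).const_mul _
    have h2 : Filter.Tendsto (fun n => mk S (F n) x - F n x) U (𝓝 0) :=
      squeeze_zero_norm (fun n => hF3 n x)
        ((tendsto_one_div_add_atTop_nhds_zero_nat (𝕜 := ℝ)).mono_left hU)
    have h3 := tendsto_nhds_unique h2 (h1.sub (hf x))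
    linarith
  · refine tendsto_nhds_unique (hf 1) ?_
    simp only [hF1]
    exact tendsto_const_nhds
  · intro h0
    have h1 : Filter.Tendsto (fun n => ∑ s ∈ S, |F n s|) U (𝓝 (∑ s ∈ S, |f s|)) :=
      tendsto_finsetSum _ fun s _ => (hf s).abs
    have h2 : 1 ≤ ∑ s ∈ S, |f s| := by
      refine ge_of_tendsto h1 (Filter.Eventually.of_forall fun n => ?_)
      obtain ⟨s, hs, h3⟩ := hF4 n
      exact (h3.trans (le_abs_self _)).trans
        (Finset.single_le_sum (f := fun s => |F n s|) (fun _ _ => abs_nonneg _) hs)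
    rw [h0] at h2
    norm_num at h2

/-- The main step: infinite groups of polynomial growth virtually surject onto `ℤ`. -/
theorem main_step (G : Type u) [Group G] (d : ℕ) (hfg : Group.FG G) (hG : PG d G)
    (hinf : Infinite G) :
    ∃ K : Subgroup G, K.FiniteIndex ∧ ∃ φ : K →* Multiplicative ℤ, Function.Surjective φ := by
  obtain ⟨T, hT⟩ := Group.fg_def.1 hfg
  have h1 := one_mem_symmSet T
  have hinv := inv_mem_symmSet T
  have hgen : ∀ g : G, ∃ k, g ∈ symmSet T ^ k := by
    intro g
    apply exists_pow_of_mem_closure h1 hinv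
    rw [closure_symmSet, hT]
    trivial
  obtain ⟨f, hf, hf0⟩ := exists_harmonic h1 hinv hgen hG
  exact main_of_harmonic h1 hgen hfg hG f hf hf0

end Harmonic

end Gromov

namespace Gromov

section Assembly

open scoped Pointwise Classical commutatorElement

universe u

theorem vnil_of_main
    (hmain : ∀ (G : Type u) [Group G] (d : ℕ), Group.FG G → PG d G → Infinite G →
      ∃ K : Subgroup G, K.FiniteIndex ∧ ∃ φ : K →* Multiplicative ℤ, Function.Surjective φ)
    (d : ℕ) : ∀ (G : Type u) [Group G], Group.FG G → PG d G →
      ∃ H : Subgroup G, Group.IsNilpotent H ∧ H.FiniteIndex := by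
  induction d with
  | zero =>
    intro G _ hfg hG
    rcases finite_or_infinite G with hf | hinf
    · exact ⟨⊥, inferInstance, inferInstance⟩
    · obtain ⟨K, hK, φ, hφ⟩ := hmain G 0 hfg hG hinf
      obtain ⟨d', hd', -⟩ := pg_ker (hG.subgroup K) φ hφ
      exact absurd hd' (by lia)
  | succ d ih =>
    intro G _ hfg hG
    rcases finite_or_infinite G with hf | hinf
    · exact ⟨⊥, inferInstance, inferInstance⟩
    obtain ⟨K, hK, φ, hφ⟩ := hmain G _ hfg hG hinf
    have hKfg : Group.FG K := inferInstance
    obtain ⟨d', hd', hker⟩ := pg_ker (hG.subgroup K) φ hφ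
    obtain rfl : d = d' := by lia
    have hNfg : Group.FG φ.ker :=
      (Group.fg_iff_subgroup_fg _).2 (ker_fg hKfg (hG.subgroup K).wpg φ hφ)
    obtain ⟨H, hHnil, hHfin⟩ := ih φ.ker hNfg hker
    obtain ⟨M, hMchar, hMnil, hMfin⟩ := exists_characteristic H hHnil hHfin
    have hMfg : Group.FG M := inferInstance
    set M' : Subgroup K := M.map φ.ker.subtype with hM'
    have hM'n : M'.Normal := inferInstance
    have hM'fg : M'.FG := fg_map ((Group.fg_iff_subgroup_fg _).1 hMfg) _
    obtain ⟨c, hc⟩ := (Subgroup.isNilpotent_iff_lowerCentralSeries M).1 hMnil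
    have hc' : M'.lowerCentralSeries c = ⊥ := by
      rw [hM', ← Subgroup.map_lowerCentralSeries, hc, Subgroup.map_bot]
    obtain ⟨t, ht⟩ := hφ (Multiplicative.ofAdd 1)
    obtain ⟨a, ha, hnil⟩ := nil_ext c K (hG.subgroup K).wpg M' hM'fg hc' t
    set L : Subgroup K := M' ⊔ Subgroup.zpowers (t ^ a) with hL
    have hLfin : L.FiniteIndex := by
      have hq : Finite (K ⧸ L) := by
        refine Finite.of_surjective (fun p : Fin a × (φ.ker ⧸ M) =>
          (QuotientGroup.mk (t ^ (p.1 : ℕ) * (p.2.out : K)) : K ⧸ L)) ?_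
        intro q
        obtain ⟨k, rfl⟩ := QuotientGroup.mk_surjective q
        set j : ℤ := (φ k).toAdd with hj
        set i : ℤ := j % a with hi
        set s : ℤ := j / a with hs
        have hia : 0 ≤ i := Int.emod_nonneg _ (by lia)
        have hia' : i < a := Int.emod_lt_of_pos _ (by lia)
        have hji : j = i + a * s := (Int.emod_add_mul_ediv j a).symm
        have htz : ∀ n : ℤ, φ (t ^ n) = Multiplicative.ofAdd n := by
          intro n
          rw [map_zpow, ht, ← ofAdd_zsmul]
          simp
        have hn : t ^ (-i) * k * t ^ (-(a * s)) ∈ φ.ker := by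
          rw [MonoidHom.mem_ker, map_mul, map_mul, htz, htz]
          apply Multiplicative.toAdd.injective
          rw [toAdd_mul, toAdd_mul, ← hj, toAdd_ofAdd, toAdd_ofAdd, toAdd_one]
          lia
        obtain ⟨m, hm⟩ := QuotientGroup.mk_out_eq_mul M ⟨_, hn⟩
        refine ⟨(⟨i.toNat, by lia⟩, QuotientGroup.mk ⟨_, hn⟩), ?_⟩
        simp only
        rw [hm, QuotientGroup.eq]
        have h1 : t ^ (i.toNat) = t ^ i := by
          rw [← zpow_natCast, Int.toNat_of_nonneg hia]
        rw [h1]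
        have h2 : (t ^ i * (((⟨t ^ (-i) * k * t ^ (-(a * s)), hn⟩ : φ.ker) * (m : φ.ker) : φ.ker) : K))⁻¹
            * k = ((m : φ.ker) : K)⁻¹ * (t ^ a) ^ s := by
          rw [Subgroup.coe_mul, ← zpow_natCast t a, ← zpow_mul]
          simp only
          group
        rw [h2]
        refine mul_mem (inv_mem (Subgroup.mem_sup_left ?_)) (Subgroup.mem_sup_right ?_)
        · exact ⟨m, m.2, rfl⟩
        · exact Subgroup.zpow_mem_zpowers _ _
      exact Subgroup.finiteIndex_of_finite_quotient
    refine ⟨L.map K.subtype, ?_, ?_⟩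
    · exact (Group.isNilpotent_congr (L.equivMapOfInjective K.subtype K.subtype_injective)).1 hnil
    · constructor
      rw [Subgroup.index_map_subtype]
      exact mul_ne_zero hLfin.index_ne_zero hK.index_ne_zero

end Assembly

end Gromov

/-- **Gromov's polynomial growth theorem.** A finitely generated group `Γ` has polynomial
growth if and only if `Γ` is almost (virtually) nilpotent, i.e. it contains a nilpotent
subgroup of finite index. -/
theorem gromov_polynomial_growth (G : Type*) [Group G] (hfg : Group.FG G) :
    HasPolynomialGrowth G ↔
      ∃ H : Subgroup G, Group.IsNilpotent H ∧ H.FiniteIndex := by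
  constructor
  · intro h
    obtain ⟨d, hd⟩ := Gromov.exists_pg_of_hasPolynomialGrowth h
    exact Gromov.vnil_of_main (fun G _ d => Gromov.main_step G d) d G hfg hd
  · rintro ⟨H, hH, hfin⟩
    exact Gromov.hasPolynomialGrowth_of_wpg hfg (Gromov.wpg_of_virtually_nilpotent H hH hfin)
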